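/- arXiv:1909.00601 — 4 statements merged into one kernel-verified Lean document; each statement's English description precedes it below -/
import Mathlib

section
/- Factorization of the Dirichlet series: Fix a function f from primes to positive reals with log f(p) = o(log p), and let G_f(s) = Σ_{p prime} f(p)/p^s for Re s > 1. Let α be a multiplicative function with α(p) = f(p) + O((log p)^{−2}) and Σ_{k ≥ 2} k·α(p^k)/p^k = O(1/(p·(log p)²)) for all primes p, and let F(s) = Σ_{n ≥ 1} α(n)/n^s. Then for Re s > 1, F(s) = φ(s)·e^{G_f(s)}, where φ is a function on {Re s ≥ 1} that is differentiable, bounded, and has bounded derivative on {Re s ≥ 1}. -/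
open Finset Filter

/-- `α` is non-negative and multiplicative. -/
def MultNonneg (α : ℕ → ℝ) : Prop :=
  (∀ n, 0 ≤ α n) ∧ α 1 = 1 ∧ ∀ m n : ℕ, Nat.Coprime m n → α (m * n) = α m * α n

/-- Polynomial condition (II): `Σ_{k ≥ 2} k α(p^k)/p^k = O(1/(p log² p))`. -/
def PolyII (α : ℕ → ℝ) : Prop :=
  ∃ C : ℝ, 0 < C ∧ ∀ p : ℕ, p.Prime →
    (Summable fun k : ℕ => ((k + 2 : ℕ) : ℝ) * α (p ^ (k + 2)) / (p : ℝ) ^ (k + 2)) ∧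
    ∑' k : ℕ, ((k + 2 : ℕ) : ℝ) * α (p ^ (k + 2)) / (p : ℝ) ^ (k + 2) ≤ C / ((p : ℝ) * Real.log p ^ 2)


theorem aux_summable_inv_p_log :
    Summable (fun p : Nat.Primes => 1 / (((p : ℕ) : ℝ) * Real.log (p : ℕ))) := by
  have hl2 : 0 < Real.log 2 := Real.log_pos (by norm_num)
  set c : ℝ := 2 * Real.log 4 / (Real.log 2) ^ 2 with hc
  have hc0 : 0 ≤ c := by have : 0 < Real.log 4 := Real.log_pos (by norm_num)
                         positivity
  have hs : Summable (fun k : ℕ => c * (1 / (k : ℝ) ^ 2)) :=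
    (Real.summable_one_div_nat_pow.mpr (by norm_num)).mul_left c
  have hlogpos : ∀ p : Nat.Primes, 0 < Real.log (p : ℕ) := fun p =>
    Real.log_pos (by exact_mod_cast p.2.one_lt)
  have hppos : ∀ p : Nat.Primes, (0 : ℝ) < ((p : ℕ) : ℝ) := fun p => by exact_mod_cast p.2.pos
  refine summable_of_sum_le (c := ∑' k : ℕ, c * (1 / (k : ℝ) ^ 2)) ?_ ?_
  · intro p
    have := hlogpos p; have := hppos p
    simp only [Pi.zero_apply]
    positivity
  intro T
  rw [← Finset.sum_fiberwise_of_maps_to (s := T) (t := T.image (fun p : Nat.Primes => Nat.log 2 p))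
    (g := fun p : Nat.Primes => Nat.log 2 p) (fun p hp => Finset.mem_image_of_mem _ hp)]
  refine le_trans (Finset.sum_le_sum ?_) (hs.sum_le_tsum _ (fun k _ => by positivity))
  intro k hk
  obtain ⟨q, hq, hqk⟩ := Finset.mem_image.1 hk
  have hk1 : 1 ≤ k := by
    rw [← hqk]; exact Nat.log_pos (by norm_num) q.2.two_le
  have hkpos : (0 : ℝ) < k := by exact_mod_cast hk1
  -- bound terms
  have hterm : ∀ p ∈ T.filter (fun p : Nat.Primes => Nat.log 2 p = k),
      1 / (((p : ℕ) : ℝ) * Real.log (p : ℕ)) ≤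
        (1 / (2 ^ k * (k * Real.log 2) ^ 2)) * Real.log (p : ℕ) := by
    intro p hp
    have hpk := (Finset.mem_filter.1 hp).2
    have h1 : (2 : ℝ) ^ k ≤ ((p : ℕ) : ℝ) := by
      have : 2 ^ k ≤ (p : ℕ) := by
        rw [← hpk]; exact Nat.pow_log_le_self 2 p.2.ne_zero
      exact_mod_cast this
    have h2 : k * Real.log 2 ≤ Real.log (p : ℕ) := by
      rw [← Real.log_pow]; exact Real.log_le_log (by positivity) h1
    have hL := hlogpos p
    have hP := hppos p
    rw [one_div_mul_eq_div, div_le_div_iff₀ (by positivity) (by positivity)]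
    calc 1 * (2 ^ k * (k * Real.log 2) ^ 2) ≤ (p : ℕ) * (Real.log (p : ℕ)) ^ 2 := by
          rw [one_mul]; gcongr
      _ = _ := by ring
  refine (Finset.sum_le_sum hterm).trans ?_
  rw [← Finset.mul_sum]
  have hth : ∑ p ∈ T.filter (fun p : Nat.Primes => Nat.log 2 p = k), Real.log (p : ℕ)
      ≤ Chebyshev.theta ((2 ^ (k + 1) : ℕ) : ℝ) := by
    rw [Chebyshev.theta_eq_sum_primesLE_log]
    refine (Finset.sum_map (T.filter (fun p : Nat.Primes => Nat.log 2 p = k))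
      (⟨fun p : Nat.Primes => (p : ℕ), Subtype.val_injective⟩ : Nat.Primes ↪ ℕ)
      (fun n : ℕ => Real.log n)).symm.trans_le ?_
    refine Finset.sum_le_sum_of_subset_of_nonneg ?_ ?_
    · intro n hn
      obtain ⟨p, hp, rfl⟩ := Finset.mem_map.1 hn
      have hpk := (Finset.mem_filter.1 hp).2
      have : (p : ℕ) < 2 ^ (k + 1) := by
        rw [← hpk]; exact Nat.lt_pow_succ_log_self (by norm_num) _
      exact Nat.mem_primesLE.2 ⟨this.le, p.2⟩
    · intro n _ _
      exact Real.log_natCast_nonneg n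
  have h4 := Chebyshev.theta_le_log4_mul_x (x := ((2 ^ (k + 1) : ℕ) : ℝ)) (by positivity)
  calc _ ≤ 1 / (2 ^ k * (k * Real.log 2) ^ 2) * (Real.log 4 * ((2 ^ (k + 1) : ℕ) : ℝ)) := by
        gcongr; exact hth.trans h4
    _ = _ := by rw [hc]; push_cast; field_simp; ring

theorem aux_deriv_tsum {ι : Type*} {S : Set ℂ} (hS : Convex ℝ S) (g g' : ι → ℂ → ℂ) (u : ι → ℝ)
    (hu : Summable u) (hg : ∀ i, ∀ s ∈ S, HasDerivWithinAt (g i) (g' i s) S s)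
    (hb : ∀ i, ∀ s ∈ S, ‖g' i s‖ ≤ u i) (hsum : ∀ s ∈ S, Summable (fun i => g i s))
    (s : ℂ) (hs : s ∈ S) :
    HasDerivWithinAt (fun z => ∑' i, g i z) (∑' i, g' i s) S s := by
  rw [hasDerivWithinAt_iff_tendsto_slope]
  have key : Tendsto (fun z => ∑' i, slope (g i) s z) (nhdsWithin s (S \ {s}))
      (nhds (∑' i, g' i s)) := by
    refine tendsto_tsum_of_dominated_convergence hu
      (fun i => hasDerivWithinAt_iff_tendsto_slope.1 (hg i s hs)) ?_
    filter_upwards [self_mem_nhdsWithin] with z hz i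
    have h := hS.norm_image_sub_le_of_norm_hasDerivWithin_le (hg i) (hb i) hs hz.1
    have hne : 0 < ‖z - s‖ := norm_pos_iff.2 (sub_ne_zero.2 hz.2)
    rw [slope_def_field, norm_div, div_le_iff₀ hne]
    exact h
  refine key.congr' ?_
  filter_upwards [self_mem_nhdsWithin] with z hz
  simp only [slope_def_field]
  rw [tsum_div_const, Summable.tsum_sub (hsum z hz.1) (hsum s hs)]

theorem aux_prod {ι : Type*} {S : Set ℂ} (hS : Convex ℝ S) (a a' : ι → ℂ → ℂ) (u : ι → ℝ)
    (hu : Summable u) (ha : ∀ i, ∀ s ∈ S, HasDerivWithinAt (a i) (a' i s) S s)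
    (hb : ∀ i, ∀ s ∈ S, ‖a i s‖ ≤ u i) (hb' : ∀ i, ∀ s ∈ S, ‖a' i s‖ ≤ u i)
    (hu0 : ∀ i, 0 ≤ u i) :
    ∃ φ φ' : ℂ → ℂ, ∃ C : ℝ, 0 < C ∧ (∀ s ∈ S, 
      HasDerivWithinAt φ (φ' s) S s ∧ ‖φ s‖ ≤ C ∧ ‖φ' s‖ ≤ C) ∧
      ∀ s ∈ S, HasProd (fun i => 1 + a i s) (φ s) := by
  classical
  have h2u : Summable (fun T : Finset ι => ∏ i ∈ T, 2 * u i) :=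
    summable_finsetProd_of_summable_nonneg (fun i => by have := hu0 i; positivity) (hu.mul_left 2)
  have h2u0 : ∀ T : Finset ι, 0 ≤ ∏ i ∈ T, 2 * u i := fun T =>
    Finset.prod_nonneg (fun i _ => by have := hu0 i; positivity)
  set g : Finset ι → ℂ → ℂ := fun T s => ∏ i ∈ T, a i s with hg
  set g' : Finset ι → ℂ → ℂ := fun T s => ∑ i ∈ T, (∏ j ∈ T.erase i, a j s) • a' i s with hg'
  have hgb : ∀ T, ∀ s ∈ S, ‖g T s‖ ≤ ∏ i ∈ T, 2 * u i := by
    intro T s hs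
    rw [hg, norm_prod]
    refine Finset.prod_le_prod (fun _ _ => norm_nonneg _) (fun i _ => ?_)
    linarith [hb i s hs, hu0 i]
  have hgb' : ∀ T, ∀ s ∈ S, ‖g' T s‖ ≤ ∏ i ∈ T, 2 * u i := by
    intro T s hs
    calc ‖g' T s‖ ≤ ∑ i ∈ T, ∏ j ∈ T, u j := by
          refine norm_sum_le_of_le _ (fun i hi => ?_)
          rw [norm_smul, norm_prod, ← Finset.prod_erase_mul _ _ hi]
          refine mul_le_mul (Finset.prod_le_prod (fun _ _ => norm_nonneg _) (fun j _ => hb j s hs))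
            (hb' i s hs) (norm_nonneg _) (Finset.prod_nonneg (fun _ _ => hu0 _))
      _ = T.card * ∏ j ∈ T, u j := by simp
      _ ≤ 2 ^ T.card * ∏ j ∈ T, u j := by
          gcongr
          · exact Finset.prod_nonneg (fun _ _ => hu0 _)
          · exact_mod_cast Nat.lt_two_pow_self.le
      _ = _ := by rw [Finset.prod_mul_distrib]; simp
  have hsum : ∀ s ∈ S, Summable (fun T => g T s) := fun s hs =>
    Summable.of_norm_bounded h2u (fun T => hgb T s hs)
  refine ⟨fun s => ∑' T, g T s, fun s => ∑' T, g' T s, (∑' T : Finset ι, ∏ i ∈ T, 2 * u i) + 1,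
    add_pos_of_nonneg_of_pos (tsum_nonneg h2u0) one_pos, ?_, ?_⟩
  · intro s hs
    refine ⟨aux_deriv_tsum hS g g' _ h2u ?_ hgb' hsum s hs, ?_, ?_⟩
    · intro T z hz
      exact HasDerivWithinAt.fun_finsetProd (fun i _ => ha i z hz)
    · have := tsum_of_norm_bounded h2u.hasSum (fun T => hgb T s hs)
      linarith
    · have := tsum_of_norm_bounded h2u.hasSum (fun T => hgb' T s hs)
      linarith
  · intro s hs
    have hm : Multipliable (fun i => 1 + a i s) := by
      refine multipliable_one_add_of_summable (Summable.of_nonneg_of_le (fun _ => norm_nonneg _) (fun i => hb i s hs) hu)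
    have := hm.hasProd
    rwa [tprod_one_add (hsum s hs)] at this

/-- Norm of `p^{-s}` on the half-plane. -/
theorem aux_norm_w (x : ℝ) (hx : 0 < x) (s : ℂ) :
    ‖Complex.exp (-(s * (Real.log x : ℂ)))‖ = x ^ (-s.re) := by
  rw [Complex.norm_exp, Real.rpow_def_of_pos hx]
  congr 1
  simp
  ring

theorem aux_local (x : ℝ) (hx : 1 < x) (b : ℕ → ℝ) (hb0 : ∀ k, 0 ≤ b k) (A f D : ℝ)
    (hA : 0 ≤ A) (hf : 0 ≤ f)
    (hsum : Summable fun k : ℕ => ((k + 2 : ℕ) : ℝ) * b k / x ^ (k + 2))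
    (hD : ∑' k : ℕ, ((k + 2 : ℕ) : ℝ) * b k / x ^ (k + 2) ≤ D) :
    ∃ a' : ℂ → ℂ, ∀ s ∈ {z : ℂ | 1 ≤ z.re},
      Summable (fun k : ℕ => (b k : ℂ) * Complex.exp (-(s * (Real.log x : ℂ))) ^ (k + 2)) ∧
      HasDerivWithinAt (fun s : ℂ => (1 + A * Complex.exp (-(s * (Real.log x : ℂ))) +
        ∑' k : ℕ, (b k : ℂ) * Complex.exp (-(s * (Real.log x : ℂ))) ^ (k + 2)) *
        Complex.exp (-(f * Complex.exp (-(s * (Real.log x : ℂ))))) - 1) (a' s) {z : ℂ | 1 ≤ z.re} s ∧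
      ‖a' s‖ ≤ (|A - f| * Real.log x / x + Real.log x * D + (A / x + D) * f * Real.log x / x) *
        Real.exp (f / x) ∧
      ‖(1 + A * Complex.exp (-(s * (Real.log x : ℂ))) +
        ∑' k : ℕ, (b k : ℂ) * Complex.exp (-(s * (Real.log x : ℂ))) ^ (k + 2)) *
        Complex.exp (-(f * Complex.exp (-(s * (Real.log x : ℂ))))) - 1‖ ≤
        ((f / x) ^ 2 * Real.exp (f / x) + |A - f| / x + D) * Real.exp (f / x) := by
  have hx0 : 0 < x := by linarith
  set L := Real.log x with hL
  have hLpos : 0 < L := Real.log_pos hx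
  set S := {z : ℂ | 1 ≤ z.re} with hSdef
  have hS : Convex ℝ S := convex_halfSpace_re_ge 1
  set w : ℂ → ℂ := fun s => Complex.exp (-(s * (L : ℂ))) with hw
  have hwn : ∀ s ∈ S, ‖w s‖ ≤ 1 / x := by
    intro s hs
    rw [hw, hL]
    rw [aux_norm_w x hx0, one_div, ← Real.rpow_neg_one]
    exact Real.rpow_le_rpow_of_exponent_le hx.le (neg_le_neg hs)
  have hwd : ∀ s, HasDerivAt w (-(L * w s)) s := by
    intro s
    have := (((hasDerivAt_id s).mul_const (L : ℂ)).neg).cexp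
    refine this.congr_deriv ?_
    simp only [hw, Pi.neg_apply, id, one_mul, mul_neg]
    ring
  set R : ℂ → ℂ := fun s => ∑' k : ℕ, (b k : ℂ) * w s ^ (k + 2) with hR
  set R' : ℂ → ℂ := fun s => ∑' k : ℕ, (b k : ℂ) * (((k + 2 : ℕ) : ℂ) * w s ^ (k + 1) * (-(L * w s)))
    with hR'
  have hbd : ∀ k : ℕ, ∀ s ∈ S, ‖(b k : ℂ) * w s ^ (k + 2)‖ ≤
      ((k + 2 : ℕ) : ℝ) * b k / x ^ (k + 2) := by
    intro k s hs
    rw [norm_mul, norm_pow, Complex.norm_real, Real.norm_of_nonneg (hb0 k)]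
    have h1 : ‖w s‖ ^ (k + 2) ≤ (1 / x) ^ (k + 2) := by gcongr; exact hwn s hs
    have h2 : (1 : ℝ) ≤ ((k + 2 : ℕ) : ℝ) := by push_cast; linarith [(Nat.cast_nonneg k : (0:ℝ) ≤ k)]
    calc b k * ‖w s‖ ^ (k + 2) ≤ b k * (1 / x) ^ (k + 2) := by gcongr; exact hb0 k
      _ = 1 * b k / x ^ (k + 2) := by rw [one_div, inv_pow]; ring
      _ ≤ _ := by gcongr; exact hb0 k
  have hbd' : ∀ k : ℕ, ∀ s ∈ S, ‖(b k : ℂ) * (((k + 2 : ℕ) : ℂ) * w s ^ (k + 1) * (-(L * w s)))‖ ≤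
      L * (((k + 2 : ℕ) : ℝ) * b k / x ^ (k + 2)) := by
    intro k s hs
    have h1 : ‖w s‖ ^ (k + 2) ≤ (1 / x) ^ (k + 2) := by gcongr; exact hwn s hs
    have h3 : (b k : ℂ) * (((k + 2 : ℕ) : ℂ) * w s ^ (k + 1) * (-(L * w s))) =
      -((b k : ℂ) * ((k + 2 : ℕ) : ℂ) * L * w s ^ (k + 2)) := by ring
    rw [h3, norm_neg, norm_mul, norm_mul, norm_mul, norm_pow, Complex.norm_real, Complex.norm_real,
      Real.norm_of_nonneg (hb0 k), Complex.norm_natCast, Real.norm_of_nonneg hLpos.le]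
    calc b k * ((k + 2 : ℕ) : ℝ) * L * ‖w s‖ ^ (k + 2) ≤
        b k * ((k + 2 : ℕ) : ℝ) * L * (1 / x) ^ (k + 2) := by
          have := hb0 k
          gcongr
      _ = _ := by rw [one_div, inv_pow]; ring
  have hRs : ∀ s ∈ S, Summable (fun k : ℕ => (b k : ℂ) * w s ^ (k + 2)) := fun s hs =>
    Summable.of_norm_bounded hsum (fun k => hbd k s hs)
  have hRd : ∀ s ∈ S, HasDerivWithinAt R (R' s) S s := by
    intro s hs
    refine aux_deriv_tsum hS (fun k s => (b k : ℂ) * w s ^ (k + 2))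
      (fun k s => (b k : ℂ) * (((k + 2 : ℕ) : ℂ) * w s ^ (k + 1) * (-(L * w s)))) _
      (hsum.mul_left L) ?_ hbd' hRs s hs
    intro k z _
    exact (((hwd z).pow (k + 2)).const_mul (b k : ℂ)).hasDerivWithinAt
  have hRn : ∀ s ∈ S, ‖R s‖ ≤ D := fun s hs =>
    (tsum_of_norm_bounded hsum.hasSum (fun k => hbd k s hs)).trans hD
  have hRn' : ∀ s ∈ S, ‖R' s‖ ≤ L * D := fun s hs =>
    (tsum_of_norm_bounded (hsum.hasSum.mul_left L) (fun k => hbd' k s hs)).trans (by gcongr)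
  have hD0 : 0 ≤ D := (norm_nonneg _).trans (hRn 1 (by simp [hSdef]))
  have hz : ∀ s ∈ S, ‖(f : ℂ) * w s‖ ≤ f / x := by
    intro s hs
    rw [norm_mul, Complex.norm_real, Real.norm_of_nonneg hf, div_eq_mul_one_div]
    gcongr; exact hwn s hs
  have hAw : ∀ s ∈ S, ‖(A : ℂ) * w s‖ ≤ A / x := by
    intro s hs
    rw [norm_mul, Complex.norm_real, Real.norm_of_nonneg hA, div_eq_mul_one_div]
    gcongr; exact hwn s hs
  have hdw : ∀ s ∈ S, ‖((A - f : ℝ) : ℂ) * w s‖ ≤ |A - f| / x := by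
    intro s hs
    rw [norm_mul, Complex.norm_real, Real.norm_eq_abs, div_eq_mul_one_div]
    gcongr; exact hwn s hs
  have he : ∀ s ∈ S, ‖Complex.exp (-(f * w s))‖ ≤ Real.exp (f / x) := by
    intro s hs
    refine (Complex.norm_exp_le_exp_norm _).trans (Real.exp_le_exp.2 ?_)
    rw [norm_neg]; exact hz s hs
  refine ⟨fun s => (-(((A - f : ℝ) : ℂ) * w s * L) + R' s + (A * w s + R s) * (f * w s) * L) *
    Complex.exp (-(f * w s)), fun s hs => ⟨hRs s hs, ?_, ?_, ?_⟩⟩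
  · have h1 := (((hwd s).const_mul (A : ℂ)).const_add 1).hasDerivWithinAt (s := S)
    have h2 := ((hwd s).const_mul (f : ℂ)).neg.cexp.hasDerivWithinAt (s := S)
    have h3 := ((h1.add (hRd s hs)).mul h2).sub_const 1
    refine h3.congr_deriv ?_
    simp only [Pi.add_apply, Pi.neg_apply]
    push_cast
    ring
  · rw [norm_mul]
    refine mul_le_mul ?_ (he s hs) (norm_nonneg _) (by positivity)
    refine (norm_add_le _ _).trans (add_le_add ((norm_add_le _ _).trans (add_le_add ?_ (hRn' s hs))) ?_)
    · rw [norm_neg, norm_mul, Complex.norm_real, Real.norm_of_nonneg hLpos.le, mul_div_right_comm]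
      gcongr; exact hdw s hs
    · rw [norm_mul, norm_mul, Complex.norm_real, Real.norm_of_nonneg hLpos.le]
      calc _ ≤ (A / x + D) * (f / x) * L := by
            gcongr
            · exact (norm_add_le _ _).trans (add_le_add (hAw s hs) (hRn s hs))
            · exact hz s hs
        _ = _ := by ring
  · have h0 : (1 + A * w s + R s) * Complex.exp (-(f * w s)) - 1 =
        (-(Complex.exp (f * w s) - 1 - f * w s) + ((A - f : ℝ) : ℂ) * w s + R s) *
          Complex.exp (-(f * w s)) := by
      have : Complex.exp (f * w s) * Complex.exp (-(f * w s)) = 1 := by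
        rw [← Complex.exp_add]; simp
      push_cast
      linear_combination this
    change ‖(1 + A * w s + R s) * Complex.exp (-(f * w s)) - 1‖ ≤ _
    rw [h0, norm_mul]
    refine mul_le_mul ?_ (he s hs) (norm_nonneg _) (by positivity)
    refine (norm_add_le _ _).trans (add_le_add ((norm_add_le _ _).trans
      (add_le_add ?_ (hdw s hs))) (hRn s hs))
    rw [norm_neg]
    have h5 := Complex.norm_exp_sub_sum_le_norm_mul_exp (f * w s) 2
    simp only [Finset.sum_range_succ, Finset.sum_range_zero] at h5
    simp only [pow_zero, Nat.factorial, pow_one] at h5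
    norm_num at h5
    rw [← sub_sub] at h5
    have h6 := hz s hs
    rw [norm_mul, Complex.norm_real, Real.norm_eq_abs] at h6
    refine h5.trans ?_
    gcongr

theorem aux_half_le_log {p : ℕ} (hp : p.Prime) : 1 / 2 ≤ Real.log p := by
  have h1 : Real.log 2 ≤ Real.log p := Real.log_le_log (by norm_num) (by exact_mod_cast hp.two_le)
  linarith [Real.log_two_gt_d9]

theorem aux_growth (f : ℕ → ℝ) (hfpos : ∀ p : ℕ, p.Prime → 0 < f p)
    (hfo : ∀ ε : ℝ, 0 < ε → ∃ P₀ : ℕ, ∀ p : ℕ, p.Prime → P₀ ≤ p →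
      |Real.log (f p)| ≤ ε * Real.log p) (α : ℕ → ℝ)
    (hI : ∃ C : ℝ, 0 < C ∧ ∀ p : ℕ, p.Prime → |α p - f p| ≤ C / Real.log p ^ 2)
    (η : ℝ) (hη : 0 < η) :
    ∃ K : ℝ, 0 < K ∧ ∀ p : ℕ, p.Prime → f p ≤ K * (p : ℝ) ^ η ∧ α p ≤ K * (p : ℝ) ^ η := by
  obtain ⟨P₀, hP⟩ := hfo η hη
  obtain ⟨C, hC, hI⟩ := hI
  set M : ℝ := 1 + ∑ p ∈ Finset.range P₀, |f p| with hM
  have hM1 : 1 ≤ M := by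
    have : 0 ≤ ∑ p ∈ Finset.range P₀, |f p| := Finset.sum_nonneg (fun _ _ => abs_nonneg _)
    linarith
  have hf : ∀ p : ℕ, p.Prime → f p ≤ M * (p : ℝ) ^ η := by
    intro p hp
    have hp0 : (0 : ℝ) < p := by exact_mod_cast hp.pos
    have hp1 : (1 : ℝ) ≤ p := by exact_mod_cast hp.one_le
    have h1 : 1 ≤ (p : ℝ) ^ η := Real.one_le_rpow hp1 hη.le
    by_cases h : P₀ ≤ p
    · have h2 := (le_abs_self _).trans (hP p hp h)
      have h3 : f p ≤ (p : ℝ) ^ η := by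
        rw [← Real.log_le_log_iff (hfpos p hp) (by positivity), Real.log_rpow hp0]
        exact h2
      nlinarith
    · have h2 : |f p| ≤ ∑ p ∈ Finset.range P₀, |f p| :=
        Finset.single_le_sum (f := fun p => |f p|) (fun _ _ => abs_nonneg _)
          (Finset.mem_range.2 (not_le.1 h))
      have h3 := le_abs_self (f p)
      nlinarith
  refine ⟨M + 4 * C, by linarith, fun p hp => ?_⟩
  have hp1 : (1 : ℝ) ≤ p := by exact_mod_cast hp.one_le
  have h1 : 1 ≤ (p : ℝ) ^ η := Real.one_le_rpow hp1 hη.le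
  have h2 := hf p hp
  have h3 := (le_abs_self _).trans (hI p hp)
  have h4 := aux_half_le_log hp
  have h5 : C / Real.log p ^ 2 ≤ 4 * C := by
    rw [div_le_iff₀ (by positivity)]
    nlinarith [mul_le_mul h4 h4 (by norm_num) (by linarith)]
  constructor <;> nlinarith

theorem aux_summable_growth (f : ℕ → ℝ) (hf0 : ∀ p : ℕ, p.Prime → 0 ≤ f p)
    (hg : ∀ η : ℝ, 0 < η → ∃ K : ℝ, 0 < K ∧ ∀ p : ℕ, p.Prime → f p ≤ K * (p : ℝ) ^ η)
    (σ : ℝ) (hσ : 1 < σ) :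
    Summable (fun p : Nat.Primes => f (p : ℕ) * ((p : ℕ) : ℝ) ^ (-σ)) := by
  obtain ⟨K, hK, h⟩ := hg ((σ - 1) / 2) (by linarith)
  have hs : Summable (fun p : Nat.Primes => K * ((p : ℕ) : ℝ) ^ (-(σ + 1) / 2)) :=
    (Nat.Primes.summable_rpow.2 (by linarith)).mul_left K
  refine Summable.of_nonneg_of_le (fun p => ?_) (fun p => ?_) hs
  · have := hf0 p p.2
    positivity
  · have hp0 : (0 : ℝ) < (p : ℕ) := by exact_mod_cast p.2.pos
    calc f (p : ℕ) * ((p : ℕ) : ℝ) ^ (-σ) ≤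
        (K * ((p : ℕ) : ℝ) ^ ((σ - 1) / 2)) * ((p : ℕ) : ℝ) ^ (-σ) := by
          gcongr; exact h p p.2
      _ = _ := by
          rw [mul_assoc, ← Real.rpow_add hp0]; congr 2; ring

theorem aux_dirichlet_summable (α : ℕ → ℝ) (hα : MultNonneg α) (hII : PolyII α)
    (hg : ∀ η : ℝ, 0 < η → ∃ K : ℝ, 0 < K ∧ ∀ p : ℕ, p.Prime → α p ≤ K * (p : ℝ) ^ η)
    (σ : ℝ) (hσ : 1 < σ) :
    Summable (fun n : ℕ => α n * (n : ℝ) ^ (-σ)) := by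
  obtain ⟨h0, h1, hm⟩ := hα
  obtain ⟨C, hC, hII⟩ := hII
  set g : ℕ → ℝ := fun n => α n * (n : ℝ) ^ (-σ) with hgdef
  have hg0 : ∀ n, 0 ≤ g n := fun n => mul_nonneg (h0 n) (by positivity)
  have hgz : g 0 = 0 := by
    simp only [hgdef, Nat.cast_zero]
    rw [Real.zero_rpow (by linarith), mul_zero]
  have hg1 : g 1 = 1 := by simp [hgdef, h1]
  have hgm : ∀ {m n}, Nat.Coprime m n → g (m * n) = g m * g n := by
    intro m n hmn
    simp only [hgdef, hm m n hmn, Nat.cast_mul]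
    rw [Real.mul_rpow (by positivity) (by positivity)]
    ring
  have hterm : ∀ p : ℕ, p.Prime → ∀ k : ℕ, g (p ^ (k + 2)) ≤
      ((k + 2 : ℕ) : ℝ) * α (p ^ (k + 2)) / (p : ℝ) ^ (k + 2) := by
    intro p hp k
    have hp1 : (1 : ℝ) ≤ p := by exact_mod_cast hp.one_le
    have hp0 : (0 : ℝ) < p := by linarith
    have h2 : (1 : ℝ) ≤ ((k + 2 : ℕ) : ℝ) := by push_cast; linarith [(Nat.cast_nonneg k : (0:ℝ) ≤ k)]
    have h3 : ((p ^ (k + 2) : ℕ) : ℝ) ^ (-σ) ≤ 1 / (p : ℝ) ^ (k + 2) := by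
      rw [one_div, ← Real.rpow_neg_one, Nat.cast_pow]
      exact Real.rpow_le_rpow_of_exponent_le (one_le_pow₀ hp1) (by linarith)
    calc g (p ^ (k + 2)) ≤ α (p ^ (k + 2)) * (1 / (p : ℝ) ^ (k + 2)) := by
          simp only [hgdef]; gcongr; exact h0 _
      _ = 1 * α (p ^ (k + 2)) / (p : ℝ) ^ (k + 2) := by ring
      _ ≤ _ := by gcongr; exact h0 _
  have hs2 : ∀ p : ℕ, p.Prime → Summable (fun k => g (p ^ (k + 2))) := fun p hp =>
    Summable.of_nonneg_of_le (fun k => hg0 _) (hterm p hp) (hII p hp).1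
  have hs : ∀ p : ℕ, p.Prime → Summable (fun k => g (p ^ k)) := fun p hp =>
    (summable_nat_add_iff 2).1 (hs2 p hp)
  set v : ℕ → ℝ := fun p => α p * (p : ℝ) ^ (-σ) + 2 * C * (1 / ((p : ℝ) * Real.log p)) with hv
  have hvs : Summable (fun p : Nat.Primes => v (p : ℕ)) :=
    (aux_summable_growth α (fun p _ => h0 p) hg σ hσ).add (aux_summable_inv_p_log.mul_left _)
  have hv0 : ∀ p : ℕ, 0 ≤ v p := fun p =>
    add_nonneg (hg0 p) (by have := Real.log_natCast_nonneg p; positivity)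
  have hloc : ∀ p : ℕ, p.Prime → ∑' k, g (p ^ k) ≤ Real.exp (v p) := by
    intro p hp
    have hlog := aux_half_le_log hp
    have hp0 : (0 : ℝ) < p := by exact_mod_cast hp.pos
    rw [← (hs p hp).sum_add_tsum_nat_add 2]
    have h2 : ∑' k, g (p ^ (k + 2)) ≤ C / ((p : ℝ) * Real.log p ^ 2) :=
      ((hs2 p hp).tsum_le_tsum (hterm p hp) (hII p hp).1).trans (hII p hp).2
    have h3 : C / ((p : ℝ) * Real.log p ^ 2) ≤ 2 * C * (1 / ((p : ℝ) * Real.log p)) := by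
      rw [mul_one_div, div_le_div_iff₀ (by positivity) (by positivity)]
      have : 0 ≤ C * p * Real.log p := by positivity
      nlinarith
    simp only [Finset.sum_range_succ, Finset.sum_range_zero, pow_zero, pow_one, hg1]
    have h4 := Real.add_one_le_exp (v p)
    have h5 : v p = g p + 2 * C * (1 / ((p : ℝ) * Real.log p)) := rfl
    linarith
  refine summable_of_sum_range_le (c := Real.exp (∑' p : Nat.Primes, v (p : ℕ))) hg0 (fun N => ?_)
  have hE := (EulerProduct.summable_and_hasSum_smoothNumbers_prod_primesBelow_tsum (f := g) hg1 hgm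
    (fun {p} hp => (hs p hp).norm) N).2
  have hE' := (hasSum_subtype_iff_indicator (f := g) (s := (N.smoothNumbers : Set ℕ))).1 hE
  calc ∑ n ∈ Finset.range N, g n
      = ∑ n ∈ Finset.range N, (N.smoothNumbers : Set ℕ).indicator g n := by
        refine Finset.sum_congr rfl (fun n hn => ?_)
        rcases Nat.eq_zero_or_pos n with rfl | hn0
        · by_cases h : 0 ∈ N.smoothNumbers
          · rw [Set.indicator_of_mem h]
          · rw [Set.indicator_of_notMem h, hgz]
        · rw [Set.indicator_of_mem (Nat.mem_smoothNumbers_of_lt hn0 (Finset.mem_range.1 hn))]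
    _ ≤ ∏ p ∈ N.primesBelow, ∑' n : ℕ, g (p ^ n) :=
        sum_le_hasSum _ (fun n _ => Set.indicator_nonneg (fun n _ => hg0 n) n) hE'
    _ ≤ ∏ p ∈ N.primesBelow, Real.exp (v p) :=
        Finset.prod_le_prod (fun p _ => tsum_nonneg (fun _ => hg0 _))
          (fun p hp => hloc p (Nat.prime_of_mem_primesBelow hp))
    _ = Real.exp (∑ p ∈ N.primesBelow, v p) := (Real.exp_sum _ _).symm
    _ ≤ _ := by
        refine Real.exp_le_exp.2 ?_
        rw [← Finset.sum_subtype_of_mem v (p := Nat.Prime)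
          (fun p hp => Nat.prime_of_mem_primesBelow hp)]
        let T : Finset Nat.Primes := Finset.subtype Nat.Prime N.primesBelow
        have hT := Summable.sum_le_tsum (f := fun p : Nat.Primes => v (p : ℕ)) T
          (fun p _ => hv0 p) hvs
        exact hT

theorem aux_cpow (n : ℕ) (hn : n ≠ 0) (s : ℂ) (k : ℕ) (c : ℂ) :
    c / ((n ^ k : ℕ) : ℂ) ^ s = c * Complex.exp (-(s * (Real.log n : ℂ))) ^ k := by
  have h : ((n ^ k : ℕ) : ℂ) ≠ 0 := by exact_mod_cast pow_ne_zero k hn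
  rw [div_eq_mul_inv, Complex.cpow_def_of_ne_zero h, ← Complex.exp_neg, ← Complex.exp_nat_mul,
    ← Complex.natCast_log, Nat.cast_pow, Real.log_pow]
  congr 2
  push_cast
  ring

theorem aux_bounds (x : ℝ) (hx : 1 < x) (K C1 C2 A f : ℝ) (hK : 0 < K) (hC1 : 0 < C1)
    (hC2 : 0 < C2) (hA : 0 ≤ A) (hf : 0 ≤ f) (hfK : f ≤ K * x ^ (1 / 4 : ℝ))
    (hAK : A ≤ K * x ^ (1 / 4 : ℝ)) (hL : 1 / 2 ≤ Real.log x)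
    (hd : |A - f| ≤ C1 / Real.log x ^ 2) :
    (|A - f| * Real.log x / x + Real.log x * (C2 / (x * Real.log x ^ 2)) +
        (A / x + C2 / (x * Real.log x ^ 2)) * f * Real.log x / x) * Real.exp (f / x) ≤
      Real.exp (2 * K) * ((2 * C1 + 2 * C2 + C2 * K) * (1 / (x * Real.log x)) +
        5 * K ^ 2 * x ^ (-(5 / 4) : ℝ)) ∧
    ((f / x) ^ 2 * Real.exp (f / x) + |A - f| / x + C2 / (x * Real.log x ^ 2)) *
        Real.exp (f / x) ≤
      Real.exp (2 * K) * ((2 * C1 + 2 * C2 + C2 * K) * (1 / (x * Real.log x)) +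
        5 * K ^ 2 * x ^ (-(5 / 4) : ℝ)) := by
  have hx0 : 0 < x := by linarith
  set q : ℝ := x ^ (1 / 4 : ℝ) with hq
  have hq1 : 1 ≤ q := Real.one_le_rpow hx.le (by norm_num)
  have hq0 : 0 < q := by linarith
  have hxq : x = q ^ 4 := by
    rw [hq, ← Real.rpow_natCast, ← Real.rpow_mul hx0.le]; norm_num
  have hY : x ^ (-(5 / 4) : ℝ) = 1 / q ^ 5 := by
    rw [hq, ← Real.rpow_natCast, ← Real.rpow_mul hx0.le, one_div, ← Real.rpow_neg hx0.le]; norm_num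
  have hLq : Real.log x ≤ 4 * q := by
    have := Real.log_le_sub_one_of_pos hq0
    have h2 : Real.log x = 4 * Real.log q := by
      rw [hxq, Real.log_pow]; norm_num
    linarith
  set L := Real.log x with hLdef
  have hL0 : 0 < L := by linarith
  rw [hY]
  set X := 1 / (x * L) with hX
  set Y := 1 / q ^ 5 with hYdef
  have hX0 : 0 < X := by positivity
  have hY0 : 0 < Y := by positivity
  have hfx : f / x ≤ K := by
    rw [div_le_iff₀ hx0]
    refine hfK.trans ?_
    have : q ≤ x := by rw [hxq]; exact le_self_pow₀ hq1 (by norm_num)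
    gcongr
  have hfx0 : 0 ≤ f / x := by positivity
  have he : Real.exp (f / x) ≤ Real.exp K := Real.exp_le_exp.2 hfx
  have he1 : 1 ≤ Real.exp K := Real.one_le_exp hK.le
  have he2 : Real.exp (2 * K) = Real.exp K * Real.exp K := by rw [two_mul, Real.exp_add]
  have hfq : f / x ≤ K / q ^ 3 := by
    rw [div_le_div_iff₀ hx0 (by positivity), hxq]
    calc f * q ^ 3 ≤ K * q * q ^ 3 := by gcongr
      _ = _ := by ring
  have hAq : A / x ≤ K / q ^ 3 := by
    rw [div_le_div_iff₀ hx0 (by positivity), hxq]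
    calc A * q ^ 3 ≤ K * q * q ^ 3 := by gcongr
      _ = _ := by ring
  have hD : C2 / (x * L ^ 2) = C2 * X / L := by rw [hX]; field_simp
  have hDL : C2 * X / L ≤ 2 * C2 * X := by
    rw [div_le_iff₀ hL0]
    have : 0 < C2 * X := by positivity
    nlinarith
  have hdx : |A - f| / x ≤ C1 * X / L := by
    calc |A - f| / x ≤ (C1 / L ^ 2) / x := by gcongr
      _ = _ := by rw [hX]; field_simp
  have hd1 : C1 * X / L ≤ 2 * C1 * X := by
    rw [div_le_iff₀ hL0]
    have : 0 < C1 * X := by positivity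
    nlinarith
  constructor
  · have t1 : |A - f| * L / x ≤ C1 * X := by
      calc |A - f| * L / x = |A - f| / x * L := by ring
        _ ≤ C1 * X / L * L := by gcongr
        _ = _ := by field_simp
    have t2 : L * (C2 / (x * L ^ 2)) = C2 * X := by rw [hX]; field_simp
    have t3 : (A / x + C2 / (x * L ^ 2)) * f * L / x ≤ 4 * K ^ 2 * Y + C2 * K * X := by
      have e1 : (A / x + C2 / (x * L ^ 2)) * f * L / x =
          (A / x) * (f / x) * L + C2 * X * (f / x) := by rw [hX]; field_simp
      rw [e1]
      have e2 : (A / x) * (f / x) * L ≤ (K / q ^ 3) * (K / q ^ 3) * (4 * q) := by gcongr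
      have e3 : (K / q ^ 3) * (K / q ^ 3) * (4 * q) = 4 * K ^ 2 * Y := by rw [hYdef]; field_simp
      have e4 : C2 * X * (f / x) ≤ C2 * X * K := by gcongr
      linarith
    have hB : |A - f| * L / x + L * (C2 / (x * L ^ 2)) + (A / x + C2 / (x * L ^ 2)) * f * L / x ≤
        (2 * C1 + 2 * C2 + C2 * K) * X + 5 * K ^ 2 * Y := by
      have : 0 < C1 * X := by positivity
      have : 0 < C2 * X := by positivity
      have : 0 < K ^ 2 * Y := by positivity
      linarith
    rw [mul_comm (Real.exp (2 * K))]
    refine mul_le_mul hB ?_ (Real.exp_pos _).le (by positivity)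
    exact Real.exp_le_exp.2 (by linarith)
  · have t1 : (f / x) ^ 2 ≤ K ^ 2 * Y := by
      calc (f / x) ^ 2 ≤ (K / q ^ 3) ^ 2 := by gcongr
        _ = K ^ 2 / q ^ 6 := by ring
        _ ≤ K ^ 2 / q ^ 5 := by gcongr; norm_num
        _ = _ := by rw [hYdef]; ring
    rw [hD]
    have hB : (f / x) ^ 2 * Real.exp (f / x) + |A - f| / x + C2 * X / L ≤
        Real.exp K * ((2 * C1 + 2 * C2 + C2 * K) * X + 5 * K ^ 2 * Y) := by
      have e1 : (f / x) ^ 2 * Real.exp (f / x) ≤ K ^ 2 * Y * Real.exp K := by gcongr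
      have e2 : 2 * C1 * X + 2 * C2 * X ≤ Real.exp K * (2 * C1 * X + 2 * C2 * X) :=
        le_mul_of_one_le_left (by positivity) he1
      have e3 : 0 ≤ Real.exp K * (C2 * K * X + 4 * K ^ 2 * Y) := by positivity
      nlinarith
    rw [he2]
    calc _ ≤ (Real.exp K * ((2 * C1 + 2 * C2 + C2 * K) * X + 5 * K ^ 2 * Y)) * Real.exp K := by
          gcongr
      _ = _ := by ring

/-- **Factorization of the Dirichlet series:** if `log f(p) = o(log p)`,
`α(p) = f(p) + O((log p)^{-2})` and `Σ_{k≥2} k α(p^k)/p^k = O(1/(p log² p))`, then for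
`Re s > 1`, `F(s) = φ(s) e^{G_f(s)}` where `φ` is differentiable, bounded, and with bounded
derivative on `{Re s ≥ 1}`. -/
theorem dirichlet_series_factorization
    (f : ℕ → ℝ) (hfpos : ∀ p : ℕ, p.Prime → 0 < f p)
    (hfo : ∀ ε : ℝ, 0 < ε → ∃ P₀ : ℕ, ∀ p : ℕ, p.Prime → P₀ ≤ p →
      |Real.log (f p)| ≤ ε * Real.log p)
    (α : ℕ → ℝ) (hα : MultNonneg α)
    (hI : ∃ C : ℝ, 0 < C ∧ ∀ p : ℕ, p.Prime → |α p - f p| ≤ C / Real.log p ^ 2)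
    (hII : PolyII α) :
    ∃ φ φ' : ℂ → ℂ, ∃ C : ℝ, 0 < C ∧
      (∀ s : ℂ, 1 ≤ s.re →
        HasDerivWithinAt φ (φ' s) {z : ℂ | 1 ≤ z.re} s ∧ ‖φ s‖ ≤ C ∧ ‖φ' s‖ ≤ C) ∧
      ∀ s : ℂ, 1 < s.re →
        (∑' n : ℕ, (α (n + 1) : ℂ) / ((n : ℂ) + 1) ^ s) =
          φ s * Complex.exp (∑' p : Nat.Primes, (f (p : ℕ) : ℂ) / ((p : ℕ) : ℂ) ^ s) := by
  classical
  have hgr := aux_growth f hfpos hfo α hI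
  obtain ⟨K, hK, hKb⟩ := hgr (1 / 4) (by norm_num)
  obtain ⟨C1, hC1, hI1⟩ := hI
  have hα' := hα
  obtain ⟨h0, h1, hm⟩ := hα'
  have hII' := hII
  obtain ⟨C2, hC2, hII2⟩ := hII'
  have hloc := fun p : Nat.Primes => aux_local ((p : ℕ) : ℝ) (by exact_mod_cast p.2.one_lt)
    (fun k => α ((p : ℕ) ^ (k + 2))) (fun k => h0 _) (α p) (f p) _ (h0 _) (hfpos p p.2).le
    (hII2 p p.2).1 (hII2 p p.2).2
  choose a' ha' using hloc
  set S := {z : ℂ | 1 ≤ z.re} with hS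
  set w : Nat.Primes → ℂ → ℂ := fun p s => Complex.exp (-(s * (Real.log (p : ℕ) : ℂ))) with hw
  set E : Nat.Primes → ℂ → ℂ := fun p s => 1 + (α p : ℂ) * w p s +
    ∑' k : ℕ, (α ((p : ℕ) ^ (k + 2)) : ℂ) * w p s ^ (k + 2) with hE
  set a : Nat.Primes → ℂ → ℂ := fun p s => E p s * Complex.exp (-((f p : ℂ) * w p s)) - 1 with ha
  set u : Nat.Primes → ℝ := fun p => Real.exp (2 * K) *
    ((2 * C1 + 2 * C2 + C2 * K) * (1 / (((p : ℕ) : ℝ) * Real.log (p : ℕ))) +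
      5 * K ^ 2 * ((p : ℕ) : ℝ) ^ (-(5 / 4) : ℝ)) with hu
  have hus : Summable u :=
    ((aux_summable_inv_p_log.mul_left _).add
      ((Nat.Primes.summable_rpow.2 (by norm_num)).mul_left _)).mul_left _
  have hu0 : ∀ p, 0 ≤ u p := fun p => by
    have := Real.log_natCast_nonneg (p : ℕ)
    simp only [hu]
    positivity
  have hbounds : ∀ p : Nat.Primes,
      (|α p - f p| * Real.log (p : ℕ) / (p : ℕ) + Real.log (p : ℕ) *
          (C2 / (((p : ℕ) : ℝ) * Real.log (p : ℕ) ^ 2)) +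
        (α p / (p : ℕ) + C2 / (((p : ℕ) : ℝ) * Real.log (p : ℕ) ^ 2)) * f p * Real.log (p : ℕ)
          / (p : ℕ)) * Real.exp (f p / (p : ℕ)) ≤ u p ∧
      ((f p / (p : ℕ)) ^ 2 * Real.exp (f p / (p : ℕ)) + |α p - f p| / (p : ℕ) +
        C2 / (((p : ℕ) : ℝ) * Real.log (p : ℕ) ^ 2)) * Real.exp (f p / (p : ℕ)) ≤ u p := fun p =>
    aux_bounds ((p : ℕ) : ℝ) (by exact_mod_cast p.2.one_lt) K C1 C2 (α p) (f p) hK hC1 hC2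
      (h0 _) (hfpos p p.2).le (hKb p p.2).1 (hKb p p.2).2 (aux_half_le_log p.2) (hI1 p p.2)
  obtain ⟨φ, φ', C, hC, hφ, hprod⟩ := aux_prod (convex_halfSpace_re_ge 1) a a' u hus
    (fun p s hs => (ha' p s hs).2.1)
    (fun p s hs => (ha' p s hs).2.2.2.trans (hbounds p).2)
    (fun p s hs => (ha' p s hs).2.2.1.trans (hbounds p).1) hu0
  refine ⟨φ, φ', C, hC, hφ, fun s hs => ?_⟩
  -- the Dirichlet series
  set G : ℕ → ℂ := fun n => (α n : ℂ) / (n : ℂ) ^ s with hG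
  have hsne : s ≠ 0 := by
    rintro rfl
    simp at hs
    linarith
  have hGz : G 0 = 0 := by simp [hG, Complex.zero_cpow hsne]
  have hG1 : G 1 = 1 := by simp [hG, h1]
  have hGm : ∀ {m n}, Nat.Coprime m n → G (m * n) = G m * G n := by
    intro m n hmn
    simp only [hG, hm m n hmn]
    push_cast
    rw [Complex.natCast_mul_natCast_cpow]
    ring
  have hGs : Summable (fun n => ‖G n‖) := by
    refine (aux_dirichlet_summable α hα hII (fun η hη => ?_) s.re hs).congr (fun n => ?_)
    · obtain ⟨K, hK, h⟩ := hgr η hη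
      exact ⟨K, hK, fun p hp => (h p hp).2⟩
    · simp only [hG]
      rcases Nat.eq_zero_or_pos n with rfl | hn
      · simp [Complex.zero_cpow hsne, Real.zero_rpow (show -s.re ≠ 0 by linarith)]
      · rw [norm_div, Complex.norm_natCast_cpow_of_pos hn, Complex.norm_real,
          Real.norm_of_nonneg (h0 n), Real.rpow_neg (by positivity), div_eq_mul_inv]
  have hGpow : ∀ (p : Nat.Primes) (k : ℕ), G ((p : ℕ) ^ k) = (α ((p : ℕ) ^ k) : ℂ) * w p s ^ k :=
    fun p k => aux_cpow p p.2.ne_zero s k _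
  have hEuler := EulerProduct.eulerProduct_hasProd hG1 hGm hGs hGz
  have hlocE : ∀ p : Nat.Primes, ∑' e, G ((p : ℕ) ^ e) = E p s := by
    intro p
    have hsm : Summable (fun e => G ((p : ℕ) ^ e)) :=
      hGs.of_norm.comp_injective (Nat.pow_right_injective p.2.two_le)
    rw [← hsm.sum_add_tsum_nat_add 2]
    simp only [hGpow, Finset.sum_range_succ, Finset.sum_range_zero, pow_zero, pow_one, h1, hE]
    simp
  have hfs : Summable (fun p : Nat.Primes => (f (p : ℕ) : ℂ) * w p s) := by
    refine Summable.of_norm ?_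
    refine (aux_summable_growth f (fun p hp => (hfpos p hp).le) (fun η hη => ?_) s.re hs).congr
      (fun p => ?_)
    · obtain ⟨K, hK, h⟩ := hgr η hη
      exact ⟨K, hK, fun p hp => (h p hp).1⟩
    · simp only [hw]
      rw [norm_mul, aux_norm_w _ (by exact_mod_cast p.2.pos), Complex.norm_real,
        Real.norm_of_nonneg (hfpos p p.2).le]
  have hexp := hfs.hasSum.cexp
  have hmul := (hprod s hs.le).mul hexp
  have heq : (fun p : Nat.Primes => (1 + a p s) *
      (Complex.exp ∘ fun p : Nat.Primes => (f (p : ℕ) : ℂ) * w p s) p) =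
      fun p : Nat.Primes => ∑' e, G ((p : ℕ) ^ e) := by
    funext p
    rw [hlocE]
    simp only [ha, Function.comp]
    have : Complex.exp (-((f p : ℂ) * w p s)) * Complex.exp ((f p : ℂ) * w p s) = 1 := by
      rw [← Complex.exp_add]; simp
    linear_combination (E p s) * this
  rw [heq] at hmul
  have hfin := hEuler.unique hmul
  have hshift : (∑' n : ℕ, (α (n + 1) : ℂ) / ((n : ℂ) + 1) ^ s) = ∑' n, G n := by
    rw [hGs.of_norm.tsum_eq_zero_add, hGz, zero_add]
    simp [hG]
  rw [hshift, hfin]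
  congr 3
  funext p
  have := aux_cpow p p.2.ne_zero s 1 (f p)
  simp only [pow_one] at this
  exact this.symm
end

section
/- Behavior of derivatives of the prime zeta-type series near s=1: Fix γ > 0 and a non-negative integer k, and let G(s) = Σ_{p prime} (log p)^γ / p^s for Re s > 1. Then there exists a real constant B_k (depending on γ and k) such that for Re s > 1, the k-th derivative satisfies G^{(k)}(s) = (−1)^k·Γ(γ+k)/(s−1)^{γ+k} + B_k + O(|s−1|·|s|), where (s−1)^{γ+k} = exp((γ+k)·log(s−1)) is defined using the principal branch of the logarithm. -/
open Complex


lemma pz_rpow_diff (s : ℂ) (hs : 0 < s.re) (n : ℕ) (x : ℝ) (hx : x ∈ Set.Icc ((n:ℝ)+1) (n+2)) :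
    ‖(x:ℂ)^(-s) - (((n:ℝ)+1 : ℝ):ℂ)^(-s)‖ ≤ ‖s‖ * ((n:ℝ)+1)^(-s.re-1) := by
  have hn : (0:ℝ) < (n:ℝ)+1 := by positivity
  have hs0 : s ≠ 0 := by rintro rfl; simp at hs
  have key := (convex_Icc ((n:ℝ)+1) (n+2)).norm_image_sub_le_of_norm_hasDerivWithin_le
    (f := fun y : ℝ => (y:ℂ)^(-s)) (f' := fun y : ℝ => -s * (y:ℂ)^(-s-1))
    (C := ‖s‖ * ((n:ℝ)+1)^(-s.re-1)) (x := (n:ℝ)+1) (y := x) ?_ ?_ ?_ hx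
  · refine key.trans ?_
    have h1 : ‖x - ((n:ℝ)+1)‖ ≤ 1 := by
      rw [Real.norm_eq_abs, abs_le]; constructor <;> linarith [hx.1, hx.2]
    calc _ ≤ ‖s‖ * ((n:ℝ)+1)^(-s.re-1) * 1 := by gcongr
      _ = _ := by ring
  · intro y hy
    have hy0 : 0 < y := by linarith [hy.1]
    exact (hasDerivAt_ofReal_cpow_const (x := y) hy0.ne' (r := -s) (neg_ne_zero.mpr hs0)).hasDerivWithinAt
  · intro y hy
    have hy0 : 0 < y := by linarith [hy.1]
    rw [norm_mul, norm_neg, norm_cpow_eq_rpow_re_of_pos hy0]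
    gcongr ?_ * ?_
    simp only [sub_re, neg_re, one_re]
    exact Real.rpow_le_rpow_of_nonpos hn hy.1 (by linarith)
  · constructor <;> linarith

noncomputable def pzE (n : ℕ) (s : ℂ) : ℂ :=
  (((n:ℝ)+1 : ℝ):ℂ)^(-s) - ((((n:ℝ)+1 : ℝ):ℂ)^(1-s) - (((n:ℝ)+2 : ℝ):ℂ)^(1-s)) / (s-1)

lemma pzE_bound (s : ℂ) (hs : 0 < s.re) (hs1 : s ≠ 1) (n : ℕ) :
    ‖pzE n s‖ ≤ ‖s‖ * ((n:ℝ)+1)^(-s.re-1) := by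
  have hn : (0:ℝ) < (n:ℝ)+1 := by positivity
  have h1s : 1 - s ≠ 0 := sub_ne_zero.mpr hs1.symm
  have hs1' : s - 1 ≠ 0 := sub_ne_zero.mpr hs1
  have key := (convex_Icc ((n:ℝ)+1) (n+2)).norm_image_sub_le_of_norm_hasDerivWithin_le
    (f := fun y : ℝ => (y:ℂ)^(1-s)/(1-s) - y * (((n:ℝ)+1 : ℝ):ℂ)^(-s))
    (f' := fun y : ℝ => (y:ℂ)^(-s) - (((n:ℝ)+1 : ℝ):ℂ)^(-s))
    (C := ‖s‖ * ((n:ℝ)+1)^(-s.re-1)) (x := (n:ℝ)+1) (y := n+2) ?_ ?_ ?_ ?_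
  · have h2 : ‖((n:ℝ)+2) - ((n:ℝ)+1)‖ = 1 := by
      rw [show ((n:ℝ)+2) - ((n:ℝ)+1) = 1 by ring]; simp
    rw [h2, mul_one, ← norm_neg] at key
    refine le_of_eq_of_le ?_ key
    congr 1
    unfold pzE
    push_cast
    field_simp
    ring
  · intro y hy
    have hy0 : 0 < y := by linarith [hy.1]
    have := (hasDerivAt_ofReal_cpow_const (x := y) hy0.ne' (r := 1-s) h1s).div_const (1-s)
    rw [mul_div_cancel_left₀ _ h1s, show 1 - s - 1 = -s by ring] at this
    have h2 : HasDerivAt (fun y : ℝ => (y:ℂ) * (((n:ℝ)+1 : ℝ):ℂ)^(-s)) (1 * (((n:ℝ)+1 : ℝ):ℂ)^(-s)) y :=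
      (HasDerivAt.ofReal_comp (hasDerivAt_id y)).mul_const _ 
    rw [one_mul] at h2
    exact (this.sub h2).hasDerivWithinAt
  · intro y hy
    exact pz_rpow_diff s hs n y hy
  · constructor <;> linarith
  · constructor <;> linarith

lemma pz_summable_shift (a : ℝ) (ha : a < -1) : Summable (fun n : ℕ => ((n:ℝ)+1)^a) := by
  have := (summable_nat_add_iff 1).mpr (Real.summable_nat_rpow.mpr ha)
  simpa using this

lemma pzE_summable (s : ℂ) (hs : 0 < s.re) (hs1 : s ≠ 1) : Summable (fun n => pzE n s) := by
  refine Summable.of_norm_bounded ?_ (pzE_bound s hs hs1)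
  exact (pz_summable_shift _ (by linarith)).mul_left _

noncomputable def pzZ (N : ℕ) (s : ℂ) : ℂ :=
  ∑ n ∈ Finset.range N, (((n:ℝ)+1 : ℝ):ℂ)^(-s) + (((N:ℝ)+1 : ℝ):ℂ)^(1-s) / (s-1) + ∑' n, pzE (n+N) s

lemma pzZ_eq_of_one_lt (N : ℕ) (s : ℂ) (hs : 1 < s.re) : riemannZeta s = pzZ N s := by
  have hs1 : s ≠ 1 := by rintro rfl; simp at hs
  have hs1' : s - 1 ≠ 0 := sub_ne_zero.mpr hs1
  have ha : Summable (fun n : ℕ => (((n:ℝ)+1 : ℝ):ℂ)^(-s)) := by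
    refine Summable.of_norm ((pz_summable_shift (-s.re) (by linarith)).congr fun n => ?_)
    rw [norm_cpow_eq_rpow_re_of_pos (by positivity)]; simp
  have he := pzE_summable s (by linarith) hs1
  have hz : riemannZeta s = ∑' n : ℕ, (((n:ℝ)+1 : ℝ):ℂ)^(-s) := by
    rw [zeta_eq_tsum_one_div_nat_add_one_cpow hs]
    congr 1; ext n; rw [cpow_neg]; push_cast; simp
  rw [hz, ← ha.sum_add_tsum_nat_add N, pzZ, add_assoc]
  congr 1
  have ha' := (summable_nat_add_iff N).mpr ha
  have he' := (summable_nat_add_iff N).mpr he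
  have hd := ha'.sub he'
  have : ∑' n : ℕ, ((((n+N:ℕ):ℝ)+1 : ℝ):ℂ)^(-s) - ∑' n, pzE (n+N) s = (((N:ℝ)+1 : ℝ):ℂ)^(1-s) / (s-1) := by
    rw [← ha'.tsum_sub he']
    refine HasSum.tsum_eq ?_
    rw [hd.hasSum_iff_tendsto_nat]
    have h1 : ∀ n : ℕ, ∑ i ∈ Finset.range n, (((((i+N:ℕ):ℝ)+1 : ℝ):ℂ)^(-s) - pzE (i+N) s) 
        = (((N:ℝ)+1 : ℝ):ℂ)^(1-s) / (s-1) - ((((n+N:ℕ):ℝ)+1 : ℝ):ℂ)^(1-s) / (s-1) := by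
      intro n
      induction n with
      | zero => simp
      | succ n ih =>
        rw [Finset.sum_range_succ, ih, pzE]
        have : (((n + 1 + N : ℕ) : ℝ) + 1) = ((n+N:ℕ):ℝ)+2 := by push_cast; ring
        rw [this]; ring
    simp_rw [h1]
    have h2 : Filter.Tendsto (fun n : ℕ => ((((n+N:ℕ):ℝ)+1 : ℝ):ℂ)^(1-s)) Filter.atTop (nhds 0) := by
      rw [tendsto_zero_iff_norm_tendsto_zero]
      have h3 : ∀ n : ℕ, ‖((((n+N:ℕ):ℝ)+1 : ℝ):ℂ)^(1-s)‖ = (((n+N:ℕ):ℝ)+1)^(-(s.re-1)) := by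
        intro n
        rw [norm_cpow_eq_rpow_re_of_pos (by positivity)]; simp
      simp_rw [h3]
      refine (tendsto_rpow_neg_atTop (by linarith)).comp ?_
      refine Filter.tendsto_atTop_add_const_right _ _ ?_
      exact tendsto_natCast_atTop_atTop.comp (Filter.tendsto_add_atTop_nat N)
    have := (h2.div_const (s-1)).const_sub ((((N:ℝ)+1 : ℝ):ℂ)^(1-s) / (s-1))
    simpa using this
  linear_combination this

lemma pzZ_eq (N : ℕ) (s : ℂ) (hs : 1/2 ≤ s.re) (hs' : 0 < s.im) : riemannZeta s = pzZ N s := by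
  set M := ‖s‖ + 3 with hM
  set U : Set ℂ := {z : ℂ | 1/4 < z.re} ∩ {z : ℂ | 0 < z.im} ∩ Metric.ball 0 M with hU
  have hUo : IsOpen U := ((isOpen_lt continuous_const continuous_re).inter
    (isOpen_lt continuous_const continuous_im)).inter Metric.isOpen_ball
  have hUc : Convex ℝ U := ((convex_halfSpace_re_gt _).inter (convex_halfSpace_im_gt _)).inter
    (convex_ball _ _)
  have hU1 : ∀ z ∈ U, z ≠ 1 := by
    rintro z hz rfl; have := hz.1.2; simp at this
  have hdz : DifferentiableOn ℂ riemannZeta U := fun z hz =>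
    (differentiableAt_riemannZeta (hU1 z hz)).differentiableWithinAt
  have hcp : ∀ (r : ℝ), 0 < r → ∀ (f : ℂ → ℂ), Differentiable ℂ f → Differentiable ℂ (fun z => (r:ℂ)^(f z)) := by
    intro r hr f hf
    exact hf.const_cpow (Or.inl (by exact_mod_cast hr.ne'))
  have hdE : ∀ n, DifferentiableOn ℂ (pzE n) U := by
    intro n z hz
    have h1 := hU1 z hz
    unfold pzE
    apply DifferentiableAt.differentiableWithinAt
    refine ((hcp _ (by positivity) _ (by fun_prop)) z).sub (DifferentiableAt.div ?_ (by fun_prop) (sub_ne_zero.mpr h1))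
    exact ((hcp _ (by positivity) _ (by fun_prop)) z).sub ((hcp _ (by positivity) _ (by fun_prop)) z)
  have hdZ : DifferentiableOn ℂ (pzZ N) U := by
    unfold pzZ
    refine DifferentiableOn.add (DifferentiableOn.add ?_ ?_) ?_
    · refine DifferentiableOn.fun_sum fun n _ => ?_
      exact (hcp _ (by positivity) _ (by fun_prop)).differentiableOn
    · refine DifferentiableOn.div (hcp _ (by positivity) _ (by fun_prop)).differentiableOn (by fun_prop) ?_
      intro z hz; exact sub_ne_zero.mpr (hU1 z hz)
    · refine differentiableOn_tsum_of_summable_norm (u := fun n => M * (((n+N:ℕ):ℝ)+1)^(-(5/4):ℝ)) ?_ ?_ hUo ?_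
      · exact ((summable_nat_add_iff N).mpr (pz_summable_shift (-(5/4)) (by norm_num))).mul_left _
      · intro n; exact hdE _
      · intro n z hz
        have h14 : (1/4:ℝ) < z.re := hz.1.1
        refine (pzE_bound z (by linarith) (hU1 z hz) _).trans ?_
        have : ‖z‖ ≤ M := by have := hz.2; simp at this; exact this.le
        gcongr ?_ * ?_
        exact Real.rpow_le_rpow_of_exponent_le (by linarith [Nat.cast_nonneg (α := ℝ) (n+N)]) (by linarith)
  have hz0 : (2 + I : ℂ) ∈ U := by
    refine ⟨⟨by simp; norm_num, by simp⟩, ?_⟩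
    simp only [mem_ball_zero_iff]
    refine (norm_add_le _ _).trans_lt ?_
    simp only [norm_ofNat, norm_I]
    have : 0 < ‖s‖ := norm_pos_iff.mpr (by rintro rfl; simp at hs')
    linarith
  refine (hdz.analyticOnNhd hUo).eqOn_of_preconnected_of_eventuallyEq (hdZ.analyticOnNhd hUo)
    hUc.isPreconnected hz0 ?_ ⟨⟨?_, hs'⟩, ?_⟩
  · have : {z : ℂ | 1 < z.re} ∈ nhds (2 + I : ℂ) :=
      (isOpen_lt continuous_const continuous_re).mem_nhds (by simp)
    filter_upwards [this] with z hz
    exact pzZ_eq_of_one_lt N z hz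
  · simp only [Set.mem_ofPred_eq]; linarith
  · simp [hM]

lemma pz_zeta_bound_pos (δ : ℝ) (hδ : 0 < δ) (hδ' : δ ≤ 1/4) : ∃ C : ℝ, 0 < C ∧ ∀ s : ℂ,
    1 - δ ≤ s.re → s.re ≤ 4 → 1/2 ≤ s.im → ‖riemannZeta s‖ ≤ C * s.im ^ (2*δ) := by
  set S := ∑' n : ℕ, ((n:ℝ)+1)^(-1-δ) with hS
  have hSs := pz_summable_shift (-1-δ) (by linarith)
  have hS0 : 0 ≤ S := tsum_nonneg fun n => by positivity
  refine ⟨3 * S + 10 + 9 * S, by positivity, fun s h1 h4 him => ?_⟩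
  set t := s.im with ht
  have ht0 : 0 < t := by linarith
  set N := ⌈t⌉₊ with hN
  have hNt : t ≤ N := Nat.le_ceil t
  have hNt' : (N:ℝ) < t + 1 := Nat.ceil_lt_add_one ht0.le
  rw [pzZ_eq N s (by linarith) (by linarith), pzZ]
  have hpow : ∀ a : ℝ, 1 ≤ a → a ^ (2*δ) ≤ a := by
    intro a ha
    calc a ^ (2*δ) ≤ a ^ (1:ℝ) := Real.rpow_le_rpow_of_exponent_le ha (by linarith)
      _ = a := Real.rpow_one a
  have hA : ‖∑ n ∈ Finset.range N, (((n:ℝ)+1 : ℝ):ℂ)^(-s)‖ ≤ 3 * S * t^(2*δ) := by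
    refine (norm_sum_le _ _).trans ?_
    have : ∀ n ∈ Finset.range N, ‖(((n:ℝ)+1 : ℝ):ℂ)^(-s)‖ ≤ ((n:ℝ)+1)^(-1-δ) * (3 * t^(2*δ)) := by
      intro n hn
      have hn' : (n:ℝ)+1 ≤ N := by exact_mod_cast Finset.mem_range.mp hn
      rw [norm_cpow_eq_rpow_re_of_pos (by positivity)]
      calc ((n:ℝ)+1)^((-s).re) ≤ ((n:ℝ)+1)^((-1-δ) + 2*δ) := by
            apply Real.rpow_le_rpow_of_exponent_le
            · linarith [Nat.cast_nonneg (α := ℝ) n]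
            · simp; linarith
        _ = ((n:ℝ)+1)^(-1-δ) * ((n:ℝ)+1)^(2*δ) := Real.rpow_add (by positivity) _ _
        _ ≤ ((n:ℝ)+1)^(-1-δ) * (3*t)^(2*δ) := by gcongr; linarith
        _ = ((n:ℝ)+1)^(-1-δ) * (3^(2*δ)*t^(2*δ)) := by rw [Real.mul_rpow (by norm_num) ht0.le]
        _ ≤ _ := by gcongr; exact hpow 3 (by norm_num)
    refine (Finset.sum_le_sum this).trans ?_
    rw [← Finset.sum_mul]
    have := hSs.sum_le_tsum (Finset.range N) (fun i _ => by positivity)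
    calc _ ≤ S * (3 * t^(2*δ)) := by gcongr
      _ = _ := by ring
  have hB : ‖(((N:ℝ)+1 : ℝ):ℂ)^(1-s) / (s-1)‖ ≤ 10 * t^(2*δ) := by
    rw [norm_div, norm_cpow_eq_rpow_re_of_pos (by positivity)]
    have hs1 : 1/2 ≤ ‖s-1‖ := by
      refine le_trans ?_ (abs_im_le_norm (s-1))
      simp only [sub_im, one_im, sub_zero]; exact him.trans (le_abs_self _)
    rw [div_le_iff₀ (by linarith)]
    calc ((N:ℝ)+1)^((1-s).re) ≤ ((N:ℝ)+1)^(2*δ) := by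
            apply Real.rpow_le_rpow_of_exponent_le
            · linarith [Nat.cast_nonneg (α := ℝ) N]
            · simp; linarith
      _ ≤ (5*t)^(2*δ) := by gcongr; linarith
      _ = (5^(2*δ)*t^(2*δ)) := by rw [Real.mul_rpow (by norm_num) ht0.le]
      _ ≤ 5 * t^(2*δ) := by gcongr; exact hpow 5 (by norm_num)
      _ = 10 * t^(2*δ) * (1/2) := by ring
      _ ≤ _ := by gcongr
  have hC : ‖∑' n, pzE (n+N) s‖ ≤ 9 * S * t^(2*δ) := by
    have hs1 : s ≠ 1 := by rintro rfl; simp at ht; linarith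
    have hb : ∀ n : ℕ, ‖pzE (n+N) s‖ ≤ (9 * t^(2*δ)) * ((n:ℝ)+1)^(-1-δ) := by
      intro n
      refine (pzE_bound s (by linarith) hs1 _).trans ?_
      have hns : ‖s‖ ≤ 9 * t := by
        refine (norm_le_abs_re_add_abs_im s).trans ?_
        rw [← ht, abs_of_pos ht0, abs_of_nonneg (by linarith)]; linarith
      have hnn := Nat.cast_nonneg (α := ℝ) n
      have hq : (((n+N:ℕ):ℝ)+1)^(-s.re-1) ≤ ((n:ℝ)+1)^(-1-δ) * t^(-1+2*δ) := by
        push_cast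
        calc ((n:ℝ)+N+1)^(-s.re-1) ≤ ((n:ℝ)+N+1)^((-1-δ)+(-1+2*δ)) := by
              apply Real.rpow_le_rpow_of_exponent_le
              · linarith
              · linarith
          _ = ((n:ℝ)+N+1)^(-1-δ) * ((n:ℝ)+N+1)^(-1+2*δ) := Real.rpow_add (by positivity) _ _
          _ ≤ _ := by
              gcongr ?_ * ?_
              · exact Real.rpow_le_rpow_of_nonpos (by positivity) (by linarith) (by linarith)
              · exact Real.rpow_le_rpow_of_nonpos ht0 (by linarith) (by linarith)
      calc ‖s‖ * (((n+N:ℕ):ℝ)+1)^(-s.re-1) ≤ (9*t) * (((n:ℝ)+1)^(-1-δ) * t^(-1+2*δ)) := by gcongr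
        _ = 9 * (t * t^(-1+2*δ)) * ((n:ℝ)+1)^(-1-δ) := by ring
        _ = _ := by
          rw [← Real.rpow_one_add' ht0.le (by linarith)]
          congr 3; ring
    have := tsum_of_norm_bounded ((hSs.hasSum).mul_left (9 * t^(2*δ))) hb
    refine this.trans (le_of_eq ?_)
    ring
  calc _ ≤ ‖∑ n ∈ Finset.range N, (((n:ℝ)+1 : ℝ):ℂ)^(-s)‖ + ‖(((N:ℝ)+1 : ℝ):ℂ)^(1-s) / (s-1)‖ + ‖∑' n, pzE (n+N) s‖ := norm_add₃_le
    _ ≤ 3 * S * t^(2*δ) + 10 * t^(2*δ) + 9 * S * t^(2*δ) := by gcongr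
    _ = _ := by ring

lemma pz_zeta_bound (δ : ℝ) (hδ : 0 < δ) (hδ' : δ ≤ 1/4) : ∃ C : ℝ, 0 < C ∧ ∀ s : ℂ,
    1 - δ ≤ s.re → s.re ≤ 4 → 1/2 ≤ |s.im| → ‖riemannZeta s‖ ≤ C * |s.im| ^ (2*δ) := by
  obtain ⟨C, hC, h⟩ := pz_zeta_bound_pos δ hδ hδ'
  refine ⟨C, hC, fun s h1 h2 h3 => ?_⟩
  rcases le_total 0 s.im with h0 | h0
  · rw [abs_of_nonneg h0] at h3 ⊢
    exact h s h1 h2 h3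
  · rw [abs_of_nonpos h0] at h3 ⊢
    have := h ((starRingEnd ℂ) s) (by simpa using h1) (by simpa using h2) (by simpa using h3)
    rw [riemannZeta_conj] at this
    simpa using this

lemma pz_two_bounds (δ : ℝ) (hδ : 0 < δ) (hδ' : δ ≤ 1/4) : ∃ C : ℝ, 0 < C ∧ ∀ t : ℝ, 1 ≤ |t| →
    ∀ w : ℂ, 1 - δ/2 ≤ w.re → w.re ≤ 3 → |w.im - t| ≤ 1/4 →
      ‖riemannZeta w‖ ≤ C * |t| ^ (2*δ) ∧ ‖deriv riemannZeta w‖ ≤ C * |t| ^ (2*δ) := by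
  obtain ⟨C, hC, h⟩ := pz_zeta_bound δ hδ hδ'
  have hbig : ∀ t : ℝ, 1 ≤ |t| → ∀ w : ℂ, 1 - δ ≤ w.re → w.re ≤ 4 → |w.im - t| ≤ 1/2 →
      ‖riemannZeta w‖ ≤ 2 * C * |t| ^ (2*δ) := by
    intro t ht w h1 h2 h3
    have e1 : |t| ≤ |w.im| + |w.im - t| := by
      have := abs_sub_abs_le_abs_sub t w.im
      rw [abs_sub_comm t] at this; linarith
    have e2 : |w.im| ≤ |t| + |w.im - t| := by
      have := abs_sub_abs_le_abs_sub w.im t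
      linarith
    refine (h w h1 h2 (by linarith)).trans ?_
    have : |w.im| ^ (2*δ) ≤ 2 * |t| ^ (2*δ) := by
      calc |w.im| ^ (2*δ) ≤ (2 * |t|) ^ (2*δ) := by gcongr; linarith
        _ = 2 ^ (2*δ) * |t| ^ (2*δ) := Real.mul_rpow (by norm_num) (abs_nonneg _)
        _ ≤ 2 ^ (1:ℝ) * |t| ^ (2*δ) := by
            gcongr
            · norm_num
            · linarith
        _ = _ := by rw [Real.rpow_one]
    calc _ ≤ C * (2 * |t| ^ (2*δ)) := by gcongr
      _ = _ := by ring
  refine ⟨2 * C + 2 * C / (δ/2), by positivity, fun t ht w h1 h2 h3 => ⟨?_, ?_⟩⟩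
  · refine (hbig t ht w (by linarith) (by linarith) (by linarith)).trans ?_
    have : 0 ≤ 2 * C / (δ/2) := by positivity
    gcongr; linarith
  · have hball : ∀ z ∈ Metric.closedBall w (δ/2), 1 - δ ≤ z.re ∧ z.re ≤ 4 ∧ |z.im - t| ≤ 1/2 := by
      intro z hz
      rw [mem_closedBall_iff_norm] at hz
      have a1 := (abs_re_le_norm (z - w)).trans hz
      have a2 := (abs_im_le_norm (z - w)).trans hz
      simp only [sub_re, sub_im, abs_le] at a1 a2 h3 ⊢
      refine ⟨?_, ?_, ?_, ?_⟩ <;> linarith [a1.1, a1.2, a2.1, a2.2, h3.1, h3.2]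
    have := norm_deriv_le_of_forall_mem_sphere_norm_le (c := w) (R := δ/2)
      (C := 2 * C * |t| ^ (2*δ)) (f := riemannZeta) (by positivity) ?_ ?_
    · refine this.trans ?_
      rw [mul_div_right_comm]
      gcongr; linarith
    · refine DifferentiableOn.diffContOnCl ?_
      rw [closure_ball _ (by positivity)]
      intro z hz
      refine (differentiableAt_riemannZeta ?_).differentiableWithinAt
      rintro rfl
      have := (hball _ hz).2.2
      simp at this; linarith
    · intro z hz
      obtain ⟨b1, b2, b3⟩ := hball z (Metric.sphere_subset_closedBall hz)
      exact hbig t ht z b1 b2 b3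

lemma pz_341 {x : ℝ} (hx : 0 < x) (y : ℝ) :
    1 ≤ ‖riemannZeta (1 + x)‖ ^ 3 * ‖riemannZeta (1 + x + I * y)‖ ^ 4 * ‖riemannZeta (1 + x + 2 * I * y)‖ := by
  have := DirichletCharacter.norm_LFunction_product_ge_one (N := 1) (1 : DirichletCharacter ℂ 1) hx y
  simpa [DirichletCharacter.LFunctionTrivChar, DirichletCharacter.LFunction_modOne_eq] using this

lemma pz_real_zeta : ∃ C : ℝ, 0 < C ∧ ∀ x : ℝ, 0 < x → x ≤ 2 → x * ‖riemannZeta (1 + x)‖ ≤ C := by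
  have hc : Continuous riemannZeta₁ := differentiable_riemannZeta₁.continuous
  obtain ⟨C, hC⟩ := (isCompact_Icc (a := (0:ℝ)) (b := 2)).exists_bound_of_continuousOn
    (f := fun x : ℝ => riemannZeta₁ (1 + x)) (by fun_prop)
  refine ⟨|C| + 1, by positivity, fun x hx hx2 => ?_⟩
  have h1 : (1 + x : ℂ) ≠ 1 := by simp [hx.ne']
  have := hC x ⟨hx.le, hx2⟩
  rw [riemannZeta_eq_inv_sub_mul h1, norm_mul]
  simp only [add_sub_cancel_left, norm_inv, norm_real, Real.norm_eq_abs, abs_of_pos hx]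
  rw [mul_inv_cancel_left₀ hx.ne']
  linarith [le_abs_self C]

lemma pz_lower (T t : ℝ) (hT : 1 ≤ T)
    (h1 : ∀ x : ℝ, 0 ≤ x → x ≤ 1 → ‖deriv riemannZeta (1 + x + I * t)‖ ≤ T)
    (h2 : ∀ x : ℝ, 0 < x → x ≤ 1 → ‖riemannZeta (1 + x + 2 * I * t)‖ ≤ T)
    (h3 : ∀ x : ℝ, 0 < x → x ≤ 1 → x * ‖riemannZeta (1 + x)‖ ≤ T) (ht : t ≠ 0)
    (x : ℝ) (hx : 0 < x) (hx1 : x ≤ 1) : 1 / (16 * T^7) ≤ ‖riemannZeta (1 + x + I * t)‖ := by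
  have hT0 : 0 < T := by linarith
  set η := 1 / (16 * T^8) with hη
  have hη0 : 0 < η := by positivity
  have hη1 : η ≤ 1 := by
    rw [hη, div_le_one (by positivity)]
    nlinarith [one_le_pow₀ hT (n := 8)]
  have key : ∀ y : ℝ, η ≤ y → y ≤ 1 → 1 / (8 * T^7) ≤ ‖riemannZeta (1 + y + I * t)‖ := by
    intro y hy hy1
    have hy0 : 0 < y := by linarith
    have a := pz_341 hy0 t
    have b2 := h2 y hy0 hy1
    have b3 := h3 y hy0 hy1
    set X := ‖riemannZeta (1 + y + I * t)‖
    have hX : 0 ≤ X := norm_nonneg _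
    have b3' : ‖riemannZeta (1 + y)‖ ≤ T / y := by rw [le_div_iff₀ hy0]; linarith
    have c : 1 ≤ (T/y)^3 * X^4 * T := a.trans (by gcongr)
    have d : 1 ≤ (T/η)^3 * X^4 * T := c.trans (by gcongr)
    have e : (T/η)^3 * X^4 * T = (8 * T^7 * X)^4 := by rw [hη]; field_simp; ring
    rw [e] at d
    have f : 1 ≤ 8 * T^7 * X := by
      by_contra! hlt
      exact absurd d (not_le.mpr (pow_lt_one₀ (by positivity) hlt (by norm_num)))
    rw [div_le_iff₀ (by positivity)]; linarith
  rcases le_total η x with h | h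
  · refine le_trans ?_ (key x h hx1)
    gcongr; norm_num
  · have hmv := (convex_Icc (0:ℝ) 1).norm_image_sub_le_of_norm_hasDerivWithin_le
      (f := fun y : ℝ => riemannZeta (1 + y + I * t)) (f' := fun y : ℝ => deriv riemannZeta (1 + y + I * t))
      (C := T) (x := x) (y := η) ?_ ?_ ⟨hx.le, hx1⟩ ⟨hη0.le, hη1⟩
    · have hk := key η le_rfl hη1
      have hh : ‖η - x‖ ≤ η := by
        rw [Real.norm_eq_abs, abs_of_nonneg (by linarith)]; linarith
      have hm : ‖riemannZeta (1 + η + I * t) - riemannZeta (1 + x + I * t)‖ ≤ T * η := hmv.trans (by gcongr)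
      have hTη : T * η = 1 / (16 * T^7) := by rw [hη]; field_simp
      have h8 : 1 / (8 * T^7) = 1 / (16 * T^7) + 1 / (16 * T^7) := by field_simp; norm_num
      have := norm_sub_norm_le (riemannZeta (1 + η + I * t)) (riemannZeta (1 + x + I * t))
      linarith
    · intro y hy
      have hne : (1 + y + I * t : ℂ) ≠ 1 := by
        intro h; have := congrArg Complex.im h; simp at this; exact ht this
      have hd := (differentiableAt_riemannZeta hne).hasDerivAt
      have hl : HasDerivAt (fun y : ℝ => (1 + y + I * t : ℂ)) 1 y := by
        have := ((HasDerivAt.ofReal_comp (hasDerivAt_id y)).const_add (1:ℂ)).add_const (I * t)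
        simpa using this
      have := HasDerivAt.comp (𝕜' := ℂ) y hd hl
      simp only [mul_one] at this
      exact this.hasDerivWithinAt
    · intro y hy; exact h1 y hy.1 hy.2

set_option maxHeartbeats 1000000 in
lemma pz_logDeriv_bound (n : ℕ) : ∃ C : ℝ, 0 < C ∧ ∀ s : ℂ, 1 < s.re → s.re ≤ 2 → 1 ≤ |s.im| →
    ‖iteratedDeriv n (fun z => deriv riemannZeta z / riemannZeta z) s‖ ≤ C * |s.im| := by
  set δ : ℝ := 1 / (16 * (n+1)) with hδd
  have hn : (0:ℝ) ≤ n := Nat.cast_nonneg n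
  have hδ : 0 < δ := by positivity
  have hδ' : δ ≤ 1/16 := by
    rw [hδd]; gcongr; linarith
  obtain ⟨C1, hC1, hb⟩ := pz_two_bounds δ hδ (by linarith)
  obtain ⟨C2, hC2, hr⟩ := pz_real_zeta
  set C := 2 * C1 + C2 + 1 + 2/δ with hC
  have hδ2 : 0 < 2/δ := by positivity
  have hC0 : 0 < C := by positivity
  refine ⟨n.factorial * 32^(n+1) * C^(8*(n+1)), by positivity, fun s hs1 hs2 him => ?_⟩
  set t := s.im with ht
  have ht0 : 0 < |t| := by linarith
  have htn : t ≠ 0 := abs_pos.mp ht0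
  have hP : 1 ≤ |t|^(2*δ) := Real.one_le_rpow him (by positivity)
  set T := C * |t|^(2*δ) with hT
  have hTC : C ≤ T := le_mul_of_one_le_right hC0.le hP
  have hT1 : 1 ≤ T := by linarith
  have hT0 : 0 < T := by linarith
  have hC1T : C1 * |t|^(2*δ) ≤ T := by rw [hT]; gcongr; linarith
  have hform : ∀ x : ℝ, (1 + x + I * t : ℂ).re = 1 + x ∧ (1 + x + I * t : ℂ).im = t := by
    intro x; simp
  have hform2 : ∀ x : ℝ, (1 + x + 2 * I * t : ℂ).re = 1 + x ∧ (1 + x + 2 * I * t : ℂ).im = 2 * t := by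
    intro x; simp
  have hlow := pz_lower T t hT1 ?_ ?_ ?_ htn
  rotate_left
  · intro x hx0 hx1
    refine ((hb t him _ ?_ ?_ ?_).2).trans hC1T
    · rw [(hform x).1]; linarith
    · rw [(hform x).1]; linarith
    · rw [(hform x).2]; norm_num
  · intro x hx0 hx1
    refine ((hb (2*t) ?_ _ ?_ ?_ ?_).1).trans ?_
    · rw [abs_mul]; norm_num; linarith
    · rw [(hform2 x).1]; linarith
    · rw [(hform2 x).1]; linarith
    · rw [(hform2 x).2]; norm_num
    · rw [abs_mul, Real.mul_rpow (abs_nonneg _) (abs_nonneg _), abs_two]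
      have : (2:ℝ)^(2*δ) ≤ 2 := by
        calc (2:ℝ)^(2*δ) ≤ 2^(1:ℝ) := Real.rpow_le_rpow_of_exponent_le (by norm_num) (by linarith)
          _ = 2 := Real.rpow_one 2
      calc C1 * (2^(2*δ) * |t|^(2*δ)) ≤ C1 * (2 * |t|^(2*δ)) := by gcongr
        _ = (2 * C1) * |t|^(2*δ) := by ring
        _ ≤ T := by rw [hT]; gcongr; linarith
  · intro x hx0 hx1
    exact (hr x hx0 (by linarith)).trans (by linarith)
  have hs : 1 / (16 * T^7) ≤ ‖riemannZeta s‖ := by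
    have := hlow (s.re - 1) (by linarith) (by linarith)
    convert this using 3
    apply Complex.ext <;> simp [ht]
  set r := 1 / (32 * T^8) with hrr
  have hr0 : 0 < r := by positivity
  have hT8 : T ≤ T^8 := le_self_pow₀ hT1 (by norm_num)
  have hr1 : r ≤ δ/2 := by
    have : 2/δ ≤ T^8 := by linarith
    rw [hrr, div_le_iff₀ (by positivity)]
    rw [div_le_iff₀ hδ] at this
    linarith
  have hball : ∀ z ∈ Metric.closedBall s r, 1 - δ/2 ≤ z.re ∧ z.re ≤ 3 ∧ |z.im - t| ≤ 1/4 := by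
    intro z hz
    rw [mem_closedBall_iff_norm] at hz
    have a1 := (abs_re_le_norm (z - s)).trans hz
    have a2 := (abs_im_le_norm (z - s)).trans hz
    simp only [sub_re, sub_im, abs_le] at a1 a2 ⊢
    refine ⟨?_, ?_, ?_, ?_⟩ <;> linarith [a1.1, a1.2, a2.1, a2.2]
  have hne1 : ∀ z ∈ Metric.closedBall s r, z ≠ 1 := by
    rintro z hz rfl
    have := (hball _ hz).2.2
    simp at this; linarith
  have hd : ∀ z ∈ Metric.closedBall s r, ‖deriv riemannZeta z‖ ≤ T := fun z hz =>
    (hb t him z (hball z hz).1 (hball z hz).2.1 (hball z hz).2.2).2.trans hC1T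
  have hz : ∀ z ∈ Metric.closedBall s r, 1 / (32 * T^7) ≤ ‖riemannZeta z‖ := by
    intro z hz
    have hm := (convex_closedBall s r).norm_image_sub_le_of_norm_hasDerivWithin_le
      (f := riemannZeta) (f' := deriv riemannZeta) (C := T) (x := s) (y := z)
      (fun w hw => (differentiableAt_riemannZeta (hne1 w hw)).hasDerivAt.hasDerivWithinAt) hd
      (Metric.mem_closedBall_self hr0.le) hz
    have hz' := mem_closedBall_iff_norm.mp hz
    have hm2 : ‖riemannZeta z - riemannZeta s‖ ≤ T * r := hm.trans (by gcongr)
    have hTr : T * r = 1 / (32 * T^7) := by rw [hrr]; field_simp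
    have h8 : 1 / (16 * T^7) = 1 / (32 * T^7) + 1 / (32 * T^7) := by field_simp; norm_num
    have := norm_sub_norm_le (riemannZeta s) (riemannZeta z)
    rw [norm_sub_rev] at this
    linarith
  have hz0 : ∀ z ∈ Metric.closedBall s r, riemannZeta z ≠ 0 := by
    intro z hz' h0
    have := hz z hz'
    rw [h0, norm_zero] at this
    have : 0 < 1 / (32 * T^7) := by positivity
    linarith
  have hfin := norm_iteratedDeriv_le_of_forall_mem_sphere_norm_le (c := s) (R := r) (C := 32 * T^8)
    (f := fun z => deriv riemannZeta z / riemannZeta z) n hr0 ?_ ?_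
  · refine hfin.trans (le_of_eq ?_)
    have e1 : T^(8*(n+1)) = C^(8*(n+1)) * |t| := by
      rw [hT, mul_pow, ← Real.rpow_natCast (|t|^(2*δ)), ← Real.rpow_mul ht0.le]
      have : 2 * δ * ((8*(n+1) : ℕ) : ℝ) = 1 := by
        rw [hδd]; push_cast; field_simp; norm_num
      rw [this, Real.rpow_one]
    rw [mul_assoc _ _ |t|, ← e1, hrr, one_div, inv_pow, div_inv_eq_mul, mul_assoc, ← pow_succ',
      mul_pow, ← pow_mul, mul_assoc]
  · refine DifferentiableOn.diffContOnCl ?_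
    rw [closure_ball _ hr0.ne']
    intro z hz'
    have hda : DifferentiableAt ℂ (deriv riemannZeta) z := by
      have hA : AnalyticAt ℂ riemannZeta z := by
        have ho : IsOpen ({1}ᶜ : Set ℂ) := isOpen_compl_singleton
        exact differentiableOn_riemannZeta.analyticAt (ho.mem_nhds (hne1 z hz'))
      exact hA.deriv.differentiableAt
    exact (hda.div (differentiableAt_riemannZeta (hne1 z hz')) (hz0 z hz')).differentiableWithinAt
  · intro z hz'
    have hz'' := Metric.sphere_subset_closedBall hz'
    rw [norm_div, div_le_iff₀ (norm_pos_iff.mpr (hz0 z hz''))]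
    have a := hz z hz''
    calc ‖deriv riemannZeta z‖ ≤ T := hd z hz''
      _ = 32 * T^8 * (1 / (32 * T^7)) := by field_simp
      _ ≤ _ := by gcongr

noncomputable def pzA (α : ℝ) (n : ℕ) : ℂ := if n.Prime then ((Real.log n ^ α : ℝ) : ℂ) else 0

noncomputable def pzB (n : ℕ) : ℂ := if n.Prime then 0 else ((ArithmeticFunction.vonMangoldt n : ℝ) : ℂ)

lemma pzA_abscissa (α : ℝ) : LSeries.abscissaOfAbsConv (pzA α) ≤ 1 := by
  refine LSeries.abscissaOfAbsConv_le_of_forall_lt_LSeriesSummable fun y hy => ?_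
  set ε := (y - 1) / 2 with hε
  have hε0 : 0 < ε := by rw [hε]; linarith
  refine LSeriesSummable_of_isBigO_rpow (x := 1 + ε) (by simp; linarith) ?_
  have h1 : (fun n : ℕ => Real.log n ^ α) =O[Filter.atTop] fun n : ℕ => (n:ℝ)^ε :=
    ((isLittleO_log_rpow_rpow_atTop α hε0).comp_tendsto tendsto_natCast_atTop_atTop).isBigO
  rw [add_sub_cancel_left]
  refine Asymptotics.IsBigO.trans ?_ h1
  refine Asymptotics.IsBigO.of_bound 1 (Filter.Eventually.of_forall fun n => ?_)
  unfold pzA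
  split_ifs
  · simp
  · simp

lemma pzA_abscissa_lt (α : ℝ) {s : ℂ} (hs : 1 < s.re) : LSeries.abscissaOfAbsConv (pzA α) < s.re :=
  (pzA_abscissa α).trans_lt (by exact_mod_cast hs)

lemma pzA_logMul (α : ℝ) : LSeries.logMul (pzA α) = pzA (α + 1) := by
  ext n
  unfold LSeries.logMul pzA
  split_ifs with h
  · have h0 : 0 < Real.log n := Real.log_pos (by exact_mod_cast h.one_lt)
    rw [Real.rpow_add h0, Real.rpow_one, ← natCast_log]
    push_cast; ring
  · simp

lemma pzA_hasDerivAt (α : ℝ) {s : ℂ} (hs : 1 < s.re) :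
    HasDerivAt (LSeries (pzA α)) (- LSeries (pzA (α+1)) s) s := by
  have := LSeries_hasDerivAt (pzA_abscissa_lt α hs)
  rwa [pzA_logMul] at this

lemma pzA_iterate (α : ℝ) (k : ℕ) : LSeries.logMul^[k] (pzA α) = pzA (α + k) := by
  induction k with
  | zero => simp
  | succ k ih =>
    rw [Function.iterate_succ_apply', ih, pzA_logMul]; push_cast; ring_nf

lemma pzA_iteratedDeriv (α : ℝ) (k : ℕ) {s : ℂ} (hs : 1 < s.re) :
    iteratedDeriv k (LSeries (pzA α)) s = (-1)^k * LSeries (pzA (α+k)) s := by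
  rw [LSeries_iteratedDeriv k (pzA_abscissa_lt α hs), pzA_iterate]

lemma pz_tsum_eq (α : ℝ) (z : ℂ) :
    ∑' p : Nat.Primes, ((Real.log (p : ℕ) ^ α : ℝ) : ℂ) / ((p : ℕ) : ℂ) ^ z = LSeries (pzA α) z := by
  unfold LSeries
  have := tsum_subtype {p : ℕ | p.Prime} (fun n : ℕ => ((Real.log n ^ α : ℝ) : ℂ) / (n : ℂ) ^ z)
  refine Eq.trans this ?_
  congr 1; ext n
  rw [LSeries.term_def]
  unfold pzA Set.indicator
  by_cases h : n.Prime
  · simp [h, h.ne_zero]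
  · simp [h]

noncomputable def pzF₀ (n : ℕ) : ℝ := (if n.Prime then 0 else ArithmeticFunction.vonMangoldt n) / (n:ℝ)^(3/4:ℝ)
noncomputable def pzF' (pk : Nat.Primes × ℕ) : ℝ := pzF₀ (pk.1 ^ (pk.2 + 1))
noncomputable def pzF'' : Nat.Primes × ℕ → ℝ := pzF' ∘ (Prod.map _root_.id (· + 1))

lemma pzF₀_nonneg (n : ℕ) : 0 ≤ pzF₀ n := by
  unfold pzF₀
  have := ArithmeticFunction.vonMangoldt_nonneg (n := n)
  split_ifs <;> positivity

lemma pzF''_le (p : Nat.Primes) (k : ℕ) :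
    pzF'' (p, k) ≤ 8 * (((2:ℝ)^(-(3/4):ℝ)) ^ k * (p : ℝ) ^ (-(11/8) : ℝ)) := by
  have hp0 : (0:ℝ) < p := by exact_mod_cast p.prop.pos
  have hp2 : (2:ℝ) ≤ p := by exact_mod_cast p.prop.two_le
  have e1 : pzF'' (p, k) = Real.log p * ((p:ℝ)^(-(3/4):ℝ))^(k+2) := by
    have hnp : ¬ ((p:ℕ)^(k+1+1)).Prime := Nat.Prime.not_prime_pow (by omega)
    simp only [pzF'', Function.comp_apply, pzF', pzF₀, Prod.map_apply, id_eq, hnp, if_false]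
    rw [ArithmeticFunction.vonMangoldt_apply_pow (by omega), ArithmeticFunction.vonMangoldt_apply_prime p.prop]
    rw [div_eq_mul_inv]
    congr 1
    push_cast
    rw [← Real.rpow_natCast, ← Real.rpow_natCast, ← Real.rpow_mul hp0.le, ← Real.rpow_mul hp0.le, ← Real.rpow_neg hp0.le]
    congr 1; push_cast; ring
  rw [e1]
  calc Real.log p * ((p:ℝ)^(-(3/4):ℝ))^(k+2) ≤ ((p:ℝ)^(1/8:ℝ) / (1/8)) * (((p:ℝ)^(-(3/4):ℝ))^k * ((p:ℝ)^(-(3/4):ℝ))^2) := by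
        rw [pow_add]
        gcongr
        exact Real.log_le_rpow_div hp0.le (by norm_num)
    _ ≤ ((p:ℝ)^(1/8:ℝ) / (1/8)) * (((2:ℝ)^(-(3/4):ℝ))^k * ((p:ℝ)^(-(3/4):ℝ))^2) := by
        gcongr ?_ * (?_^k * ?_)
        exact Real.rpow_le_rpow_of_nonpos (by norm_num) hp2 (by norm_num)
    _ = 8 * (((2:ℝ)^(-(3/4):ℝ))^k * ((p:ℝ)^(1/8:ℝ) * ((p:ℝ)^(-(3/4):ℝ))^2)) := by ring
    _ = _ := by
        rw [← Real.rpow_natCast ((p:ℝ)^(-(3/4):ℝ)) 2, ← Real.rpow_mul hp0.le, ← Real.rpow_add hp0]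
        norm_num

lemma pz_summable_F'' : Summable pzF'' := by
  have hg : Summable (fun k : ℕ => ((2:ℝ)^(-(3/4):ℝ)) ^ k) := by
    refine summable_geometric_of_lt_one (by positivity) ?_
    exact Real.rpow_lt_one_of_one_lt_of_neg (by norm_num) (by norm_num)
  have hp : Summable (fun p : Nat.Primes => (p:ℝ)^(-(11/8):ℝ)) :=
    Nat.Primes.summable_rpow.mpr (by norm_num)
  have := (hp.mul_of_nonneg hg (fun p => by positivity) (fun k => by positivity)).mul_left 8
  refine this.of_nonneg_of_le (fun pk => pzF₀_nonneg _) (fun pk => ?_)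
  refine (pzF''_le pk.1 pk.2).trans (le_of_eq ?_)
  ring

lemma pz_summable_F₀ : Summable pzF₀ := by
  have hF₀ (p : Nat.Primes) : pzF₀ p.val = 0 := by
    simp only [p.prop, ↓reduceIte, zero_div, pzF₀]
  refine (summable_subtype_iff_indicator (s := {n | IsPrimePow n}).mp ?_).congr
      fun n ↦ Set.indicator_apply_eq_self.mpr fun (hn : ¬ IsPrimePow n) ↦ ?_
  swap
  · have : ArithmeticFunction.vonMangoldt n = 0 := ArithmeticFunction.vonMangoldt_eq_zero_iff.mpr hn
    simp [pzF₀, this]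
  have hFF' :
      pzF₀ ∘ Subtype.val (p := fun n ↦ n ∈ {n | IsPrimePow n}) = pzF' ∘ ⇑Nat.Primes.prodNatEquiv.symm := by
    refine (Equiv.eq_comp_symm Nat.Primes.prodNatEquiv (pzF₀ ∘ Subtype.val) pzF').mpr ?_
    ext1 n
    simp only [Function.comp_apply, pzF']
    congr
  rw [hFF']
  refine (Nat.Primes.prodNatEquiv.symm.summable_iff (f := pzF')).mpr ?_
  have hF'₀ (p : Nat.Primes) : pzF' (p, 0) = 0 := by simp only [zero_add, pow_one, hF₀, pzF']
  have hF'₁ : pzF'' = pzF' ∘ (Prod.map _root_.id (· + 1)) := rfl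
  refine (Function.Injective.summable_iff ?_ fun u hu ↦ ?_).mp <| hF'₁ ▸ pz_summable_F''
  · exact Function.Injective.prodMap (fun ⦃a₁ a₂⦄ a ↦ a) <| add_left_injective 1
  · simp only [Set.range_prodMap, Set.range_id, Set.mem_prod, Set.mem_univ, Set.mem_range,
      Nat.exists_add_one_eq, true_and, not_lt, nonpos_iff_eq_zero] at hu
    rw [← hF'₀ u.1, ← hu]

lemma pzB_norm_term (n : ℕ) : ‖LSeries.term pzB ((3/4:ℝ):ℂ) n‖ = pzF₀ n := by
  rw [LSeries.norm_term_eq]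
  rcases eq_or_ne n 0 with rfl | hn
  · simp [pzF₀]
  · rw [if_neg hn, pzF₀, pzB]
    have := ArithmeticFunction.vonMangoldt_nonneg (n := n)
    split_ifs
    · simp
    · simp [abs_of_nonneg this]

lemma pzB_summable : LSeriesSummable pzB ((3/4:ℝ):ℂ) := by
  refine Summable.of_norm ?_
  simp_rw [pzB_norm_term]
  exact pz_summable_F₀

lemma pzB_abscissa {s : ℂ} (hs : 3/4 < s.re) : LSeries.abscissaOfAbsConv pzB < s.re := by
  refine pzB_summable.abscissaOfAbsConv_le.trans_lt ?_
  rw [ofReal_re]; exact_mod_cast hs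

lemma pzB_bound {s : ℂ} (hs : 3/4 ≤ s.re) : ‖LSeries pzB s‖ ≤ ∑' n, pzF₀ n := by
  refine tsum_of_norm_bounded pz_summable_F₀.hasSum fun n => ?_
  rw [← pzB_norm_term]
  exact LSeries.norm_term_le_of_re_le_re _ (by simpa using hs) n

lemma pzB_differentiableAt {s : ℂ} (hs : 3/4 < s.re) : DifferentiableAt ℂ (LSeries pzB) s :=
  (LSeries_hasDerivAt (pzB_abscissa hs)).differentiableAt

lemma pzB_iteratedDeriv (n : ℕ) : ∃ C : ℝ, 0 < C ∧ ∀ s : ℂ, 1 ≤ s.re → ‖iteratedDeriv n (LSeries pzB) s‖ ≤ C := by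
  have hS : 0 ≤ ∑' n, pzF₀ n := tsum_nonneg pzF₀_nonneg
  refine ⟨n.factorial * (∑' n, pzF₀ n) / (1/8)^n + 1, by positivity, fun s hs => ?_⟩
  have hball : ∀ z ∈ Metric.closedBall s (1/8), 3/4 < z.re := by
    intro z hz
    rw [mem_closedBall_iff_norm] at hz
    have a1 := (abs_re_le_norm (z - s)).trans hz
    simp only [sub_re, abs_le] at a1
    linarith [a1.1]
  refine (norm_iteratedDeriv_le_of_forall_mem_sphere_norm_le (c := s) (R := 1/8) (C := ∑' n, pzF₀ n) n
    (by norm_num) ?_ ?_).trans (by linarith)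
  · refine DifferentiableOn.diffContOnCl ?_
    rw [closure_ball _ (by norm_num)]
    intro z hz
    exact (pzB_differentiableAt (hball z hz)).differentiableWithinAt
  · intro z hz
    exact pzB_bound (hball z (Metric.sphere_subset_closedBall hz)).le

lemma pzA_one_eq {s : ℂ} (hs : 1 < s.re) :
    LSeries (pzA 1) s = - (deriv riemannZeta s / riemannZeta s) - LSeries pzB s := by
  have h1 := ArithmeticFunction.LSeries_vonMangoldt_eq_deriv_riemannZeta_div hs
  have h2 : (fun n : ℕ => ((ArithmeticFunction.vonMangoldt n : ℝ) : ℂ)) = pzA 1 + pzB := by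
    ext n
    simp only [Pi.add_apply, pzA, pzB]
    split_ifs with h
    · rw [ArithmeticFunction.vonMangoldt_apply_prime h]; simp
    · simp
  rw [h2, LSeries_add (LSeriesSummable_of_abscissaOfAbsConv_lt_re (pzA_abscissa_lt 1 hs))
    (LSeriesSummable_of_abscissaOfAbsConv_lt_re (pzB_abscissa (by linarith)))] at h1
  rw [neg_div] at h1
  linear_combination h1

noncomputable def pzW (n : ℕ) (s : ℂ) : ℂ := LSeries (pzA (n + 1)) s - n.factorial / (s - 1) ^ (n + 1)

lemma pz_half_nhds {a : ℝ} {s : ℂ} (hs : a < s.re) : ∀ᶠ z in nhds s, a < z.re :=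
  (isOpen_lt continuous_const continuous_re).mem_nhds hs

lemma pzW_hasDerivAt (n : ℕ) {s : ℂ} (hs : 1 < s.re) : HasDerivAt (pzW n) (- pzW (n + 1) s) s := by
  have hne : s - 1 ≠ 0 := by
    intro h
    have := congrArg Complex.re h
    simp at this
    linarith
  have h1 := pzA_hasDerivAt (n + 1) hs
  have h2 : HasDerivAt (fun z : ℂ => (n.factorial : ℂ) / (z - 1) ^ (n + 1))
      (- ((n + 1).factorial / (s - 1) ^ (n + 2))) s := by
    have h3 : HasDerivAt (fun z : ℂ => (z - 1) ^ (n + 1)) ((n + 1 : ℕ) * (s - 1) ^ n) s := by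
      refine (((hasDerivAt_id s).sub_const 1).fun_pow (n + 1)).congr_deriv ?_
      simp
    have h4 := (hasDerivAt_const s (n.factorial : ℂ)).fun_div h3 (pow_ne_zero _ hne)
    refine h4.congr_deriv ?_
    rw [Nat.factorial_succ]
    push_cast
    field_simp
    ring
  have h5 := h1.sub h2
  have e : pzW n = LSeries (pzA (n + 1)) - (fun z : ℂ => (n.factorial : ℂ) / (z - 1) ^ (n + 1)) := by
    ext z; simp [pzW]
  rw [e]
  refine h5.congr_deriv ?_
  simp only [pzW]
  push_cast
  ring

lemma pzW_iter (n : ℕ) {s : ℂ} (hs : 1 < s.re) : iteratedDeriv n (pzW 0) s = (-1) ^ n * pzW n s := by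
  induction n generalizing s with
  | zero => simp
  | succ n ih =>
    rw [iteratedDeriv_succ]
    have : iteratedDeriv n (pzW 0) =ᶠ[nhds s] fun z => (-1) ^ n * pzW n z := by
      filter_upwards [pz_half_nhds hs] with z hz using ih hz
    rw [this.deriv_eq, ((pzW_hasDerivAt n hs).const_mul _).deriv]
    ring

lemma pz_analyticAt_of_half {f : ℂ → ℂ} {a : ℝ} (h : ∀ z : ℂ, a < z.re → DifferentiableAt ℂ f z) {s : ℂ}
    (hs : a < s.re) : AnalyticAt ℂ f s := by
  have ho : IsOpen {z : ℂ | a < z.re} := isOpen_lt continuous_const continuous_re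
  exact DifferentiableOn.analyticAt (s := {z : ℂ | a < z.re})
    (fun z hz => (h z hz).differentiableWithinAt) (ho.mem_nhds hs)

lemma pzB_analyticAt {s : ℂ} (hs : 3/4 < s.re) : AnalyticAt ℂ (LSeries pzB) s :=
  pz_analyticAt_of_half (fun _ hz => pzB_differentiableAt hz) hs

lemma pzW_strip_large (n : ℕ) : ∃ C : ℝ, 0 < C ∧ ∀ s : ℂ, 1 < s.re → s.re ≤ 2 → 1 ≤ |s.im| →
    ‖pzW n s‖ ≤ C * (1 + |s.im|) := by
  obtain ⟨C1, hC1, h1⟩ := pz_logDeriv_bound n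
  obtain ⟨C2, hC2, h2⟩ := pzB_iteratedDeriv n
  refine ⟨C1 + C2 + n.factorial, by positivity, fun s hs hs2 him => ?_⟩
  have hz : AnalyticAt ℂ (fun z => deriv riemannZeta z / riemannZeta z) s := by
    have hn1 : s ≠ 1 := by rintro rfl; simp at hs
    have ha : AnalyticAt ℂ riemannZeta s := by
      refine DifferentiableOn.analyticAt (s := {1}ᶜ)
        (fun z hz => (differentiableAt_riemannZeta hz).differentiableWithinAt)
        (isOpen_compl_singleton.mem_nhds hn1)
    exact ha.deriv.div ha (riemannZeta_ne_zero_of_one_le_re hs.le)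
  have e : LSeries (pzA 1) =ᶠ[nhds s] fun z => -(deriv riemannZeta z / riemannZeta z + LSeries pzB z) := by
    filter_upwards [pz_half_nhds hs] with z hz
    rw [pzA_one_eq hz]; ring
  have e2 := e.iteratedDeriv_eq n
  rw [pzA_iteratedDeriv 1 n hs, iteratedDeriv_fun_neg, iteratedDeriv_fun_add hz.contDiffAt
    (pzB_analyticAt (by linarith)).contDiffAt] at e2
  have e3 : ‖LSeries (pzA (n + 1)) s‖ ≤ C1 * |s.im| + C2 := by
    have : ‖LSeries (pzA (n + 1)) s‖ = ‖(-1) ^ n * LSeries (pzA (1 + n)) s‖ := by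
      rw [add_comm (n : ℝ) 1]; simp
    rw [this, e2, norm_neg]
    exact (norm_add_le _ _).trans (add_le_add (h1 s hs hs2 him) (h2 s hs.le))
  have e4 : ‖(n.factorial : ℂ) / (s - 1) ^ (n + 1)‖ ≤ n.factorial := by
    rw [norm_div, norm_pow, Complex.norm_natCast]
    refine div_le_self (by positivity) (one_le_pow₀ ?_)
    have := abs_im_le_norm (s - 1)
    simp only [sub_im, one_im, sub_zero] at this
    linarith
  calc ‖pzW n s‖ ≤ _ := norm_sub_le _ _
    _ ≤ C1 * |s.im| + C2 + n.factorial := add_le_add e3 e4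
    _ ≤ _ := by
      have : 0 ≤ (n.factorial : ℝ) := by positivity
      nlinarith [abs_nonneg s.im]

lemma pz_zeta₁_eq (z : ℂ) (hz : z ≠ 1) : riemannZeta₁ z = (z - 1) * riemannZeta z := by
  have : z - 1 ≠ 0 := sub_ne_zero.2 hz
  rw [riemannZeta_eq_inv_sub_mul hz]
  field_simp

lemma pz_zeta₁_ne {z : ℂ} (hz : 1 ≤ z.re) : riemannZeta₁ z ≠ 0 := by
  by_cases h : z = 1
  · rw [h, riemannZeta₁_one]; exact one_ne_zero
  · rw [pz_zeta₁_eq z h]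
    exact mul_ne_zero (sub_ne_zero.2 h) (riemannZeta_ne_zero_of_one_le_re hz)

lemma pzW_zero_eq {s : ℂ} (hs : 1 < s.re) :
    pzW 0 s = - (deriv riemannZeta₁ s / riemannZeta₁ s + LSeries pzB s) := by
  have hn1 : s ≠ 1 := by rintro rfl; simp at hs
  have hne : s - 1 ≠ 0 := sub_ne_zero.2 hn1
  have hz := riemannZeta_ne_zero_of_one_le_re hs.le
  have hd : deriv riemannZeta₁ s = riemannZeta s + (s - 1) * deriv riemannZeta s := by
    have e : riemannZeta₁ =ᶠ[nhds s] fun z => (z - 1) * riemannZeta z := by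
      filter_upwards [isOpen_compl_singleton.mem_nhds hn1] with z hz using pz_zeta₁_eq z hz
    rw [e.deriv_eq]
    have := ((hasDerivAt_id s).sub_const 1).fun_mul (differentiableAt_riemannZeta hn1).hasDerivAt
    simp only [id, one_mul] at this
    exact this.deriv
  have : pzW 0 s = LSeries (pzA 1) s - 1 / (s - 1) := by simp [pzW]
  rw [this, pzA_one_eq hs, hd, pz_zeta₁_eq s hn1]
  field_simp
  ring

lemma pzW_strip_small (n : ℕ) : ∃ C : ℝ, 0 < C ∧ ∀ s : ℂ, 1 < s.re → s.re ≤ 2 → |s.im| ≤ 1 →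
    ‖pzW n s‖ ≤ C := by
  obtain ⟨C2, hC2, h2⟩ := pzB_iteratedDeriv n
  have hZ : ∀ z : ℂ, AnalyticAt ℂ riemannZeta₁ z := fun z => differentiable_riemannZeta₁.analyticAt z
  have hQ : ∀ z : ℂ, 1 ≤ z.re → AnalyticAt ℂ (fun w => deriv riemannZeta₁ w / riemannZeta₁ w) z :=
    fun z hz => (hZ z).deriv.div (hZ z) (pz_zeta₁_ne hz)
  have hcomp : IsCompact (Set.Icc (1:ℝ) 2 ×ℂ Set.Icc (-1:ℝ) 1) := isCompact_Icc.reProdIm isCompact_Icc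
  obtain ⟨M, hM⟩ := hcomp.exists_bound_of_continuousOn
    (f := iteratedDeriv n (fun w => deriv riemannZeta₁ w / riemannZeta₁ w)) (by
      intro z hz
      rw [mem_reProdIm] at hz
      rw [iteratedDeriv_eq_iterate]
      exact ((hQ z hz.1.1).iterated_deriv n).continuousAt.continuousWithinAt)
  refine ⟨|M| + C2, by positivity, fun s hs hs2 him => ?_⟩
  have e : pzW 0 =ᶠ[nhds s] fun z => -(deriv riemannZeta₁ z / riemannZeta₁ z + LSeries pzB z) := by
    filter_upwards [pz_half_nhds hs] with z hz
    rw [pzW_zero_eq hz]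
  have e2 := e.iteratedDeriv_eq n
  rw [pzW_iter n hs, iteratedDeriv_fun_neg, iteratedDeriv_fun_add (hQ s hs.le).contDiffAt
    (pzB_analyticAt (by linarith)).contDiffAt] at e2
  have : ‖pzW n s‖ = ‖(-1) ^ n * pzW n s‖ := by simp
  rw [this, e2, norm_neg]
  refine (norm_add_le _ _).trans (add_le_add ((hM s ?_).trans (le_abs_self M)) (h2 s hs.le))
  rw [mem_reProdIm]
  exact ⟨⟨hs.le, hs2⟩, abs_le.1 him⟩

lemma pzA_decay (α : ℝ) (m : ℕ) : ∃ C : ℝ, 0 < C ∧ ∀ s : ℂ, 2 ≤ s.re →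
    ‖LSeries (pzA α) s‖ ≤ C / s.re ^ m := by
  have hsum : LSeriesSummable (pzA α) ((3/2:ℝ):ℂ) :=
    LSeriesSummable_of_abscissaOfAbsConv_lt_re (pzA_abscissa_lt α (by rw [ofReal_re]; norm_num))
  set S := ∑' n, ‖LSeries.term (pzA α) ((3/2:ℝ):ℂ) n‖ with hS
  have hS0 : 0 ≤ S := tsum_nonneg fun _ => norm_nonneg _
  have hl2 : 0 < Real.log 2 := Real.log_pos (by norm_num)
  set K : ℝ := m.factorial * (4 / Real.log 2) ^ m with hK
  have hK0 : 0 < K := by positivity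
  refine ⟨K * S + 1, by positivity, fun s hs => ?_⟩
  have hs0 : 0 < s.re := by linarith
  have key : ∀ n, ‖LSeries.term (pzA α) s n‖ ≤ K / s.re ^ m * ‖LSeries.term (pzA α) ((3/2:ℝ):ℂ) n‖ := by
    intro n
    rw [LSeries.norm_term_eq, LSeries.norm_term_eq]
    rcases eq_or_ne n 0 with rfl | hn
    · simp
    · rw [if_neg hn, if_neg hn]
      by_cases hp : n.Prime
      · have hn2 : (2:ℝ) ≤ n := by exact_mod_cast hp.two_le
        have hn0 : (0:ℝ) < n := by linarith
        have hlog : Real.log 2 ≤ Real.log n := Real.log_le_log (by norm_num) hn2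
        rw [ofReal_re]
        have a1 : (n:ℝ) ^ (3/2:ℝ) * (n:ℝ) ^ (s.re / 4) ≤ (n:ℝ) ^ s.re := by
          rw [← Real.rpow_add hn0]
          exact Real.rpow_le_rpow_of_exponent_le (by linarith) (by linarith)
        have a2 : s.re ^ m / K ≤ (n:ℝ) ^ (s.re / 4) := by
          have b1 := Real.pow_div_factorial_le_exp (Real.log 2 * (s.re / 4)) (by positivity) m
          have b2 : s.re ^ m / K = (Real.log 2 * (s.re / 4)) ^ m / m.factorial := by
            rw [hK, div_pow, mul_pow, div_pow]; field_simp
          rw [b2]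
          refine b1.trans ?_
          rw [Real.rpow_def_of_pos hn0]
          gcongr
        have a3 : (n:ℝ) ^ (3/2:ℝ) * (s.re ^ m / K) ≤ (n:ℝ) ^ s.re :=
          (mul_le_mul_of_nonneg_left a2 (by positivity)).trans a1
        calc ‖pzA α n‖ / (n:ℝ) ^ s.re ≤ ‖pzA α n‖ / ((n:ℝ) ^ (3/2:ℝ) * (s.re ^ m / K)) := by gcongr
          _ = _ := by field_simp
      · simp [pzA, hp]
  have hb : ‖LSeries (pzA α) s‖ ≤ K / s.re ^ m * S :=
    tsum_of_norm_bounded (hsum.norm.hasSum.mul_left _) key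
  refine hb.trans ?_
  rw [div_mul_eq_mul_div]
  gcongr
  linarith

lemma pzW_bound (n : ℕ) : ∃ C : ℝ, 0 < C ∧ ∀ s : ℂ, 1 < s.re →
    ‖pzW n s‖ ≤ C * (1 + |s.im|) / s.re ^ (n + 1) := by
  obtain ⟨C1, hC1, h1⟩ := pzW_strip_large n
  obtain ⟨C2, hC2, h2⟩ := pzW_strip_small n
  obtain ⟨C3, hC3, h3⟩ := pzA_decay (n + 1) (n + 1)
  set D : ℝ := (C1 + C2) * 2 ^ (n + 1) + (C3 + n.factorial * 2 ^ (n + 1)) with hD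
  have hD0 : 0 < D := by positivity
  refine ⟨D, hD0, fun s hs => ?_⟩
  have hs0 : 0 < s.re := by linarith
  have him := abs_nonneg s.im
  rw [le_div_iff₀ (by positivity)]
  rcases le_total s.re 2 with hs2 | hs2
  · have a : ‖pzW n s‖ ≤ (C1 + C2) * (1 + |s.im|) := by
      rcases le_total |s.im| 1 with h | h
      · refine (h2 s hs hs2 h).trans ?_
        nlinarith
      · refine (h1 s hs hs2 h).trans ?_
        nlinarith
    calc ‖pzW n s‖ * s.re ^ (n + 1) ≤ ((C1 + C2) * (1 + |s.im|)) * 2 ^ (n + 1) := by gcongr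
      _ = (C1 + C2) * 2 ^ (n + 1) * (1 + |s.im|) := by ring
      _ ≤ _ := by
        gcongr
        have : 0 ≤ C3 + n.factorial * 2 ^ (n + 1) := by positivity
        linarith
  · have a : ‖(n.factorial : ℂ) / (s - 1) ^ (n + 1)‖ ≤ n.factorial * 2 ^ (n + 1) / s.re ^ (n + 1) := by
      rw [norm_div, norm_pow, Complex.norm_natCast]
      have b : s.re / 2 ≤ ‖s - 1‖ := by
        have := re_le_norm (s - 1)
        simp only [sub_re, one_re] at this
        linarith
      calc (n.factorial : ℝ) / ‖s - 1‖ ^ (n + 1) ≤ n.factorial / (s.re / 2) ^ (n + 1) := by gcongr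
        _ = _ := by rw [div_pow]; field_simp
    have c : ‖pzW n s‖ ≤ (C3 + n.factorial * 2 ^ (n + 1)) / s.re ^ (n + 1) := by
      refine (norm_sub_le _ _).trans ?_
      rw [add_div]
      exact add_le_add (h3 s hs2) a
    rw [le_div_iff₀ (by positivity)] at c
    have d : 0 ≤ (C1 + C2) * 2 ^ (n + 1) := by positivity
    nlinarith

open MeasureTheory in
lemma pz_int_exp {β r : ℝ} (hβ : 0 < β) (hr : 0 < r) :
    IntegrableOn (fun t : ℝ => t ^ (β - 1) * Real.exp (-(r * t))) (Set.Ioi 0) := by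
  have := integrableOn_rpow_mul_exp_neg_mul_rpow (s := β - 1) (p := 1) (b := r) (by linarith) (by norm_num) hr
  refine this.congr_fun (fun t _ => ?_) measurableSet_Ioi
  simp

open MeasureTheory in
lemma pz_laplace_diff {α : ℝ} (hα : 0 < α) {z : ℂ} (hz : 0 < z.re) :
    DifferentiableAt ℂ (fun w : ℂ => ∫ u in Set.Ioi (0:ℝ), ((u ^ (α - 1) : ℝ) : ℂ) * cexp (-(w * u))) z := by
  set μ : Measure ℝ := volume.restrict (Set.Ioi 0) with hμ
  have hae : ∀ᵐ u ∂μ, u ∈ Set.Ioi (0:ℝ) := ae_restrict_mem measurableSet_Ioi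
  have hmeas : ∀ w : ℂ, AEStronglyMeasurable (fun u : ℝ => ((u ^ (α - 1) : ℝ) : ℂ) * cexp (-(w * u))) μ := by
    intro w
    refine Measurable.aestronglyMeasurable ?_
    fun_prop
  have hn : ∀ w : ℂ, ∀ u : ℝ, 0 < u → ‖((u ^ (α - 1) : ℝ) : ℂ) * cexp (-(w * u))‖ =
      u ^ (α - 1) * Real.exp (-(w.re * u)) := by
    intro w u hu
    rw [norm_mul, norm_real, Complex.norm_exp, Real.norm_of_nonneg (by positivity)]
    simp
  have hS : {w : ℂ | z.re / 2 < w.re} ∈ nhds z :=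
    (isOpen_lt continuous_const continuous_re).mem_nhds (show z.re / 2 < z.re by linarith)
  have := hasDerivAt_integral_of_dominated_loc_of_deriv_le (μ := μ) (𝕜 := ℂ)
    (F := fun (w : ℂ) (u : ℝ) => ((u ^ (α - 1) : ℝ) : ℂ) * cexp (-(w * u)))
    (F' := fun (w : ℂ) (u : ℝ) => ((u ^ (α - 1) : ℝ) : ℂ) * (cexp (-(w * u)) * (-u)))
    (bound := fun u : ℝ => u ^ (α + 1 - 1) * Real.exp (-(z.re / 2 * u)))
    (x₀ := z) hS (Filter.Eventually.of_forall hmeas) ?_ ?_ ?_ ?_ ?_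
  · exact this.2.differentiableAt
  · refine (pz_int_exp hα hz).mono' (hmeas z) ?_
    filter_upwards [hae] with u hu using (hn z u hu).le
  · refine Measurable.aestronglyMeasurable ?_
    fun_prop
  · filter_upwards [hae] with u hu w hw
    have hu : 0 < u := hu
    have hw : z.re / 2 < w.re := hw
    rw [← mul_assoc, norm_mul, hn w u hu, norm_neg, norm_real, Real.norm_of_nonneg hu.le]
    rw [show α + 1 - 1 = (α - 1) + 1 by ring, Real.rpow_add hu, Real.rpow_one]
    have : Real.exp (-(w.re * u)) ≤ Real.exp (-(z.re / 2 * u)) := by gcongr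
    calc _ = u ^ (α - 1) * u * Real.exp (-(w.re * u)) := by ring
      _ ≤ _ := by gcongr
  · exact pz_int_exp (by linarith) (by linarith)
  · filter_upwards [hae] with u hu w hw
    refine HasDerivAt.const_mul _ ?_
    refine (((hasDerivAt_id w).mul_const (u:ℂ)).neg.cexp).congr_deriv ?_
    simp

open MeasureTheory in
lemma pz_laplace {α : ℝ} (hα : 0 < α) {z : ℂ} (hz : 0 < z.re) :
    ∫ u in Set.Ioi (0:ℝ), ((u ^ (α - 1) : ℝ) : ℂ) * cexp (-(z * u)) = (Real.Gamma α : ℂ) / z ^ (α : ℂ) := by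
  have ho : IsOpen {w : ℂ | 0 < w.re} := isOpen_lt continuous_const continuous_re
  have h1 : AnalyticOnNhd ℂ (fun w : ℂ => ∫ u in Set.Ioi (0:ℝ), ((u ^ (α - 1) : ℝ) : ℂ) * cexp (-(w * u)))
      {w : ℂ | 0 < w.re} :=
    DifferentiableOn.analyticOnNhd (fun w hw => (pz_laplace_diff hα hw).differentiableWithinAt) ho
  have h2 : AnalyticOnNhd ℂ (fun w : ℂ => (Real.Gamma α : ℂ) / w ^ (α : ℂ)) {w : ℂ | 0 < w.re} := by
    refine DifferentiableOn.analyticOnNhd (fun w hw => ?_) ho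
    have hw : 0 < w.re := hw
    have hw0 : w ≠ 0 := by rintro rfl; simp at hw
    refine DifferentiableAt.differentiableWithinAt ?_
    refine (differentiableAt_const _).div (differentiableAt_id.cpow_const (Or.inl hw)) ?_
    simp [cpow_eq_zero_iff, hw0]
  have hreal : ∀ r : ℝ, 0 < r → ∫ u in Set.Ioi (0:ℝ), ((u ^ (α - 1) : ℝ) : ℂ) * cexp (-((r:ℂ) * u)) =
      (Real.Gamma α : ℂ) / (r:ℂ) ^ (α : ℂ) := by
    intro r hr
    have e := Real.integral_rpow_mul_exp_neg_mul_Ioi hα hr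
    have e2 : ∫ u in Set.Ioi (0:ℝ), ((u ^ (α - 1) : ℝ) : ℂ) * cexp (-((r:ℂ) * u)) =
        ((∫ u in Set.Ioi (0:ℝ), u ^ (α - 1) * Real.exp (-(r * u)) : ℝ) : ℂ) := by
      rw [← integral_complex_ofReal]
      congr 1
      ext u
      push_cast
      rfl
    rw [e2, e, one_div, Real.inv_rpow hr.le, ← ofReal_cpow hr.le]
    push_cast
    ring
  have hfreq : ∃ᶠ w in nhdsWithin (1:ℂ) {1}ᶜ,
      (∫ u in Set.Ioi (0:ℝ), ((u ^ (α - 1) : ℝ) : ℂ) * cexp (-(w * u))) = (Real.Gamma α : ℂ) / w ^ (α : ℂ) := by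
    have ht : Filter.Tendsto (fun n : ℕ => (((1 + 1 / ((n:ℝ) + 1) : ℝ)) : ℂ)) Filter.atTop (nhdsWithin (1:ℂ) {1}ᶜ) := by
      rw [tendsto_nhdsWithin_iff]
      refine ⟨?_, Filter.Eventually.of_forall fun n => ?_⟩
      · have h0 := (tendsto_one_div_add_atTop_nhds_zero_nat (𝕜 := ℝ)).const_add 1
        rw [add_zero] at h0
        have := (continuous_ofReal.tendsto 1).comp h0
        simpa [Function.comp_def] using this
      · have : (0:ℝ) < 1 / ((n:ℝ) + 1) := by positivity
        intro hh
        have hh : (((1 + 1 / ((n:ℝ) + 1) : ℝ)) : ℂ) = 1 := hh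
        have h3 : (1 + 1 / ((n:ℝ) + 1) : ℝ) = 1 := by exact_mod_cast hh
        linarith
    refine ht.frequently (Filter.Frequently.of_forall fun n => ?_)
    exact hreal _ (by positivity)
  have hpre : IsPreconnected {w : ℂ | 0 < w.re} := (convex_halfSpace_re_gt 0).isPreconnected
  exact h1.eqOn_of_preconnected_of_frequently_eq h2 hpre (by simp) hfreq hz

open MeasureTheory in
lemma pz_int_kernel {a β : ℝ} {N : ℕ} (ha : 0 < a) (hβ : 0 < β) (hN : β < N) :
    IntegrableOn (fun t : ℝ => t ^ (β - 1) / (a + t) ^ N) (Set.Ioi 0) := by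
  have hc : ContinuousOn (fun t : ℝ => t ^ (β - 1) / (a + t) ^ N) (Set.Ioi 0) := by
    intro t ht
    have ht : 0 < t := ht
    have : (a + t) ^ N ≠ 0 := by positivity
    exact ((Real.continuousAt_rpow_const _ _ (Or.inl ht.ne')).div (by fun_prop) this).continuousWithinAt
  rw [← Set.Ioc_union_Ioi_eq_Ioi (zero_le_one' ℝ)]
  refine IntegrableOn.union ?_ ?_
  · have h1 : IntegrableOn (fun t : ℝ => t ^ (β - 1) * (1 / a ^ N)) (Set.Ioc 0 1) :=
      (((intervalIntegral.intervalIntegrable_rpow' (by linarith)).1).mul_const _)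
    refine Integrable.mono' h1 ((hc.mono Set.Ioc_subset_Ioi_self).aestronglyMeasurable measurableSet_Ioc) ?_
    refine (ae_restrict_iff' measurableSet_Ioc).2 (Filter.Eventually.of_forall fun t ht => ?_)
    have ht : 0 < t := ht.1
    rw [Real.norm_of_nonneg (by positivity), mul_one_div]
    gcongr
    linarith
  · have h1 : IntegrableOn (fun t : ℝ => t ^ (β - 1 - N)) (Set.Ioi 1) :=
      integrableOn_Ioi_rpow_of_lt (by linarith) one_pos
    refine Integrable.mono' h1 ((hc.mono (Set.Ioi_subset_Ioi zero_le_one)).aestronglyMeasurable measurableSet_Ioi) ?_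
    refine (ae_restrict_iff' measurableSet_Ioi).2 (Filter.Eventually.of_forall fun t ht => ?_)
    have ht1 : 1 < t := ht
    have ht : 0 < t := by linarith
    rw [Real.norm_of_nonneg (by positivity), Real.rpow_sub ht (β - 1), Real.rpow_natCast]
    gcongr
    linarith

open MeasureTheory in
lemma pz_beta {α β : ℝ} {m : ℕ} (hα : 0 < α) (hβ : 0 < β) (h : α + β = m + 1) {z : ℂ} (hz : 0 < z.re) :
    ∫ t in Set.Ioi (0:ℝ), ((t ^ (β - 1) : ℝ) : ℂ) * (m.factorial / (z + t) ^ (m + 1))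
      = (Real.Gamma β : ℂ) * ((Real.Gamma α : ℂ) / z ^ (α : ℂ)) := by
  set μ : Measure ℝ := volume.restrict (Set.Ioi 0) with hμ
  set K : ℝ → ℝ → ℂ := fun t u => ((t ^ (β - 1) * Real.exp (-(u * t)) : ℝ) : ℂ) *
    (((u ^ m : ℝ) : ℂ) * cexp (-(z * u))) with hK
  have hae : ∀ᵐ u ∂μ, u ∈ Set.Ioi (0:ℝ) := ae_restrict_mem measurableSet_Ioi
  have hmeas : AEStronglyMeasurable (Function.uncurry K) (μ.prod μ) := by
    refine Measurable.aestronglyMeasurable ?_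
    simp only [hK, Function.uncurry_def]
    fun_prop
  have hint1 : ∀ u : ℝ, 0 < u → Integrable (fun t => K t u) μ := fun u hu =>
    ((pz_int_exp hβ hu).ofReal).mul_const _
  have hval1 : ∀ u : ℝ, 0 < u → ∫ t, t ^ (β - 1) * Real.exp (-(u * t)) ∂μ = Real.Gamma β * u ^ (-β) := by
    intro u hu
    rw [hμ, Real.integral_rpow_mul_exp_neg_mul_Ioi hβ hu, one_div, Real.inv_rpow hu.le, Real.rpow_neg hu.le,
      mul_comm]
  have hnorm : ∀ t u : ℝ, 0 < t → 0 < u → ‖K t u‖ =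
      t ^ (β - 1) * Real.exp (-(u * t)) * (u ^ m * Real.exp (-(z.re * u))) := by
    intro t u ht hu
    simp only [hK]
    rw [norm_mul, norm_mul, norm_real, norm_real, Complex.norm_exp, Real.norm_of_nonneg (by positivity),
      Real.norm_of_nonneg (by positivity)]
    simp
  have hpow : ∀ u : ℝ, 0 < u → u ^ (-β) * u ^ m = u ^ (α - 1) := by
    intro u hu
    rw [← Real.rpow_natCast, ← Real.rpow_add hu]
    congr 1
    linarith
  have hprod : Integrable (Function.uncurry K) (μ.prod μ) := by
    rw [integrable_prod_iff' hmeas]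
    refine ⟨?_, ?_⟩
    · filter_upwards [hae] with u hu using hint1 u hu
    · have := ((pz_int_exp hα hz).const_mul (Real.Gamma β))
      refine this.congr ?_
      filter_upwards [hae] with u hu
      have hu : 0 < u := hu
      have : ∫ t, ‖Function.uncurry K (t, u)‖ ∂μ =
          ∫ t, t ^ (β - 1) * Real.exp (-(u * t)) * (u ^ m * Real.exp (-(z.re * u))) ∂μ := by
        refine integral_congr_ae ?_
        filter_upwards [hae] with t ht using hnorm t u ht hu
      rw [this, integral_mul_const, hval1 u hu, ← hpow u hu]
      ring
  have hswap := integral_integral_swap hprod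
  have hL : ∫ t, ∫ u, K t u ∂μ ∂μ = ∫ t in Set.Ioi (0:ℝ), ((t ^ (β - 1) : ℝ) : ℂ) * (m.factorial / (z + t) ^ (m + 1)) := by
    refine integral_congr_ae ?_
    filter_upwards [hae] with t ht
    have ht : 0 < t := ht
    have hzt : 0 < (z + t).re := by simp; linarith
    have hg := pz_laplace (α := (m : ℝ) + 1) (z := z + t) (by positivity) hzt
    have e1 : ∫ u, K t u ∂μ = ∫ u in Set.Ioi (0:ℝ), ((t ^ (β - 1) : ℝ) : ℂ) * (((u ^ ((m : ℝ) + 1 - 1) : ℝ) : ℂ) * cexp (-((z + t) * u))) := by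
      refine integral_congr_ae (Filter.Eventually.of_forall fun u => ?_)
      simp only [hK, add_sub_cancel_right, Real.rpow_natCast]
      push_cast
      rw [show -((z + t) * (u:ℂ)) = -(u * t) + -(z * u) by ring, Complex.exp_add]
      ring
    rw [e1, integral_const_mul, hg, Real.Gamma_nat_eq_factorial]
    congr 1
    rw [show (((m:ℝ) + 1 : ℝ) : ℂ) = ((m + 1 : ℕ) : ℂ) by push_cast; ring, cpow_natCast]
    simp
  have hR : ∫ u, ∫ t, K t u ∂μ ∂μ = (Real.Gamma β : ℂ) * ((Real.Gamma α : ℂ) / z ^ (α : ℂ)) := by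
    have hg := pz_laplace hα hz
    have e1 : ∫ u, ∫ t, K t u ∂μ ∂μ = ∫ u in Set.Ioi (0:ℝ), (Real.Gamma β : ℂ) * (((u ^ (α - 1) : ℝ) : ℂ) * cexp (-(z * u))) := by
      refine integral_congr_ae ?_
      filter_upwards [hae] with u hu
      have hu : 0 < u := hu
      simp only [hK]
      rw [integral_mul_const, integral_complex_ofReal, hval1 u hu, ← hpow u hu]
      push_cast
      ring
    rw [e1, integral_const_mul, hg]
  rw [← hL, hswap, hR]

open MeasureTheory in
lemma pz_frac_LSeries {α β : ℝ} (hβ : 0 < β) {s : ℂ} (hs : 1 < s.re) :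
    ∫ t in Set.Ioi (0:ℝ), ((t ^ (β - 1) : ℝ) : ℂ) * LSeries (pzA (α + β)) (s + t)
      = (Real.Gamma β : ℂ) * LSeries (pzA α) s := by
  set μ : Measure ℝ := volume.restrict (Set.Ioi 0) with hμ
  have hae : ∀ᵐ u ∂μ, u ∈ Set.Ioi (0:ℝ) := ae_restrict_mem measurableSet_Ioi
  set F : ℕ → ℝ → ℂ := fun n t => ((t ^ (β - 1) : ℝ) : ℂ) * LSeries.term (pzA (α + β)) (s + t) n with hF
  have hform : ∀ n : ℕ, n.Prime → ∀ t : ℝ, F n t =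
      ((t ^ (β - 1) * Real.exp (-(Real.log n * t)) : ℝ) : ℂ) *
        (((Real.log n ^ β : ℝ) : ℂ) * LSeries.term (pzA α) s n) := by
    intro n hn t
    have hn0 : (n:ℂ) ≠ 0 := by exact_mod_cast hn.ne_zero
    have hl : 0 < Real.log n := Real.log_pos (by exact_mod_cast hn.one_lt)
    simp only [hF]
    rw [LSeries.term_of_ne_zero hn.ne_zero, LSeries.term_of_ne_zero hn.ne_zero, pzA, pzA, if_pos hn, if_pos hn,
      Real.rpow_add hl, cpow_add _ _ hn0, Real.exp_neg]
    have : ((n:ℂ) ^ (t:ℂ)) = ((Real.exp (Real.log n * t) : ℝ) : ℂ) := by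
      rw [← Real.rpow_def_of_pos (by exact_mod_cast hn.pos), ofReal_cpow (by positivity)]
      simp
    rw [this]
    push_cast
    field_simp
  have hzero : ∀ n : ℕ, ¬ n.Prime → F n = 0 := by
    intro n hn
    ext t
    simp only [hF]
    rcases eq_or_ne n 0 with rfl | h0
    · simp
    · rw [LSeries.term_of_ne_zero h0]; simp [pzA, hn]
  have hzero' : ∀ n : ℕ, ¬ n.Prime → LSeries.term (pzA α) s n = 0 := by
    intro n hn
    rcases eq_or_ne n 0 with rfl | h0
    · simp
    · rw [LSeries.term_of_ne_zero h0]; simp [pzA, hn]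
  have hval : ∀ n : ℕ, n.Prime → ∫ t, t ^ (β - 1) * Real.exp (-(Real.log n * t)) ∂μ =
      Real.Gamma β * (Real.log n ^ β)⁻¹ := by
    intro n hn
    have hl : 0 < Real.log n := Real.log_pos (by exact_mod_cast hn.one_lt)
    rw [hμ, Real.integral_rpow_mul_exp_neg_mul_Ioi hβ hl, one_div, Real.inv_rpow hl.le, mul_comm]
  have hIntF : ∀ n, Integrable (F n) μ := by
    intro n
    by_cases hn : n.Prime
    · have hl : 0 < Real.log n := Real.log_pos (by exact_mod_cast hn.one_lt)
      rw [funext (hform n hn)]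
      exact ((pz_int_exp hβ hl).ofReal).mul_const _
    · rw [hzero n hn]; exact integrable_zero _ _ _
  have hI : ∀ n, ∫ t, F n t ∂μ = (Real.Gamma β : ℂ) * LSeries.term (pzA α) s n := by
    intro n
    by_cases hn : n.Prime
    · have hl : 0 < Real.log n := Real.log_pos (by exact_mod_cast hn.one_lt)
      have hl' : ((Real.log n ^ β : ℝ) : ℂ) ≠ 0 := by exact_mod_cast (Real.rpow_pos_of_pos hl β).ne'
      rw [funext (hform n hn), integral_mul_const, integral_complex_ofReal, hval n hn]
      push_cast
      field_simp
    · rw [hzero n hn, hzero' n hn]; simp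
  have hN : ∀ n, ∫ t, ‖F n t‖ ∂μ = Real.Gamma β * ‖LSeries.term (pzA α) s n‖ := by
    intro n
    by_cases hn : n.Prime
    · have hl : 0 < Real.log n := Real.log_pos (by exact_mod_cast hn.one_lt)
      have hl' : 0 < Real.log n ^ β := Real.rpow_pos_of_pos hl β
      have : ∫ t, ‖F n t‖ ∂μ = ∫ t, t ^ (β - 1) * Real.exp (-(Real.log n * t)) *
          (Real.log n ^ β * ‖LSeries.term (pzA α) s n‖) ∂μ := by
        refine integral_congr_ae ?_
        filter_upwards [hae] with t ht
        have ht : 0 < t := ht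
        rw [hform n hn t, norm_mul, norm_mul, norm_real, norm_real, Real.norm_of_nonneg (by positivity),
          Real.norm_of_nonneg hl'.le]
      rw [this, integral_mul_const, hval n hn]
      field_simp
    · rw [hzero n hn, hzero' n hn]; simp
  have hsum : LSeriesSummable (pzA α) s := LSeriesSummable_of_abscissaOfAbsConv_lt_re (pzA_abscissa_lt α hs)
  have key := integral_tsum_of_summable_integral_norm hIntF (by
    simp_rw [hN]
    exact hsum.norm.mul_left _)
  have e1 : ∫ t in Set.Ioi (0:ℝ), ((t ^ (β - 1) : ℝ) : ℂ) * LSeries (pzA (α + β)) (s + t) = ∫ t, ∑' n, F n t ∂μ := by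
    congr 1
    ext t
    simp only [hF]
    rw [tsum_mul_left, LSeries]
  rw [e1, ← key]
  simp_rw [hI]
  rw [tsum_mul_left, LSeries]

noncomputable def pzH (α : ℝ) (s : ℂ) : ℂ := LSeries (pzA α) s - (Real.Gamma α : ℂ) / (s - 1) ^ (α : ℂ)

lemma pz_shift_cont {f : ℂ → ℂ} {a : ℝ} (hf : ∀ z : ℂ, a < z.re → ContinuousAt f z) {s : ℂ} (hs : a < s.re) {β : ℝ} :
    ContinuousOn (fun t : ℝ => ((t ^ (β - 1) : ℝ) : ℂ) * f (s + t)) (Set.Ioi 0) := by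
  intro t ht
  have ht : 0 < t := ht
  refine ContinuousAt.continuousWithinAt ?_
  refine ContinuousAt.mul ?_ ?_
  · exact continuous_ofReal.continuousAt.comp (Real.continuousAt_rpow_const _ _ (Or.inl ht.ne'))
  · have h1 : ContinuousAt f (s + t) := hf _ (by simp; linarith)
    exact ContinuousAt.comp (f := fun t : ℝ => s + (t:ℂ)) h1 (by fun_prop)

open MeasureTheory in
lemma pzW_integrable {β : ℝ} {m : ℕ} (hβ : 0 < β) (hm : β < m + 1) {s : ℂ} (hs : 1 < s.re) :
    IntegrableOn (fun t : ℝ => ((t ^ (β - 1) : ℝ) : ℂ) * pzW m (s + t)) (Set.Ioi 0) := by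
  obtain ⟨C, hC, hb⟩ := pzW_bound m
  have h1 := (pz_int_kernel (a := s.re) (N := m + 1) (by linarith) hβ (by push_cast; exact hm)).const_mul (C * (1 + |s.im|))
  refine Integrable.mono' h1 ((pz_shift_cont (a := 1) (fun z hz => (pzW_hasDerivAt m hz).continuousAt) hs).aestronglyMeasurable
    measurableSet_Ioi) ?_
  refine (ae_restrict_iff' measurableSet_Ioi).2 (Filter.Eventually.of_forall fun t ht => ?_)
  have ht : 0 < t := ht
  rw [norm_mul, norm_real, Real.norm_of_nonneg (by positivity)]
  have := hb (s + t) (by simp; linarith)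
  simp only [add_im, ofReal_im, add_zero, add_re, ofReal_re] at this
  calc _ ≤ t ^ (β - 1) * (C * (1 + |s.im|) / (s.re + t) ^ (m + 1)) := by gcongr
    _ = _ := by ring

open MeasureTheory in
lemma pz_pole_integrable {β : ℝ} {m : ℕ} (hβ : 0 < β) (hm : β < m + 1) {z : ℂ} (hz : 0 < z.re) :
    IntegrableOn (fun t : ℝ => ((t ^ (β - 1) : ℝ) : ℂ) * (m.factorial / (z + t) ^ (m + 1))) (Set.Ioi 0) := by
  have h1 := (pz_int_kernel (a := z.re) (N := m + 1) hz hβ (by push_cast; exact hm)).const_mul (m.factorial : ℝ)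
  refine Integrable.mono' h1 ((pz_shift_cont (a := 0) (f := fun z => (m.factorial : ℂ) / z ^ (m + 1)) (fun w hw => ?_) hz).aestronglyMeasurable
    measurableSet_Ioi) ?_
  · have : w ≠ 0 := by rintro rfl; simp at hw
    exact continuousAt_const.div (by fun_prop) (pow_ne_zero _ this)
  refine (ae_restrict_iff' measurableSet_Ioi).2 (Filter.Eventually.of_forall fun t ht => ?_)
  have ht : 0 < t := ht
  rw [norm_mul, norm_real, Real.norm_of_nonneg (by positivity), norm_div, norm_pow, Complex.norm_natCast]
  have := re_le_norm (z + t)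
  simp only [add_re, ofReal_re] at this
  calc _ ≤ t ^ (β - 1) * (m.factorial / (z.re + t) ^ (m + 1)) := by gcongr
    _ = _ := by ring

open MeasureTheory in
lemma pzH_eq {α β : ℝ} {m : ℕ} (hα : 0 < α) (hβ : 0 < β) (h : α + β = m + 1) {s : ℂ} (hs : 1 < s.re) :
    (Real.Gamma β : ℂ) * pzH α s = ∫ t in Set.Ioi (0:ℝ), ((t ^ (β - 1) : ℝ) : ℂ) * pzW m (s + t) := by
  have hz : 0 < (s - 1).re := by simpa using hs
  have i1 := pzW_integrable (m := m) hβ (by linarith) hs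
  have i2 := pz_pole_integrable (m := m) hβ (by linarith) hz
  have e := integral_add i1 i2
  rw [pz_beta hα hβ h hz] at e
  have e2 : ∫ t in Set.Ioi (0:ℝ), (((t ^ (β - 1) : ℝ) : ℂ) * pzW m (s + t) +
      ((t ^ (β - 1) : ℝ) : ℂ) * (m.factorial / (s - 1 + t) ^ (m + 1))) =
      ∫ t in Set.Ioi (0:ℝ), ((t ^ (β - 1) : ℝ) : ℂ) * LSeries (pzA (α + β)) (s + t) := by
    congr 1
    ext t
    rw [pzW, h, show s + t - 1 = s - 1 + (t:ℂ) by ring]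
    ring
  rw [e2, pz_frac_LSeries hβ hs] at e
  rw [pzH]
  linear_combination e

open MeasureTheory in
lemma pzH_lip {α : ℝ} (hα : 0 < α) : ∃ C : ℝ, 0 < C ∧ ∀ s s' : ℂ, 1 < s.re → 1 < s'.re →
    ‖pzH α s - pzH α s'‖ ≤ C * ‖s - s'‖ * (1 + |s.im| + |s'.im|) := by
  obtain ⟨m, β, hβ, h⟩ : ∃ (m : ℕ) (β : ℝ), 0 < β ∧ α + β = m + 1 :=
    ⟨⌈α⌉₊, ⌈α⌉₊ + 1 - α, by linarith [Nat.le_ceil α], by ring⟩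
  obtain ⟨C, hC, hb⟩ := pzW_bound (m + 1)
  have hG := Real.Gamma_pos_of_pos hβ
  have hk := pz_int_kernel (a := 1) (β := β) (N := m + 2) one_pos hβ (by push_cast; linarith)
  set I := ∫ t in Set.Ioi (0:ℝ), t ^ (β - 1) / (1 + t) ^ (m + 2) with hI
  have hI0 : 0 ≤ I := setIntegral_nonneg measurableSet_Ioi fun t ht => by
    have ht : 0 < t := ht
    positivity
  refine ⟨C * I / Real.Gamma β + 1, by positivity, fun s s' hs hs' => ?_⟩
  set M := 1 + |s.im| + |s'.im| with hM
  have hM0 : 0 < M := by positivity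
  have key : ∀ t : ℝ, 0 < t → ‖pzW m (s + t) - pzW m (s' + t)‖ ≤ C * M / (1 + t) ^ (m + 2) * ‖s - s'‖ := by
    intro t ht
    set U : Set ℂ := ({z | 1 + t < z.re} ∩ {z | z.im ≤ |s.im| + |s'.im|}) ∩ {z | -(|s.im| + |s'.im|) ≤ z.im} with hU
    have hconv : Convex ℝ U :=
      ((convex_halfSpace_re_gt _).inter (convex_halfSpace_im_le _)).inter (convex_halfSpace_im_ge _)
    have m1 : s + t ∈ U := by
      simp only [hU, Set.mem_inter_iff, Set.mem_ofPred_eq, add_re, ofReal_re, add_im, ofReal_im, add_zero]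
      refine ⟨⟨by linarith, ?_⟩, ?_⟩
      · linarith [le_abs_self s.im, abs_nonneg s'.im]
      · linarith [neg_abs_le s.im, abs_nonneg s'.im]
    have m2 : s' + t ∈ U := by
      simp only [hU, Set.mem_inter_iff, Set.mem_ofPred_eq, add_re, ofReal_re, add_im, ofReal_im, add_zero]
      refine ⟨⟨by linarith, ?_⟩, ?_⟩
      · linarith [le_abs_self s'.im, abs_nonneg s.im]
      · linarith [neg_abs_le s'.im, abs_nonneg s.im]
    have := hconv.norm_image_sub_le_of_norm_hasDerivWithin_le (f := pzW m) (f' := fun z => - pzW (m + 1) z)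
      (C := C * M / (1 + t) ^ (m + 2)) (fun z hz => (pzW_hasDerivAt m (by
        have : 1 + t < z.re := hz.1.1
        linarith)).hasDerivWithinAt) (fun z hz => ?_) m2 m1
    · refine this.trans_eq ?_
      congr 2
      ring
    · have z1 : 1 + t < z.re := hz.1.1
      have z2 : |z.im| ≤ |s.im| + |s'.im| := abs_le.2 ⟨hz.2, hz.1.2⟩
      rw [norm_neg]
      refine (hb z (by linarith)).trans ?_
      gcongr
      rw [hM]; linarith
  have e : (Real.Gamma β : ℂ) * (pzH α s - pzH α s') =
      ∫ t in Set.Ioi (0:ℝ), (((t ^ (β - 1) : ℝ) : ℂ) * pzW m (s + t) - ((t ^ (β - 1) : ℝ) : ℂ) * pzW m (s' + t)) := by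
    rw [integral_sub (pzW_integrable hβ (by linarith) hs) (pzW_integrable hβ (by linarith) hs'),
      ← pzH_eq hα hβ h hs, ← pzH_eq hα hβ h hs']
    ring
  have n1 : Real.Gamma β * ‖pzH α s - pzH α s'‖ ≤ C * M * ‖s - s'‖ * I := by
    have : Real.Gamma β * ‖pzH α s - pzH α s'‖ = ‖(Real.Gamma β : ℂ) * (pzH α s - pzH α s')‖ := by
      rw [norm_mul, norm_real, Real.norm_of_nonneg hG.le]
    rw [this, e, hI, ← integral_const_mul]
    refine norm_integral_le_of_norm_le (hk.const_mul _) ?_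
    refine (ae_restrict_iff' measurableSet_Ioi).2 (Filter.Eventually.of_forall fun t ht => ?_)
    have ht : 0 < t := ht
    rw [← mul_sub, norm_mul, norm_real, Real.norm_of_nonneg (by positivity)]
    calc _ ≤ t ^ (β - 1) * (C * M / (1 + t) ^ (m + 2) * ‖s - s'‖) := by
          gcongr
          exact key t ht
      _ = _ := by ring
  have n2 : ‖pzH α s - pzH α s'‖ ≤ C * I / Real.Gamma β * (‖s - s'‖ * M) := by
    rw [div_mul_eq_mul_div, le_div_iff₀ hG]
    linarith
  have : 0 ≤ ‖s - s'‖ * M := by positivity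
  calc _ ≤ _ := n2
    _ ≤ _ := by linarith

lemma pzH_real (α : ℝ) {x : ℝ} (hx : 1 < x) : ∃ r : ℝ, pzH α (x : ℂ) = r := by
  refine ⟨(∑' n : ℕ, if n.Prime then Real.log n ^ α / (n : ℝ) ^ x else 0) - Real.Gamma α / (x - 1) ^ α, ?_⟩
  rw [pzH, LSeries]
  push_cast
  rw [ofReal_cpow (by linarith)]
  push_cast
  congr 1
  refine tsum_congr fun n => ?_
  rcases eq_or_ne n 0 with rfl | h0
  · simp [Nat.not_prime_zero]
  · rw [LSeries.term_of_ne_zero h0, pzA]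
    split_ifs
    · push_cast
      rw [ofReal_cpow (by positivity) x]
      simp
    · simp

lemma pzH_bound {α : ℝ} (hα : 0 < α) : ∃ B : ℝ, ∃ C : ℝ, 0 < C ∧ ∀ s : ℂ, 1 < s.re →
    ‖pzH α s - B‖ ≤ C * ‖s - 1‖ * ‖s‖ := by
  obtain ⟨C, hC, hl⟩ := pzH_lip hα
  have hre : ∀ x : ℝ, 1 < x → pzH α (x : ℂ) = ((pzH α (x : ℂ)).re : ℝ) := by
    intro x hx
    obtain ⟨r, hr⟩ := pzH_real α hx
    rw [hr, ofReal_re]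
  have hlip : LipschitzOnWith C.toNNReal (fun x : ℝ => (pzH α (x : ℂ)).re) (Set.Ioi 1) := by
    refine LipschitzOnWith.of_dist_le_mul fun x hx y hy => ?_
    rw [Real.coe_toNNReal _ hC.le, Real.dist_eq, Real.dist_eq]
    have h := hl x y (by simpa using hx) (by simpa using hy)
    rw [← ofReal_sub, norm_real, Real.norm_eq_abs] at h
    simp only [ofReal_im, abs_zero, add_zero, mul_one] at h
    refine le_trans ?_ h
    rw [← sub_re]
    exact abs_re_le_norm _
  obtain ⟨g, hg, hgeq⟩ := hlip.extend_real
  refine ⟨g 1, 3 * C, by positivity, fun s hs => ?_⟩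
  have h1 := hl s (s.re : ℂ) hs (by simpa using hs)
  have h2 := hg.dist_le_mul s.re 1
  rw [← hgeq (show s.re ∈ Set.Ioi 1 from hs), Real.coe_toNNReal _ hC.le, Real.dist_eq, Real.dist_eq] at h2
  have h3 : ‖pzH α (s.re : ℂ) - g 1‖ ≤ C * |s.re - 1| := by
    rw [hre s.re hs, ← ofReal_sub, norm_real, Real.norm_eq_abs]
    exact h2
  have a1 : |s.re - 1| ≤ ‖s - 1‖ := by simpa using abs_re_le_norm (s - 1)
  have a2 : ‖s - (s.re : ℂ)‖ ≤ ‖s - 1‖ := by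
    have e : s - (s.re : ℂ) = s.im * I := by
      apply Complex.ext <;> simp
    rw [e, norm_mul, norm_I, mul_one, norm_real, Real.norm_eq_abs]
    simpa using abs_im_le_norm (s - 1)
  have a3 : 1 ≤ ‖s‖ := hs.le.trans (re_le_norm s)
  have a4 := abs_im_le_norm s
  simp only [ofReal_im, abs_zero, add_zero] at h1
  have h4 : ‖pzH α s - pzH α (s.re : ℂ)‖ ≤ C * ‖s - 1‖ * (2 * ‖s‖) := by
    refine h1.trans ?_
    gcongr
    linarith
  calc ‖pzH α s - g 1‖ = ‖(pzH α s - pzH α (s.re : ℂ)) + (pzH α (s.re : ℂ) - g 1)‖ := by congr 1; ring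
    _ ≤ C * ‖s - 1‖ * (2 * ‖s‖) + C * |s.re - 1| := (norm_add_le _ _).trans (add_le_add h4 h3)
    _ ≤ C * ‖s - 1‖ * (2 * ‖s‖) + C * ‖s - 1‖ * ‖s‖ := by
      have : C * |s.re - 1| ≤ C * ‖s - 1‖ := by gcongr
      have : C * ‖s - 1‖ * 1 ≤ C * ‖s - 1‖ * ‖s‖ := by gcongr
      linarith
    _ = _ := by ring


/-- **Behavior of derivatives of the prime zeta-type series near `s = 1`:** for
`G(s) = Σ_p (log p)^γ / p^s` and any `k`, there is a real constant `B_k` with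
`G^{(k)}(s) = (−1)^k Γ(γ+k)/(s−1)^{γ+k} + B_k + O(|s−1||s|)` on `Re s > 1`, where
`(s−1)^{γ+k}` uses the principal branch. -/
theorem prime_zeta_derivatives (γ : ℝ) (hγ : 0 < γ) (k : ℕ) :
    ∃ B : ℝ, ∃ C : ℝ, 0 < C ∧ ∀ s : ℂ, 1 < s.re →
      ‖iteratedDeriv k
          (fun z : ℂ => ∑' p : Nat.Primes, ((Real.log (p : ℕ) ^ γ : ℝ) : ℂ) / ((p : ℕ) : ℂ) ^ z) s
        - ((-1) ^ k * ((Real.Gamma (γ + k) : ℝ) : ℂ) / (s - 1) ^ (((γ + k : ℝ)) : ℂ) + (B : ℂ))‖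
      ≤ C * ‖s - 1‖ * ‖s‖ := by
  have hα : 0 < γ + k := by positivity
  obtain ⟨B, C, hC, hb⟩ := pzH_bound hα
  refine ⟨(-1) ^ k * B, C, hC, fun s hs => ?_⟩
  rw [funext (pz_tsum_eq γ), pzA_iteratedDeriv γ k hs]
  have e : (-1) ^ k * LSeries (pzA (γ + k)) s - ((-1) ^ k * ((Real.Gamma (γ + k) : ℝ) : ℂ) /
      (s - 1) ^ (((γ + k : ℝ)) : ℂ) + (((-1) ^ k * B : ℝ) : ℂ)) = (-1) ^ k * (pzH (γ + k) s - B) := by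
    rw [pzH]
    push_cast
    ring
  rw [e, norm_mul, norm_pow, norm_neg, norm_one, one_pow, one_mul]
  exact hb s hs
end

section
/- Decay of the real part of G on the moderate-t range: Fix γ > 0 and let G(s) = Σ_{p prime} (log p)^γ / p^s for Re s > 1. There exists c > 0 with the following property: for all σ > 1 sufficiently close to 1 and all real t with 1 ≤ |t| ≤ e^{1/(σ−1)}, one has Re(G(σ + it)) ≤ (1 − c)·G(σ). -/
open Complex

lemma pzd_nonvanish {f : ℂ → ℂ} {r M : ℝ} (hr : 0 < r)
    (hf : DifferentiableOn ℂ f (Metric.ball 0 r))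
    (hM : ∀ z ∈ Metric.ball (0:ℂ) r, ‖f z‖ ≤ M) (h0 : ∀ z ∈ Metric.ball (0:ℂ) r, f z ≠ 0)
    (hlt : ‖f 0‖ < M) : ‖logDeriv f 0‖ ≤ 4 / r * Real.log (M / ‖f 0‖) := by
  have hmem0 : (0:ℂ) ∈ Metric.ball (0:ℂ) r := by simpa using hr
  have hf0 : 0 < ‖f 0‖ := norm_pos_iff.2 (h0 0 hmem0)
  have hd : DifferentiableOn ℂ (logDeriv f) (Metric.ball 0 r) := by
    have := (hf.deriv Metric.isOpen_ball).div hf h0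
    exact this
  obtain ⟨h, hh0, hh⟩ := hd.isExactOn_ball.with_val_at 0 0
  have hhd : DifferentiableOn ℂ h (Metric.ball 0 r) :=
    fun z hz => (hh z hz).differentiableAt.differentiableWithinAt
  have key : ∀ z ∈ Metric.ball (0:ℂ) r, f z * exp (-h z) = f 0 := by
    intro z hz
    have := (convex_ball (0:ℂ) r).is_const_of_fderivWithin_eq_zero (𝕜 := ℂ)
      (f := fun z => f z * exp (-h z)) (hf.mul hhd.neg.cexp) ?_ hz hmem0
    · simpa [hh0] using this
    · intro w hw
      have hD : HasDerivAt (fun z => f z * exp (-h z)) 0 w := by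
        have h1 := (hf.differentiableAt (Metric.isOpen_ball.mem_nhds hw)).hasDerivAt
        have h2 := (hh w hw).neg.cexp
        have h3 := h1.mul h2
        have e : deriv f w * cexp ((-h) w) + f w * (cexp ((-h) w) * -logDeriv f w) = 0 := by
          have := h0 w hw
          simp only [logDeriv_apply]
          field_simp
          simp
        rw [e] at h3
        exact h3
      have h3 := hD.hasFDerivAt.hasFDerivWithinAt (s := Metric.ball 0 r)
      rw [h3.fderivWithin (Metric.isOpen_ball.uniqueDiffWithinAt hw)]
      ext; simp
  have hmap : Set.MapsTo h (Metric.ball 0 r) {z | z.re ≤ Real.log (M / ‖f 0‖)} := by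
    intro z hz
    have h1 := congrArg norm (key z hz)
    rw [norm_mul, Complex.norm_exp, neg_re, Real.exp_neg] at h1
    simp only [Set.mem_ofPred_eq]
    have h2 : Real.exp (h z).re = ‖f z‖ / ‖f 0‖ := by
      rw [← h1]; have := norm_pos_iff.2 (h0 z hz); field_simp
    rw [Real.le_log_iff_exp_le (by positivity [hf0.trans hlt]), h2]
    have := hM z hz
    gcongr
  have hpos : 0 < Real.log (M / ‖f 0‖) := Real.log_pos (by rwa [lt_div_iff₀ hf0, one_mul])
  have hb : ∀ z ∈ Metric.sphere (0:ℂ) (r/2), ‖h z‖ ≤ 2 * Real.log (M / ‖f 0‖) := by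
    intro z hz
    have hzn : ‖z‖ = r/2 := by simpa using hz
    have := borelCaratheodory_zero hpos hhd hmap hr (z := z) (by simp [hzn]; linarith) hh0
    refine this.trans_eq ?_
    rw [hzn]; field_simp; ring
  have hfin := norm_deriv_le_of_forall_mem_sphere_norm_le (half_pos hr)
    (DifferentiableOn.diffContOnCl (hhd.mono (by
      rw [closure_ball _ (half_pos hr).ne']
      exact Metric.closedBall_subset_ball (by linarith)))) hb
  rw [(hh 0 hmem0).deriv] at hfin
  refine hfin.trans_eq ?_
  field_simp; ring

lemma pzd_induct {R R' M : ℝ} (hR : 0 < R) (hRR : R < R') (n : ℕ) : ∀ f : ℂ → ℂ,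
    DifferentiableOn ℂ f (Metric.ball 0 R') → (∀ z ∈ Metric.sphere (0:ℂ) R, ‖f z‖ ≤ M) →
    f 0 ≠ 0 → (∀ z ∈ Metric.ball (0:ℂ) R, f z = 0 → z.re ≤ 0) → M * (1/2)^n < ‖f 0‖ →
    -(8 / R * Real.log (2 * M / ‖f 0‖)) ≤ (logDeriv f 0).re := by
  have hmax : ∀ f : ℂ → ℂ, DifferentiableOn ℂ f (Metric.ball 0 R') →
      (∀ z ∈ Metric.sphere (0:ℂ) R, ‖f z‖ ≤ M) → ∀ z ∈ Metric.closedBall (0:ℂ) R, ‖f z‖ ≤ M := by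
    intro f hf hM z hz
    have hc : closure (Metric.ball (0:ℂ) R) = Metric.closedBall 0 R := closure_ball _ hR.ne'
    refine norm_le_of_forall_mem_frontier_norm_le (Metric.isBounded_ball (x := (0:ℂ)) (r := R))
      (DifferentiableOn.diffContOnCl (hf.mono ?_)) ?_ (hc ▸ hz)
    · rw [hc]; exact Metric.closedBall_subset_ball hRR
    · rw [frontier_ball _ hR.ne']; exact hM
  have hmem0 : (0:ℂ) ∈ Metric.closedBall (0:ℂ) R := by simpa using hR.le
  induction n with
  | zero =>
    intro f hf hM h0 hz hlt
    have := hmax f hf hM 0 hmem0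
    simp at hlt; linarith
  | succ n ih =>
    intro f hf hM h0 hz hlt
    have hf0 : 0 < ‖f 0‖ := norm_pos_iff.2 h0
    have hMle := hmax f hf hM 0 hmem0
    have hMpos : 0 < M := hf0.trans_le hMle
    by_cases hex : ∃ ρ ∈ Metric.ball (0:ℂ) (R/2), f ρ = 0
    · obtain ⟨ρ, hρ, hfρ⟩ := hex
      have hρn : ‖ρ‖ < R/2 := by simpa using hρ
      have hρ0 : ρ ≠ 0 := by rintro rfl; exact h0 hfρ
      have hρp : 0 < ‖ρ‖ := norm_pos_iff.2 hρ0
      have hρR' : ρ ∈ Metric.ball (0:ℂ) R' := by simp; linarith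
      set q := dslope f ρ with hq
      have hqd : DifferentiableOn ℂ q (Metric.ball 0 R') :=
        (Complex.differentiableOn_dslope (Metric.isOpen_ball.mem_nhds hρR')).2 hf
      have hfq : ∀ z, f z = (z - ρ) * q z := by
        intro z
        have := sub_smul_dslope f ρ z
        rw [hfρ, sub_zero, smul_eq_mul] at this
        exact this.symm
      have hRc : (R:ℂ) ≠ 0 := by exact_mod_cast hR.ne'
      set b : ℂ → ℂ := fun z => ((R:ℂ)^2 - (starRingEnd ℂ) ρ * z) / R with hb
      have hbd : Differentiable ℂ b := by
        simp only [hb]; fun_prop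
      set g : ℂ → ℂ := fun z => q z * b z with hg
      have hgd : DifferentiableOn ℂ g (Metric.ball 0 R') := hqd.mul hbd.differentiableOn
      have hq0 : q 0 ≠ 0 := by
        intro h; apply h0; rw [hfq, h, mul_zero]
      have hb0 : b 0 = R := by simp [hb]; field_simp
      have hg0 : g 0 = q 0 * R := by simp only [hg, hb0]
      have hf0q : ‖f 0‖ = ‖ρ‖ * ‖q 0‖ := by rw [hfq 0]; simp
      have hg0n : ‖g 0‖ = ‖q 0‖ * R := by rw [hg0]; simp [abs_of_pos hR]
      have h2 : 2 * ‖f 0‖ ≤ ‖g 0‖ := by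
        rw [hf0q, hg0n]
        have := norm_nonneg (q 0)
        nlinarith
      have hgM : ∀ z ∈ Metric.sphere (0:ℂ) R, ‖g z‖ ≤ M := by
        intro z hzR
        have hzn : ‖z‖ = R := by simpa using hzR
        have : ‖b z‖ = ‖z - ρ‖ := by
          have h3 : (R:ℂ)^2 = (starRingEnd ℂ) z * z := by
            rw [mul_comm, Complex.mul_conj, Complex.normSq_eq_norm_sq, hzn]; push_cast; ring
          simp only [hb, h3, ← sub_mul, ← map_sub, norm_div, norm_mul, hzn, RCLike.norm_conj]
          simp [abs_of_pos hR, hR.ne']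
        have h4 := hM z hzR
        rw [hfq, norm_mul] at h4
        simp only [hg, norm_mul, this]; linarith
      have hbne : ∀ z ∈ Metric.ball (0:ℂ) R, b z ≠ 0 := by
        intro z hzR h
        have hzn : ‖z‖ < R := by simpa using hzR
        simp only [hb, div_eq_zero_iff, hRc, or_false, sub_eq_zero] at h
        have := congrArg norm h
        simp [abs_of_pos hR] at this
        nlinarith [norm_nonneg z]
      have hgz : ∀ z ∈ Metric.ball (0:ℂ) R, g z = 0 → z.re ≤ 0 := by
        intro z hzR h
        refine hz z hzR ?_
        have : q z = 0 := (mul_eq_zero.1 h).resolve_right (hbne z hzR)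
        rw [hfq, this, mul_zero]
      have hgne : g 0 ≠ 0 := by rw [hg0]; exact mul_ne_zero hq0 hRc
      have hlt' : M * (1/2)^n < ‖g 0‖ := by
        rw [pow_succ] at hlt; linarith
      have hIH := ih g hgd hgM hgne hgz hlt'
      have hq0d : DifferentiableAt ℂ q 0 :=
        hqd.differentiableAt (Metric.isOpen_ball.mem_nhds (by simp; linarith))
      have hL1 : logDeriv f 0 = -1/ρ + logDeriv q 0 := by
        have : f = fun z => (z - ρ) * q z := funext hfq
        rw [this, logDeriv_mul 0 (by simpa using hρ0) hq0 (by fun_prop) hq0d]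
        congr 1
        simp [logDeriv_apply, div_neg, neg_div]
      have hL2 : logDeriv g 0 = logDeriv q 0 - (starRingEnd ℂ) ρ / R^2 := by
        rw [hg, logDeriv_mul 0 hq0 (by rw [hb0]; exact hRc) hq0d hbd.differentiableAt,
          sub_eq_add_neg]
        congr 1
        rw [logDeriv_apply, hb0]
        have : HasDerivAt b ((0 - (starRingEnd ℂ) ρ * 1) / R) 0 :=
          (((hasDerivAt_const _ _).sub ((hasDerivAt_id _).const_mul _))).div_const _
        rw [this.deriv]; field_simp; simp
      have hre : (logDeriv g 0).re ≤ (logDeriv f 0).re := by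
        rw [hL1, hL2]
        have hρre : ρ.re ≤ 0 := hz ρ (by simp; linarith) hfρ
        have e1 : ((starRingEnd ℂ) ρ / (R:ℂ)^2).re = ρ.re / R^2 := by
          rw [← ofReal_pow, div_ofReal_re, conj_re]
        have e2 : (-1/ρ).re = - ρ.re / ‖ρ‖^2 := by
          rw [neg_div, neg_re, one_div, inv_re, normSq_eq_norm_sq]; ring
        rw [sub_re, add_re, e1, e2]
        have h5 : -ρ.re / R^2 ≤ -ρ.re / ‖ρ‖^2 := by
          apply div_le_div_of_nonneg_left (by linarith) (by positivity)
          apply pow_le_pow_left₀ hρp.le; linarith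
        rw [neg_div] at h5
        linarith
      have hlog : Real.log (2 * M / ‖g 0‖) ≤ Real.log (2 * M / ‖f 0‖) := by
        have : 0 < ‖g 0‖ := by linarith
        apply Real.log_le_log (by positivity)
        apply div_le_div_of_nonneg_left (by positivity) hf0; linarith
      have : 8 / R * Real.log (2 * M / ‖g 0‖) ≤ 8 / R * Real.log (2 * M / ‖f 0‖) := by gcongr
      linarith
    · push Not at hex
      have := pzd_nonvanish (half_pos hR) (M := 2 * M)
        (hf.mono (Metric.ball_subset_ball (by linarith)))
        (fun z hz => (hmax f hf hM z (by simp at hz ⊢; linarith)).trans (by linarith)) hex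
        (by linarith)
      have h2 := abs_le.1 (Complex.abs_re_le_norm (logDeriv f 0))
      have h3 : 4 / (R/2) = 8 / R := by field_simp; norm_num
      rw [h3] at this
      linarith [h2.1]

lemma pzd_blaschke {R R' M : ℝ} (hR : 0 < R) (hRR : R < R') (f : ℂ → ℂ)
    (hf : DifferentiableOn ℂ f (Metric.ball 0 R')) (hM : ∀ z ∈ Metric.sphere (0:ℂ) R, ‖f z‖ ≤ M)
    (h0 : f 0 ≠ 0) (hz : ∀ z ∈ Metric.ball (0:ℂ) R, f z = 0 → z.re ≤ 0) :
    -(8 / R * Real.log (2 * M / ‖f 0‖)) ≤ (logDeriv f 0).re := by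
  have h1 : Filter.Tendsto (fun n : ℕ => M * (1/2:ℝ)^n) Filter.atTop (nhds (M * 0)) :=
    (tendsto_pow_atTop_nhds_zero_of_lt_one (by norm_num) (by norm_num)).const_mul M
  rw [mul_zero] at h1
  obtain ⟨n, hn⟩ := (h1.eventually_lt_const (norm_pos_iff.2 h0)).exists
  exact pzd_induct hR hRR n f hf hM h0 hz hn

lemma pzd_term_bound {x : ℝ} (hx : 1 ≤ x) {s : ℂ} (hs : 0 < s.re) (hs1 : s ≠ 1) :
    ‖(x:ℂ)^(-s) - (((x+1 : ℝ):ℂ)^(-s+1) - (x:ℂ)^(-s+1)) / (-s+1)‖ ≤ ‖s‖ * x^(-s.re-1) := by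
  have hs0 : s ≠ 0 := by rintro rfl; simp at hs
  have hx0 : 0 < x := by linarith
  have h1 : ∀ u ∈ Set.Icc x (x+1), ‖(u:ℂ)^(-s) - (x:ℂ)^(-s)‖ ≤ ‖s‖ * x^(-s.re-1) := by
    intro u hu
    have hd : ∀ y ∈ Set.Icc x (x+1), HasDerivWithinAt (fun y : ℝ => (y:ℂ)^(-s))
        (-s * (y:ℂ)^(-s-1)) (Set.Icc x (x+1)) y := by
      intro y hy
      have hy0 : y ≠ 0 := by linarith [hy.1]
      exact (hasDerivAt_ofReal_cpow_const hy0 (neg_ne_zero.2 hs0)).hasDerivWithinAt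
    have hb : ∀ y ∈ Set.Icc x (x+1), ‖-s * (y:ℂ)^(-s-1)‖ ≤ ‖s‖ * x^(-s.re-1) := by
      intro y hy
      have hy0 : 0 < y := by linarith [hy.1]
      rw [norm_mul, norm_neg, norm_cpow_eq_rpow_re_of_pos hy0]
      gcongr
      simp only [sub_re, neg_re, one_re]
      exact Real.rpow_le_rpow_of_nonpos hx0 hy.1 (by linarith)
    have := (convex_Icc x (x+1)).norm_image_sub_le_of_norm_hasDerivWithin_le hd hb
      (Set.left_mem_Icc.2 (by linarith)) hu
    refine this.trans ?_
    have h3 : ‖u - x‖ ≤ 1 := by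
      rw [Real.norm_eq_abs, abs_le]; constructor <;> linarith [hu.1, hu.2]
    have h4 : 0 ≤ ‖s‖ * x^(-s.re-1) := by positivity
    nlinarith
  have hd : ∀ y ∈ Set.Icc x (x+1), HasDerivWithinAt
      (fun y : ℝ => (y:ℂ)^(-s+1)/(-s+1) - (y:ℂ) * (x:ℂ)^(-s))
      ((y:ℂ)^(-s) - (x:ℂ)^(-s)) (Set.Icc x (x+1)) y := by
    intro y hy
    have hy0 : y ≠ 0 := by linarith [hy.1]
    have h5 := (hasDerivAt_ofReal_cpow_const' hy0 (r := -s) (by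
        intro h; apply hs1; linear_combination -h))
    have h6 := ((hasDerivAt_id y).ofReal_comp).mul_const ((x:ℂ)^(-s))
    have := (h5.sub h6).hasDerivWithinAt (s := Set.Icc x (x+1))
    simp only [id, ofReal_one, one_mul] at this
    exact this
  have := (convex_Icc x (x+1)).norm_image_sub_le_of_norm_hasDerivWithin_le hd h1
      (Set.left_mem_Icc.2 (by linarith)) (Set.right_mem_Icc.2 (by linarith))
  simp only [add_sub_cancel_left, norm_one, mul_one] at this
  rw [← norm_neg]
  refine le_trans (le_of_eq ?_) this
  congr 1
  push_cast
  ring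

/-- the Euler-Maclaurin terms -/
noncomputable def pzdA (n : ℕ) (s : ℂ) : ℂ :=
  ((n+1 : ℝ):ℂ)^(-s) - (((n+1+1 : ℝ):ℂ)^(-s+1) - ((n+1 : ℝ):ℂ)^(-s+1)) / (-s+1)

lemma pzdA_bound (n : ℕ) {s : ℂ} (hs : 1/4 ≤ s.re) (hs1 : s ≠ 1) :
    ‖pzdA n s‖ ≤ ‖s‖ * (1 / |(n:ℝ)+1|^(5/4:ℝ)) := by
  have hn : (1:ℝ) ≤ n + 1 := by linarith [(Nat.cast_nonneg n : (0:ℝ) ≤ n)]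
  refine (pzd_term_bound hn (by linarith) hs1).trans ?_
  gcongr
  rw [abs_of_pos (by linarith), one_div, ← Real.rpow_neg (by linarith)]
  exact Real.rpow_le_rpow_of_exponent_le hn (by linarith)

lemma pzdA_summable : Summable (fun n : ℕ => 1 / |(n:ℝ)+1|^(5/4:ℝ)) :=
  (Real.summable_one_div_nat_add_rpow 1 (5/4)).2 (by norm_num)

lemma pzdA_diff (n : ℕ) {s : ℂ} (hs1 : s ≠ 1) : DifferentiableAt ℂ (pzdA n) s := by
  have h1 : ((n+1 : ℝ):ℂ) ≠ 0 := by
    have : (0:ℝ) < n + 1 := by positivity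
    exact_mod_cast this.ne'
  have h2 : ((n+1+1 : ℝ):ℂ) ≠ 0 := by
    have : (0:ℝ) < n + 1 + 1 := by positivity
    exact_mod_cast this.ne'
  have h3 : -s + 1 ≠ 0 := by intro h; apply hs1; linear_combination -h
  unfold pzdA
  refine DifferentiableAt.sub ?_ (DifferentiableAt.div (DifferentiableAt.sub ?_ ?_) ?_ h3)
  · exact DifferentiableAt.const_cpow (by fun_prop) (Or.inl h1)
  · exact DifferentiableAt.const_cpow (by fun_prop) (Or.inl h2)
  · exact DifferentiableAt.const_cpow (by fun_prop) (Or.inl h1)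
  · fun_prop

lemma pzdA_tsum {s : ℂ} (hs : 1 < s.re) :
    HasSum (fun n => pzdA n s) (riemannZeta s + 1 / (-s+1)) := by
  have h1 : HasSum (fun n : ℕ => ((n+1 : ℝ):ℂ)^(-s)) (riemannZeta s) := by
    have hz := zeta_eq_tsum_one_div_nat_add_one_cpow hs
    have hsum : Summable (fun n : ℕ => 1 / ((n:ℂ)+1)^s) := by
      have := (summable_nat_add_iff 1).2 (Complex.summable_one_div_nat_cpow.2 hs)
      simpa using this
    rw [hz]
    convert hsum.hasSum using 2 with n
    rw [cpow_neg]; push_cast; simp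
  have h2 : HasSum (fun n : ℕ => ((n+1+1 : ℝ):ℂ)^(-s+1) - ((n+1 : ℝ):ℂ)^(-s+1)) (-1) := by
    have ht : Filter.Tendsto (fun n : ℕ => ((n+1 : ℝ):ℂ)^(-s+1)) Filter.atTop (nhds 0) := by
      rw [tendsto_zero_iff_norm_tendsto_zero]
      have e : ∀ n : ℕ, ‖((n+1 : ℝ):ℂ)^(-s+1)‖ = ((n:ℝ)+1)^(-(s.re-1)) := by
        intro n
        rw [norm_cpow_eq_rpow_re_of_pos (by positivity)]
        congr 1; simp; ring
      simp_rw [e]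
      exact (tendsto_rpow_neg_atTop (by linarith)).comp
        (Filter.tendsto_atTop_add_const_right _ _ tendsto_natCast_atTop_atTop)
    have hs2 : Summable (fun n : ℕ => ((n+1+1 : ℝ):ℂ)^(-s+1) - ((n+1 : ℝ):ℂ)^(-s+1)) := by
      have hne : -s + 1 ≠ 0 := by
        intro h; have := congrArg re h; simp at this; linarith
      have hA : Summable (fun n => pzdA n s) := by
        refine Summable.of_norm_bounded (pzdA_summable.mul_left ‖s‖) (fun n => ?_)
        refine pzdA_bound n (by linarith) ?_
        rintro rfl; simp at hs
      have := ((h1.summable.sub hA).mul_left (-s+1))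
      refine this.congr (fun n => ?_)
      simp only [pzdA]; field_simp; ring
    have := hs2.hasSum.tendsto_sum_nat
    have h3 : ∀ N : ℕ, ∑ n ∈ Finset.range N,
        (((n+1+1 : ℝ):ℂ)^(-s+1) - ((n+1 : ℝ):ℂ)^(-s+1)) = ((N+1 : ℝ):ℂ)^(-s+1) - 1 := by
      intro N
      have := Finset.sum_range_sub (fun n : ℕ => ((n+1 : ℝ):ℂ)^(-s+1)) N
      simpa using this
    simp_rw [h3] at this
    have h4 := tendsto_nhds_unique this (ht.sub_const 1)
    rw [zero_sub] at h4
    rw [← h4]; exact hs2.hasSum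
  have := h1.sub (h2.div_const (-s+1))
  have e : riemannZeta s + 1 / (-s+1) = riemannZeta s - -1 / (-s+1) := by ring
  rw [e]
  exact this

lemma pzd_zeta_bound : ∃ C : ℝ, 0 < C ∧ ∀ s : ℂ, 1/2 ≤ s.re → 1/2 ≤ s.im →
    ‖riemannZeta s‖ ≤ C * ‖s‖ := by
  set S := ∑' n : ℕ, 1 / |(n:ℝ)+1|^(5/4:ℝ) with hS
  have hS0 : 0 ≤ S := tsum_nonneg (fun n => by positivity)
  refine ⟨S + 4, by linarith, fun s hs hi => ?_⟩
  set B := ‖s‖ + 4 with hB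
  set U : Set ℂ := ({z | 1/4 < z.re} ∩ {z | 1/4 < z.im}) ∩ Metric.ball 0 B with hU
  have hUo : IsOpen U := ((isOpen_lt continuous_const continuous_re).inter
    (isOpen_lt continuous_const continuous_im)).inter Metric.isOpen_ball
  have hUc : Convex ℝ U := ((convex_halfSpace_re_gt _).inter (convex_halfSpace_im_gt _)).inter
    (convex_ball _ _)
  have hne : ∀ z ∈ U, z ≠ 1 := by
    rintro z hz rfl
    have := hz.1.2; simp at this; linarith
  have hd1 : DifferentiableOn ℂ (fun z => ∑' n, pzdA n z) U := by
    refine differentiableOn_tsum_of_summable_norm (pzdA_summable.mul_left B)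
      (fun n z hz => (pzdA_diff n (hne z hz)).differentiableWithinAt) hUo ?_
    intro n z hz
    refine (pzdA_bound n hz.1.1.le (hne z hz)).trans ?_
    have : ‖z‖ < B := by simpa using hz.2
    gcongr
  have hd2 : DifferentiableOn ℂ (fun z => riemannZeta z + 1 / (-z+1)) U := by
    intro z hz
    have h3 : -z + 1 ≠ 0 := by intro h; apply hne z hz; linear_combination -h
    exact ((differentiableAt_riemannZeta (hne z hz)).add
      ((differentiableAt_const _).div (by fun_prop) h3)).differentiableWithinAt
  have hw : (2 + I : ℂ) ∈ U := by
    refine ⟨⟨?_, ?_⟩, ?_⟩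
    · simp; norm_num
    · simp; norm_num
    · simp only [Metric.mem_ball, dist_zero_right]
      calc ‖(2 + I:ℂ)‖ ≤ ‖(2:ℂ)‖ + ‖I‖ := norm_add_le _ _
        _ = 3 := by simp; norm_num
        _ < B := by linarith [norm_nonneg s]
  have heq := (hd1.analyticOnNhd hUo).eqOn_of_preconnected_of_eventuallyEq
    (hd2.analyticOnNhd hUo) hUc.isPreconnected hw (by
      have : {z : ℂ | 1 < z.re} ∈ nhds (2 + I) :=
        (isOpen_lt continuous_const continuous_re).mem_nhds (by simp)
      filter_upwards [this] with z hz
      exact (pzdA_tsum hz).tsum_eq)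
  have hsU : s ∈ U := by
    refine ⟨⟨?_, ?_⟩, ?_⟩
    · show 1/4 < s.re; linarith
    · show 1/4 < s.im; linarith
    · simp [hB]
  have h := heq hsU
  simp only at h
  have h1 : riemannZeta s = ∑' n, pzdA n s - 1 / (-s+1) := by rw [h]; ring
  have h2 : ‖∑' n, pzdA n s‖ ≤ ‖s‖ * S := by
    rw [hS, ← tsum_mul_left]
    exact tsum_of_norm_bounded (pzdA_summable.mul_left ‖s‖).hasSum
      (fun n => pzdA_bound n (by linarith) (hne s hsU))
  have h3 : ‖1 / (-s+1)‖ ≤ 2 := by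
    have : 1/2 ≤ ‖-s+1‖ := by
      have := Complex.abs_im_le_norm (-s+1)
      simp only [add_im, neg_im, one_im, add_zero, abs_neg] at this
      linarith [le_abs_self s.im]
    rw [norm_div, norm_one, div_le_iff₀ (by linarith)]; linarith
  have h4 : 1/2 ≤ ‖s‖ := hs.trans ((le_abs_self _).trans (Complex.abs_re_le_norm s))
  rw [h1]
  calc _ ≤ ‖∑' n, pzdA n s‖ + ‖1 / (-s+1)‖ := norm_sub_le _ _
    _ ≤ ‖s‖ * S + 2 := add_le_add h2 h3
    _ ≤ (S+4) * ‖s‖ := by linarith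

lemma pzd_zeta1_ne (x : ℝ) (hx : x ∈ Set.Icc (1:ℝ) 2) : riemannZeta₁ (x:ℂ) ≠ 0 := by
  rcases eq_or_lt_of_le hx.1 with h | h
  · rw [← h]; simp
  · have hne : (x:ℂ) ≠ 1 := by exact_mod_cast h.ne'
    have h1 := riemannZeta_eq_inv_sub_mul hne
    intro h0
    rw [h0, mul_zero] at h1
    exact riemannZeta_ne_zero_of_one_le_re (s := (x:ℂ)) (by simpa using hx.1) h1

lemma pzd_zeta_real_upper : ∃ C : ℝ, 0 < C ∧ ∀ η : ℝ, 0 < η → η ≤ 1 →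
    ‖riemannZeta ((1 + η : ℝ) : ℂ)‖ ≤ C / η := by
  have hc : ContinuousOn (fun x : ℝ => riemannZeta₁ (x:ℂ)) (Set.Icc 1 2) :=
    (differentiable_riemannZeta₁.continuous.comp continuous_ofReal).continuousOn
  obtain ⟨C, hC⟩ := isCompact_Icc.exists_bound_of_continuousOn hc
  refine ⟨max C 1, by positivity, fun η h0 h1 => ?_⟩
  have hne : ((1 + η : ℝ):ℂ) ≠ 1 := by
    have : (1 + η : ℝ) ≠ 1 := by linarith
    exact_mod_cast this
  rw [riemannZeta_eq_inv_sub_mul hne]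
  have := hC (1 + η) ⟨by linarith, by linarith⟩
  have e : ((1 + η : ℝ):ℂ) - 1 = (η:ℂ) := by push_cast; ring
  rw [e, norm_mul, norm_inv, norm_real, Real.norm_eq_abs, abs_of_pos h0, div_eq_inv_mul]
  gcongr
  exact this.trans (le_max_left _ _)

lemma pzd_logDeriv_real : ∃ C : ℝ, 0 ≤ C ∧ ∀ η : ℝ, 0 < η → η ≤ 1 →
    |(-deriv riemannZeta ((1 + η : ℝ) : ℂ) / riemannZeta ((1 + η : ℝ) : ℂ)).re - 1 / η| ≤ C := by
  have hc : ContinuousOn (fun x : ℝ => deriv riemannZeta₁ (x:ℂ) / riemannZeta₁ (x:ℂ))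
      (Set.Icc 1 2) := by
    refine ContinuousOn.div ?_ ?_ pzd_zeta1_ne
    · have : Differentiable ℂ (deriv riemannZeta₁) := fun z =>
        ((differentiable_riemannZeta₁.differentiableOn (s := Set.univ)).deriv
          isOpen_univ).differentiableAt Filter.univ_mem
      exact (this.continuous.comp continuous_ofReal).continuousOn
    · exact (differentiable_riemannZeta₁.continuous.comp continuous_ofReal).continuousOn
  obtain ⟨C, hC⟩ := isCompact_Icc.exists_bound_of_continuousOn hc
  refine ⟨max C 0, by positivity, fun η h0 h1 => ?_⟩
  have hm : 1 + η ∈ Set.Icc (1:ℝ) 2 := ⟨by linarith, by linarith⟩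
  have hne : ((1 + η : ℝ):ℂ) ≠ 1 := by
    have : (1 + η : ℝ) ≠ 1 := by linarith
    exact_mod_cast this
  have hz := pzd_zeta1_ne _ hm
  have hη : (η:ℂ) ≠ 0 := by exact_mod_cast h0.ne'
  have e : ((1 + η : ℝ):ℂ) - 1 = (η:ℂ) := by push_cast; ring
  have key : -deriv riemannZeta ((1 + η : ℝ) : ℂ) / riemannZeta ((1 + η : ℝ) : ℂ) =
      ((1 / η : ℝ) : ℂ) - deriv riemannZeta₁ ((1 + η : ℝ):ℂ) / riemannZeta₁ ((1 + η : ℝ):ℂ) := by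
    rw [deriv_riemannZeta_eq_neg_inv_sub_sq_mul_add hne, riemannZeta_eq_inv_sub_mul hne, e]
    generalize riemannZeta₁ ((1 + η : ℝ):ℂ) = a at *
    push_cast
    field_simp
    ring
  rw [key, sub_re, ofReal_re, sub_sub_cancel_left, abs_neg]
  exact (Complex.abs_re_le_norm _).trans ((hC _ hm).trans (le_max_left _ _))

lemma pzd_zeta_lower {s : ℂ} (hs : 1 < s.re) :
    1 ≤ ‖riemannZeta s‖ * ‖riemannZeta ((s.re : ℝ) : ℂ)‖ := by
  have h1 := LSeries_one_mul_Lseries_moebius hs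
  rw [LSeries_one_eq_riemannZeta hs] at h1
  have h2 : ‖LSeries (fun n : ℕ => (ArithmeticFunction.moebius n : ℂ)) s‖ ≤ ‖riemannZeta ((s.re : ℝ) : ℂ)‖ := by
    have hz := zeta_eq_tsum_one_div_nat_cpow (s := ((s.re : ℝ) : ℂ)) (by simpa using hs)
    have e : ∀ n : ℕ, (1:ℂ) / (n:ℂ)^((s.re:ℝ):ℂ) = ((1 / (n:ℝ)^s.re : ℝ) : ℂ) := by
      intro n; push_cast [ofReal_cpow (Nat.cast_nonneg n)]; rfl
    simp_rw [e] at hz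
    rw [← ofReal_tsum] at hz
    have hsum := Real.summable_one_div_nat_rpow.2 hs
    rw [hz, norm_real]
    refine le_trans ?_ (le_abs_self _)
    refine tsum_of_norm_bounded hsum.hasSum (fun n => ?_)
    rw [LSeries.norm_term_eq]
    split_ifs with h
    · positivity
    · gcongr
      rw [Complex.norm_intCast]
      exact_mod_cast ArithmeticFunction.abs_moebius_le_one
  calc (1:ℝ) = ‖riemannZeta s * LSeries (fun n : ℕ => (ArithmeticFunction.moebius n : ℂ)) s‖ := by rw [h1, norm_one]
    _ = ‖riemannZeta s‖ * ‖LSeries (fun n : ℕ => (ArithmeticFunction.moebius n : ℂ)) s‖ := norm_mul _ _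
    _ ≤ _ := by gcongr

lemma pzd_logDeriv_upper : ∃ C : ℝ, 0 ≤ C ∧ ∀ η t : ℝ, 0 < η → η ≤ 1 → 1 ≤ t →
    (-deriv riemannZeta (((1 + η : ℝ) : ℂ) + t * I) / riemannZeta (((1 + η : ℝ) : ℂ) + t * I)).re
      ≤ 16 * (Real.log t + Real.log (1 / η)) + C := by
  obtain ⟨C₁, hC₁, hb⟩ := pzd_zeta_bound
  obtain ⟨C₂, hC₂, hu⟩ := pzd_zeta_real_upper
  refine ⟨16 * |Real.log (8 * C₁ * C₂)|, by positivity, fun η t h0 h1 ht => ?_⟩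
  set s : ℂ := ((1 + η : ℝ) : ℂ) + t * I with hs
  have hsre : s.re = 1 + η := by simp [hs]
  have hsim : s.im = t := by simp [hs]
  set f : ℂ → ℂ := fun z => riemannZeta (z + s) with hf
  have hf0 : f 0 = riemannZeta s := by simp [hf]
  have habs : ∀ z : ℂ, ‖z‖ < 3/5 → 1/4 < (z+s).im := by
    intro z hz
    have := (abs_le.1 (Complex.abs_im_le_norm z)).1
    rw [add_im, hsim]; linarith
  have hne : f 0 ≠ 0 := by
    rw [hf0]; exact riemannZeta_ne_zero_of_one_le_re (by rw [hsre]; linarith)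
  have hB := pzd_blaschke (R := 1/2) (R' := 3/5) (M := C₁ * (4 * t)) (by norm_num) (by norm_num) f
    (by
      intro z hz
      have hz' : ‖z‖ < 3/5 := by simpa using hz
      have hz1 : z + s ≠ 1 := by
        intro h; have := habs z hz'; rw [h] at this; simp at this; linarith
      exact ((differentiableAt_riemannZeta hz1).comp z (by fun_prop)).differentiableWithinAt)
    (by
      intro z hz
      have hz' : ‖z‖ = 1/2 := by simpa using hz
      have h2 := (abs_le.1 (Complex.abs_im_le_norm z)).1
      have h3 := (abs_le.1 (Complex.abs_re_le_norm z)).1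
      refine (hb (z + s) (by rw [add_re, hsre]; linarith) (by rw [add_im, hsim]; linarith)).trans ?_
      gcongr
      calc ‖z + s‖ ≤ ‖z‖ + (‖((1 + η : ℝ) : ℂ)‖ + ‖(t:ℂ) * I‖) :=
            (norm_add_le _ _).trans (by gcongr; exact norm_add_le _ _)
        _ = 1/2 + ((1 + η) + t) := by
            rw [hz', norm_mul, norm_I, mul_one, norm_real, norm_real, Real.norm_eq_abs,
              Real.norm_eq_abs, abs_of_pos (by linarith), abs_of_pos (by linarith)]
        _ ≤ 4 * t := by linarith)
    hne
    (by
      intro z hz hz0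
      by_contra hcon
      push Not at hcon
      exact riemannZeta_ne_zero_of_one_le_re (s := z + s) (by rw [add_re, hsre]; linarith) hz0)
  have hld : logDeriv f 0 = deriv riemannZeta s / riemannZeta s := by
    rw [logDeriv_apply, hf0, hf, deriv_comp_add_const, zero_add]
  rw [hld, hf0] at hB
  have hzs : 0 < ‖riemannZeta s‖ := by rw [← hf0]; exact norm_pos_iff.2 hne
  have hlow := pzd_zeta_lower (s := s) (by rw [hsre]; linarith)
  rw [hsre] at hlow
  have h5 : 1 ≤ ‖riemannZeta s‖ * (C₂ / η) :=
    hlow.trans (by gcongr; exact hu η h0 h1)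
  have h6 : 2 * (C₁ * (4 * t)) / ‖riemannZeta s‖ ≤ (8 * C₁ * C₂) * (t * (1 / η)) := by
    rw [div_le_iff₀ hzs]
    calc 2 * (C₁ * (4 * t)) = 8 * C₁ * t * 1 := by ring
      _ ≤ 8 * C₁ * t * (‖riemannZeta s‖ * (C₂ / η)) := by gcongr
      _ = _ := by ring
  have ht0 : 0 < t := by linarith
  have h7 : Real.log (2 * (C₁ * (4 * t)) / ‖riemannZeta s‖) ≤
      Real.log (8 * C₁ * C₂) + (Real.log t + Real.log (1 / η)) := by
    rw [← Real.log_mul (by positivity) (by positivity), ← Real.log_mul (by positivity)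
      (by positivity)]
    exact Real.log_le_log (by positivity) h6
  rw [neg_div, neg_re]
  have h8 := le_abs_self (Real.log (8 * C₁ * C₂))
  norm_num at hB
  norm_num at h7
  norm_num
  linarith

/-- the non-prime contribution -/
lemma pzd_nonprime_summable :
    Summable fun n : ℕ ↦ (if n.Prime then 0 else ArithmeticFunction.vonMangoldt n) / n := by
  have := ArithmeticFunction.vonMangoldt.summable_residueClass_non_primes_div (q := 1) 0
  refine this.congr (fun n => ?_)
  have : (n : ZMod 1) = 0 := Subsingleton.elim _ _
  simp [ArithmeticFunction.vonMangoldt.residueClass, this]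

lemma pzd_prime_split : ∃ E : ℝ, 0 ≤ E ∧ ∀ u : ℕ → ℝ, (∀ n : ℕ, n ≠ 0 → |u n| ≤ 1 / n) →
    Summable (fun n => ArithmeticFunction.vonMangoldt n * u n) →
    Summable (fun p : Nat.Primes => Real.log (p:ℕ) * u p) ∧
    |∑' n, ArithmeticFunction.vonMangoldt n * u n - ∑' p : Nat.Primes, Real.log (p:ℕ) * u p|
      ≤ E := by
  refine ⟨∑' n : ℕ, (if n.Prime then 0 else ArithmeticFunction.vonMangoldt n) / n,
    tsum_nonneg (fun n => ?_), fun u hu hs => ?_⟩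
  · split_ifs
    · simp
    · exact div_nonneg ArithmeticFunction.vonMangoldt_nonneg (Nat.cast_nonneg n)
  set F : ℕ → ℝ := fun n => ArithmeticFunction.vonMangoldt n * u n with hF
  have h1 : ∀ p : Nat.Primes, Real.log (p:ℕ) * u p = F p := by
    intro p; simp only [hF, ArithmeticFunction.vonMangoldt_apply_prime p.2]
  simp_rw [h1]
  have hsub : Summable (fun p : Nat.Primes => F p) := hs.subtype {p : ℕ | p.Prime}
  refine ⟨hsub, ?_⟩
  have h2 : ∑' p : Nat.Primes, F p + ∑' p : ({p : ℕ | p.Prime}ᶜ : Set ℕ), F p = ∑' n, F n :=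
    Summable.tsum_add_tsum_compl (s := {p : ℕ | p.Prime}) (hs.subtype _) (hs.subtype _)
  rw [← h2, add_sub_cancel_left, tsum_subtype ({p : ℕ | p.Prime}ᶜ : Set ℕ) F]
  rw [← Real.norm_eq_abs]
  refine tsum_of_norm_bounded pzd_nonprime_summable.hasSum (fun n => ?_)
  by_cases hp : n.Prime
  · simp [hp]
  · rw [Set.indicator_of_mem (by simpa using hp), if_neg hp]
    rcases eq_or_ne n 0 with rfl | hn
    · simp [hF]
    · simp only [hF, norm_mul, Real.norm_eq_abs]
      rw [abs_of_nonneg ArithmeticFunction.vonMangoldt_nonneg, div_eq_mul_one_div]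
      exact mul_le_mul_of_nonneg_left (hu n hn) ArithmeticFunction.vonMangoldt_nonneg

lemma pzd_vonMangoldt (η t : ℝ) (h0 : 0 < η) :
    HasSum (fun n : ℕ => ArithmeticFunction.vonMangoldt n *
      (Real.exp (-(1 + η) * Real.log n) * Real.cos (t * Real.log n)))
      (-deriv riemannZeta (((1 + η : ℝ) : ℂ) + t * I) /
        riemannZeta (((1 + η : ℝ) : ℂ) + t * I)).re := by
  set s : ℂ := ((1 + η : ℝ) : ℂ) + t * I with hs
  have hsre : 1 < s.re := by simp [hs, h0]
  have h1 := ArithmeticFunction.LSeriesSummable_vonMangoldt hsre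
  rw [← ArithmeticFunction.LSeries_vonMangoldt_eq_deriv_riemannZeta_div hsre]
  have h2 := Complex.hasSum_re h1.hasSum
  rw [LSeries]
  convert h2 using 1
  ext n
  rcases eq_or_ne n 0 with rfl | hn
  · simp
  · have hn0 : (n:ℂ) ≠ 0 := by exact_mod_cast hn
    rw [LSeries.term_of_ne_zero hn, div_eq_mul_inv, re_ofReal_mul, ← cpow_neg,
      cpow_def_of_ne_zero hn0, ← natCast_log, exp_re]
    congr 2
    · congr 1; rw [re_ofReal_mul, neg_re]
      have : s.re = 1 + η := by simp [hs]
      rw [this]; ring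
    · rw [← Real.cos_neg]; congr 1; rw [im_ofReal_mul, neg_im]
      have : s.im = t := by simp [hs]
      rw [this]; ring

lemma pzd_main : ∃ C : ℝ, 0 ≤ C ∧ ∀ η : ℝ, 0 < η → η ≤ 1 →
    (∀ t : ℝ, Summable (fun p : Nat.Primes => Real.log (p:ℕ) *
      (Real.exp (-(1 + η) * Real.log (p:ℕ)) * Real.cos (t * Real.log (p:ℕ))))) ∧
    (∑' p : Nat.Primes, Real.log (p:ℕ) * Real.exp (-(1 + η) * Real.log (p:ℕ)) ≤ 1 / η + C) ∧
    (1 / η - C ≤ ∑' p : Nat.Primes, Real.log (p:ℕ) * Real.exp (-(1 + η) * Real.log (p:ℕ))) ∧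
    (∀ t : ℝ, 1 ≤ t → ∑' p : Nat.Primes, Real.log (p:ℕ) *
      (Real.exp (-(1 + η) * Real.log (p:ℕ)) * Real.cos (t * Real.log (p:ℕ))) ≤
        16 * (Real.log t + Real.log (1 / η)) + C) := by
  obtain ⟨E, hE, hsp⟩ := pzd_prime_split
  obtain ⟨C₁, hC₁, h₁⟩ := pzd_logDeriv_real
  obtain ⟨C₂, hC₂, h₂⟩ := pzd_logDeriv_upper
  refine ⟨E + C₁ + C₂, by positivity, fun η h0 h1 => ?_⟩
  have hu : ∀ t : ℝ, ∀ n : ℕ, n ≠ 0 →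
      |Real.exp (-(1 + η) * Real.log n) * Real.cos (t * Real.log n)| ≤ 1 / n := by
    intro t n hn
    have hn1 : (1:ℝ) ≤ n := by exact_mod_cast Nat.one_le_iff_ne_zero.2 hn
    have hl := Real.log_nonneg hn1
    rw [abs_mul, abs_of_pos (Real.exp_pos _)]
    calc _ ≤ Real.exp (-Real.log n) * 1 := by
          gcongr
          · nlinarith
          · exact Real.abs_cos_le_one _
      _ = 1 / n := by rw [mul_one, Real.exp_neg, Real.exp_log (by linarith), one_div]
  have hall := fun t => hsp _ (hu t) (pzd_vonMangoldt η t h0).summable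
  have h3 := (hall 0).2
  rw [(pzd_vonMangoldt η 0 h0).tsum_eq] at h3
  simp only [ofReal_zero, zero_mul, add_zero, Real.cos_zero, mul_one] at h3
  have h4 := abs_le.1 h3
  have h5 := abs_le.1 (h₁ η h0 h1)
  refine ⟨fun t => (hall t).1, by linarith [h4.1, h5.2], by linarith [h4.2, h5.1], ?_⟩
  intro t ht
  have h6 := (hall t).2
  rw [(pzd_vonMangoldt η t h0).tsum_eq] at h6
  have h7 := (abs_le.1 h6).1
  have h8 := h₂ η t h0 h1 ht
  linarith

/-- `p^{-(1+δ)}` -/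
noncomputable def pzdE (δ : ℝ) (p : Nat.Primes) : ℝ := Real.exp (-(1 + δ) * Real.log (p:ℕ))

lemma pzd_log_pos (p : Nat.Primes) : 0 < Real.log (p:ℕ) :=
  Real.log_pos (by exact_mod_cast p.2.one_lt)

lemma pzd_log_two_le (p : Nat.Primes) : Real.log 2 ≤ Real.log (p:ℕ) :=
  Real.log_le_log (by norm_num) (by exact_mod_cast p.2.two_le)

lemma pzdE_pos (δ : ℝ) (p : Nat.Primes) : 0 < pzdE δ p := Real.exp_pos _

lemma pzdE_add (a b : ℝ) (p : Nat.Primes) :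
    pzdE (a + b) p = pzdE a p * Real.exp (-b * Real.log (p:ℕ)) := by
  simp only [pzdE, ← Real.exp_add]; congr 1; ring

lemma pzdE_anti {a b : ℝ} (h : a ≤ b) (p : Nat.Primes) : pzdE b p ≤ pzdE a p := by
  simp only [pzdE]
  have := pzd_log_pos p
  apply Real.exp_le_exp.2
  nlinarith

lemma pzd_rpow_le_exp {β y : ℝ} (hβ : 0 < β) (hy : 0 ≤ y) : y ^ β ≤ β ^ β * Real.exp y := by
  have h1 : y / β ≤ Real.exp (y / β) := by linarith [Real.add_one_le_exp (y / β)]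
  have h2 := Real.rpow_le_rpow (by positivity) h1 hβ.le
  rw [← Real.exp_mul, div_mul_cancel₀ _ hβ.ne', Real.div_rpow hy hβ.le,
    div_le_iff₀ (by positivity)] at h2
  linarith

lemma pzd_H1 {C : ℝ} (hC : 0 ≤ C)
    (hs : ∀ η : ℝ, 0 < η → η ≤ 1 → Summable (fun p : Nat.Primes => Real.log (p:ℕ) * pzdE η p))
    (hb : ∀ η : ℝ, 0 < η → η ≤ 1 → ∑' p : Nat.Primes, Real.log (p:ℕ) * pzdE η p ≤ 1 / η + C)
    {β : ℝ} (hβ : 0 < β) : ∃ K : ℝ, 0 < K ∧ ∀ δ : ℝ, 0 < δ → δ ≤ 1 →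
      Summable (fun p : Nat.Primes => Real.log (p:ℕ) ^ (β + 1) * pzdE δ p) ∧
      ∑' p : Nat.Primes, Real.log (p:ℕ) ^ (β + 1) * pzdE δ p ≤ K * δ ^ (-β) * (1 / δ) := by
  refine ⟨β ^ β * (1/2:ℝ) ^ (-β) * (2 + C), by positivity, fun δ h0 h1 => ?_⟩
  have hpt : ∀ p : Nat.Primes, Real.log (p:ℕ) ^ (β + 1) * pzdE δ p ≤
      (β ^ β * (δ / 2) ^ (-β)) * (Real.log (p:ℕ) * pzdE (δ / 2) p) := by
    intro p
    have hx := pzd_log_pos p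
    have h2 := pzd_rpow_le_exp (y := δ / 2 * Real.log (p:ℕ)) hβ (by positivity)
    rw [Real.mul_rpow (by positivity) hx.le] at h2
    have h3 : Real.log (p:ℕ) ^ β ≤ β ^ β * (δ / 2) ^ (-β) * Real.exp (δ / 2 * Real.log (p:ℕ)) := by
      rw [Real.rpow_neg (by positivity)]
      have : 0 < (δ / 2) ^ β := by positivity
      calc Real.log (p:ℕ) ^ β = ((δ / 2) ^ β * Real.log (p:ℕ) ^ β) * ((δ / 2) ^ β)⁻¹ := by
            field_simp
        _ ≤ (β ^ β * Real.exp (δ / 2 * Real.log (p:ℕ))) * ((δ / 2) ^ β)⁻¹ := by gcongr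
        _ = _ := by ring
    have h4 : pzdE (δ / 2) p = Real.exp (δ / 2 * Real.log (p:ℕ)) * pzdE δ p := by
      simp only [pzdE, ← Real.exp_add]; congr 1; ring
    rw [h4, Real.rpow_add_one hx.ne']
    have h5 := pzdE_pos δ p
    calc Real.log (p:ℕ) ^ β * Real.log (p:ℕ) * pzdE δ p
        ≤ (β ^ β * (δ / 2) ^ (-β) * Real.exp (δ / 2 * Real.log (p:ℕ))) * Real.log (p:ℕ) *
          pzdE δ p := by gcongr
      _ = _ := by ring
  have hs2 := (hs (δ/2) (by linarith) (by linarith)).mul_left (β ^ β * (δ / 2) ^ (-β))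
  have hsum : Summable (fun p : Nat.Primes => Real.log (p:ℕ) ^ (β + 1) * pzdE δ p) := by
    refine Summable.of_nonneg_of_le (fun p => ?_) hpt hs2
    have := pzd_log_pos p
    have := pzdE_pos δ p
    positivity
  refine ⟨hsum, (hsum.tsum_le_tsum hpt hs2).trans ?_⟩
  rw [tsum_mul_left]
  have h6 := hb (δ/2) (by linarith) (by linarith)
  have h7 : 1 / (δ / 2) + C ≤ (2 + C) * (1 / δ) := by
    have : 1 ≤ 1 / δ := by rw [le_div_iff₀ h0]; linarith
    have e : 1 / (δ / 2) = 2 * (1 / δ) := by field_simp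
    rw [e]; nlinarith
  have h8 : (δ / 2) ^ (-β) = δ ^ (-β) * (1/2:ℝ) ^ (-β) := by
    rw [← Real.mul_rpow h0.le (by norm_num)]; congr 1; ring
  calc _ ≤ (β ^ β * (δ / 2) ^ (-β)) * ((2 + C) * (1 / δ)) := by
        gcongr; exact h6.trans h7
    _ = _ := by rw [h8]; ring

lemma pzd_H {C : ℝ} (hC : 0 ≤ C)
    (hs : ∀ η : ℝ, 0 < η → η ≤ 1 → Summable (fun p : Nat.Primes => Real.log (p:ℕ) * pzdE η p))
    (hb : ∀ η : ℝ, 0 < η → η ≤ 1 → ∑' p : Nat.Primes, Real.log (p:ℕ) * pzdE η p ≤ 1 / η + C)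
    {γ : ℝ} (hγ : 0 < γ) : ∃ K : ℝ, 0 < K ∧ ∀ δ : ℝ, 0 < δ → δ ≤ 1 →
      Summable (fun p : Nat.Primes => Real.log (p:ℕ) ^ γ * pzdE δ p) ∧
      ∑' p : Nat.Primes, Real.log (p:ℕ) ^ γ * pzdE δ p ≤ K * δ ^ (-γ) := by
  obtain ⟨K, hK, hH⟩ := pzd_H1 hC hs hb hγ
  have hl2 : 0 < Real.log 2 := Real.log_pos (by norm_num)
  have hnn : ∀ δ : ℝ, ∀ p : Nat.Primes, 0 ≤ Real.log (p:ℕ) ^ γ * pzdE δ p := by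
    intro δ p
    have := pzd_log_pos p
    have := pzdE_pos δ p
    positivity
  have hsum : ∀ δ : ℝ, 0 < δ → δ ≤ 1 →
      Summable (fun p : Nat.Primes => Real.log (p:ℕ) ^ γ * pzdE δ p) := by
    intro δ h0 h1
    refine Summable.of_nonneg_of_le (hnn δ) (fun p => ?_) ((hH δ h0 h1).1.mul_left (1 / Real.log 2))
    have hx := pzd_log_pos p
    have h5 := pzdE_pos δ p
    rw [Real.rpow_add_one hx.ne', one_div, ← div_eq_inv_mul, le_div_iff₀ hl2]
    have : 0 ≤ Real.log (p:ℕ) ^ γ * pzdE δ p := hnn δ p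
    nlinarith [pzd_log_two_le p]
  set H : ℝ → ℝ := fun δ => ∑' p : Nat.Primes, Real.log (p:ℕ) ^ γ * pzdE δ p with hHdef
  have hq : (2:ℝ) ^ (-γ) < 1 := Real.rpow_lt_one_of_one_lt_of_neg (by norm_num) (by linarith)
  set K' := max (H (1/2)) (K / (1 - (2:ℝ) ^ (-γ))) with hK'
  have hK'pos : 0 < K' := lt_max_of_lt_right (div_pos hK (by linarith))
  have hstep : ∀ δ : ℝ, 0 < δ → 2 * δ ≤ 1 → H δ ≤ H (2 * δ) + K * δ ^ (-γ) := by
    intro δ h0 h1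
    have hh := hH δ h0 (by linarith)
    have hpt : ∀ p : Nat.Primes, Real.log (p:ℕ) ^ γ * pzdE δ p ≤
        Real.log (p:ℕ) ^ γ * pzdE (2 * δ) p + δ * (Real.log (p:ℕ) ^ (γ + 1) * pzdE δ p) := by
      intro p
      have hx := pzd_log_pos p
      have h3 : pzdE (2 * δ) p = pzdE δ p * Real.exp (-δ * Real.log (p:ℕ)) := by
        rw [← pzdE_add]; congr 1; ring
      have h4 := Real.add_one_le_exp (-δ * Real.log (p:ℕ))
      rw [h3, Real.rpow_add_one hx.ne']
      have h5 := hnn δ p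
      nlinarith
    have hs1 := hsum (2 * δ) (by linarith) h1
    have := (hsum δ h0 (by linarith)).tsum_le_tsum hpt (hs1.add (hh.1.mul_left δ))
    rw [hs1.tsum_add (hh.1.mul_left δ), tsum_mul_left] at this
    have h6 : δ * ∑' p : Nat.Primes, Real.log (p:ℕ) ^ (γ + 1) * pzdE δ p ≤ K * δ ^ (-γ) := by
      calc _ ≤ δ * (K * δ ^ (-γ) * (1 / δ)) := by gcongr; exact hh.2
        _ = _ := by field_simp
    simp only [hHdef]
    linarith
  have hind : ∀ n : ℕ, ∀ δ : ℝ, (1/2:ℝ)^n < δ → δ ≤ 1 → H δ ≤ K' * δ ^ (-γ) := by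
    intro n
    induction n with
    | zero => intro δ h1 h2; simp at h1; linarith
    | succ n ih =>
      intro δ h1 h2
      have h0 : 0 < δ := lt_trans (by positivity) h1
      by_cases h3 : 1/2 < δ
      · have h4 : H δ ≤ H (1/2) := by
          refine (hsum δ h0 h2).tsum_le_tsum (fun p => ?_) (hsum (1/2) (by norm_num) (by norm_num))
          have := pzdE_anti h3.le p
          have := pzd_log_pos p
          gcongr
        have h5 : 1 ≤ δ ^ (-γ) := Real.one_le_rpow_of_pos_of_le_one_of_nonpos h0 h2 (by linarith)
        have h6 : H (1/2) ≤ K' := le_max_left _ _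
        nlinarith
      · have h4 : 2 * δ ≤ 1 := by linarith
        have h5 := ih (2 * δ) (by rw [pow_succ] at h1; linarith) h4
        have h6 := hstep δ h0 h4
        rw [Real.mul_rpow (by norm_num) h0.le] at h5
        have h7 : K ≤ K' * (1 - (2:ℝ) ^ (-γ)) := by
          rw [← div_le_iff₀ (by linarith)]; exact le_max_right _ _
        have h8 : 0 < δ ^ (-γ) := by positivity
        nlinarith
  refine ⟨K', hK'pos, fun δ h0 h1 => ⟨hsum δ h0 h1, ?_⟩⟩
  obtain ⟨n, hn⟩ := exists_pow_lt_of_lt_one h0 (by norm_num : (1/2:ℝ) < 1)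
  exact hind n δ hn h1

lemma pzd_pointwise {γ δ : ℝ} (h0 : 0 < δ) {η K : ℝ} (hη : 0 < η)
    (hK : 1 ≤ K) (p : Nat.Primes) :
    Real.log (p:ℕ) * pzdE η p ≤
      ((1 + K ^ (1 - γ)) * Real.exp K * δ ^ (γ - 1)) * (Real.log (p:ℕ) ^ γ * pzdE δ p)
      + Real.exp 1 * (Real.log (p:ℕ) * pzdE δ p)
      + Real.exp (-(K * (η / δ) / 2)) * (Real.log (p:ℕ) * pzdE (η / 2) p) := by
  set x := Real.log (p:ℕ) with hx
  have hxp : 0 < x := pzd_log_pos p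
  have e1 := pzdE_pos η p
  have e2 := pzdE_pos δ p
  have e3 := pzdE_pos (η / 2) p
  have n1 : 0 ≤ ((1 + K ^ (1 - γ)) * Real.exp K * δ ^ (γ - 1)) * (x ^ γ * pzdE δ p) := by
    positivity
  have n2 : 0 ≤ Real.exp 1 * (x * pzdE δ p) := by positivity
  have n3 : 0 ≤ Real.exp (-(K * (η / δ) / 2)) * (x * pzdE (η / 2) p) := by positivity
  have hE : pzdE η p ≤ Real.exp (δ * x) * pzdE δ p := by
    have : pzdE η p ≤ pzdE 0 p := pzdE_anti hη.le p
    refine this.trans_eq ?_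
    simp only [pzdE, ← Real.exp_add]; congr 1; rw [hx]; ring
  rcases le_or_gt (δ * x) 1 with h | h
  · have : x * pzdE η p ≤ Real.exp 1 * (x * pzdE δ p) := by
      calc x * pzdE η p ≤ x * (Real.exp 1 * pzdE δ p) := by
            gcongr
            exact hE.trans (by gcongr)
        _ = _ := by ring
    linarith
  rcases le_or_gt (δ * x) K with h' | h'
  · have hB : (δ * x) ^ (1 - γ) ≤ 1 + K ^ (1 - γ) := by
      rcases le_or_gt 0 (1 - γ) with hg | hg
      · have := Real.rpow_le_rpow (by positivity) h' hg
        linarith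
      · have := Real.rpow_le_one_of_one_le_of_nonpos h.le hg.le
        have : 0 < K ^ (1 - γ) := by positivity
        linarith
    have hxx : x = δ ^ (γ - 1) * (δ * x) ^ (1 - γ) * x ^ γ := by
      rw [Real.mul_rpow h0.le hxp.le]
      have a1 : δ ^ (γ - 1) * δ ^ (1 - γ) = 1 := by
        rw [← Real.rpow_add h0]; simp
      have a2 : x ^ (1 - γ) * x ^ γ = x := by
        rw [← Real.rpow_add hxp]; simp
      calc x = (δ ^ (γ - 1) * δ ^ (1 - γ)) * (x ^ (1 - γ) * x ^ γ) := by rw [a1, a2, one_mul]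
        _ = _ := by ring
    have : x * pzdE η p ≤
        ((1 + K ^ (1 - γ)) * Real.exp K * δ ^ (γ - 1)) * (x ^ γ * pzdE δ p) := by
      calc x * pzdE η p = (δ ^ (γ - 1) * (δ * x) ^ (1 - γ) * x ^ γ) * pzdE η p := by rw [← hxx]
        _ ≤ (δ ^ (γ - 1) * (1 + K ^ (1 - γ)) * x ^ γ) * (Real.exp K * pzdE δ p) := by
            gcongr
            exact hE.trans (by gcongr)
        _ = _ := by ring
    linarith
  · have : x * pzdE η p ≤ Real.exp (-(K * (η / δ) / 2)) * (x * pzdE (η / 2) p) := by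
      have h3 : pzdE η p = pzdE (η / 2) p * Real.exp (-(η / 2) * x) := by
        rw [hx, ← pzdE_add]; congr 1; ring
      have h4 : Real.exp (-(η / 2) * x) ≤ Real.exp (-(K * (η / δ) / 2)) := by
        apply Real.exp_le_exp.2
        have : K * (η / δ) ≤ η * x := by
          rw [← mul_div_assoc, div_le_iff₀ h0]
          nlinarith
        linarith
      rw [h3]
      calc x * (pzdE (η / 2) p * Real.exp (-(η / 2) * x))
          ≤ x * (pzdE (η / 2) p * Real.exp (-(K * (η / δ) / 2))) := by gcongr
        _ = _ := by ring
    linarith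

lemma pzd_real (γ : ℝ) (hγ : 0 < γ) :
    ∃ c : ℝ, 0 < c ∧ ∃ δ₀ : ℝ, 0 < δ₀ ∧ δ₀ ≤ 1 ∧ ∀ δ : ℝ, 0 < δ → δ ≤ δ₀ →
      Summable (fun p : Nat.Primes => Real.log (p:ℕ) ^ γ * pzdE δ p) ∧ ∀ t : ℝ,
      1 ≤ t → t ≤ Real.exp (1 / δ) →
      ∑' p : Nat.Primes, Real.log (p:ℕ) ^ γ * pzdE δ p * Real.cos (t * Real.log (p:ℕ))
        ≤ (1 - c) * ∑' p : Nat.Primes, Real.log (p:ℕ) ^ γ * pzdE δ p := by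
  obtain ⟨C, hC, hmain⟩ := pzd_main
  have hs : ∀ η : ℝ, 0 < η → η ≤ 1 →
      Summable (fun p : Nat.Primes => Real.log (p:ℕ) * pzdE η p) := by
    intro η h0 h1
    have := (hmain η h0 h1).1 0
    simpa [pzdE] using this
  have hb : ∀ η : ℝ, 0 < η → η ≤ 1 →
      ∑' p : Nat.Primes, Real.log (p:ℕ) * pzdE η p ≤ 1 / η + C :=
    fun η h0 h1 => (hmain η h0 h1).2.1
  obtain ⟨K', hK', hH⟩ := pzd_H hC hs hb hγ
  set K : ℝ := 128 * 255 with hK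
  set D : ℝ := (1 + K ^ (1 - γ)) * Real.exp K with hD
  have hDpos : 0 < D := by positivity
  set W : ℝ := 16 * 64 + 10 * C with hW
  have hWpos : 0 < W := by positivity
  refine ⟨1 / (D * K'), by positivity, 1 / W, by positivity, ?_, fun δ h0 hδ => ?_⟩
  · rw [div_le_one hWpos]; linarith
  have hWL : W ≤ 1 / δ := by
    rw [le_div_iff₀ h0]; rw [le_div_iff₀ hWpos] at hδ; linarith
  have h1 : δ ≤ 1 := hδ.trans (by rw [div_le_one hWpos]; linarith)
  obtain ⟨hHs, hHb⟩ := hH δ h0 h1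
  refine ⟨hHs, fun t ht hte => ?_⟩
  set L := 1 / δ with hL
  set η := δ / 64 with hη
  have hη0 : 0 < η := by positivity
  have hη1 : η ≤ 1 := by rw [hη]; linarith
  set v : Nat.Primes → ℝ := fun p => 1 - Real.cos (t * Real.log (p:ℕ)) with hv
  have hv0 : ∀ p, 0 ≤ v p := fun p => by simp only [hv]; linarith [Real.cos_le_one (t * Real.log (p:ℕ))]
  have hv2 : ∀ p, v p ≤ 2 := fun p => by
    simp only [hv]; linarith [Real.neg_one_le_cos (t * Real.log (p:ℕ))]
  have hcs : Summable (fun p : Nat.Primes => Real.log (p:ℕ) * pzdE η p * Real.cos (t * Real.log (p:ℕ))) := by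
    refine ((hmain η hη0 hη1).1 t).congr (fun p => ?_)
    simp only [pzdE]; ring
  have hlow : 32 * L - 16 * 64 - 2 * C ≤ ∑' p : Nat.Primes, Real.log (p:ℕ) * pzdE η p * v p := by
    have e : ∑' p : Nat.Primes, Real.log (p:ℕ) * pzdE η p * v p =
        ∑' p : Nat.Primes, Real.log (p:ℕ) * pzdE η p -
        ∑' p : Nat.Primes, Real.log (p:ℕ) * pzdE η p * Real.cos (t * Real.log (p:ℕ)) := by
      rw [← (hs η hη0 hη1).tsum_sub hcs]
      refine tsum_congr (fun p => ?_)
      simp only [hv]; ring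
    have a1 := (hmain η hη0 hη1).2.2.1
    have a2 := (hmain η hη0 hη1).2.2.2 t ht
    have e2 : ∑' p : Nat.Primes, Real.log (p:ℕ) * pzdE η p * Real.cos (t * Real.log (p:ℕ)) =
      ∑' p : Nat.Primes, Real.log (p:ℕ) *
      (Real.exp (-(1 + η) * Real.log (p:ℕ)) * Real.cos (t * Real.log (p:ℕ))) :=
      tsum_congr (fun p => by simp only [pzdE]; ring)
    have a3 : Real.log t ≤ L := (Real.log_le_iff_le_exp (by linarith)).2 hte
    have hLpos : 0 < L := by positivity
    have e3 : 1 / η = 64 * L := by rw [hη, hL]; field_simp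
    have a4 : Real.log (1 / η) ≤ 64 + L := by
      rw [e3, Real.log_mul (by norm_num) hLpos.ne']
      have b1 := Real.log_le_sub_one_of_pos (show (0:ℝ) < 64 by norm_num)
      have b2 := Real.log_le_sub_one_of_pos hLpos
      linarith
    rw [e, e2]
    change _ ≤ ∑' p : Nat.Primes, Real.log (p:ℕ) * Real.exp (-(1 + η) * Real.log (p:ℕ)) - _
    linarith
  have hgen : ∀ f : Nat.Primes → ℝ, (∀ p, 0 ≤ f p) → Summable f →
      Summable (fun p => f p * v p) ∧ ∑' p, f p * v p ≤ 2 * ∑' p, f p := by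
    intro f hf hfs
    have hle : ∀ p, f p * v p ≤ 2 * f p := fun p => by nlinarith [hf p, hv2 p]
    have hfv : Summable (fun p => f p * v p) :=
      Summable.of_nonneg_of_le (fun p => mul_nonneg (hf p) (hv0 p)) hle (hfs.mul_left 2)
    refine ⟨hfv, ?_⟩
    rw [← tsum_mul_left]
    exact hfv.tsum_le_tsum hle (hfs.mul_left 2)
  have hnn1 : ∀ (δ : ℝ) (p : Nat.Primes), 0 ≤ Real.log (p:ℕ) * pzdE δ p := fun δ p =>
    (mul_pos (pzd_log_pos p) (pzdE_pos δ p)).le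
  have hnn2 : ∀ p : Nat.Primes, 0 ≤ Real.log (p:ℕ) ^ γ * pzdE δ p := fun p =>
    (mul_pos (Real.rpow_pos_of_pos (pzd_log_pos p) _) (pzdE_pos δ p)).le
  obtain ⟨s1, b1⟩ := hgen _ (hnn1 δ) (hs δ h0 h1)
  obtain ⟨s2, b2⟩ := hgen _ (hnn1 (η/2)) (hs (η/2) (by positivity) (by linarith))
  obtain ⟨s3, -⟩ := hgen _ hnn2 hHs
  obtain ⟨s4, -⟩ := hgen _ (hnn1 η) (hs η hη0 hη1)
  set S := ∑' p : Nat.Primes, Real.log (p:ℕ) ^ γ * pzdE δ p * v p with hS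
  have hup : ∑' p : Nat.Primes, Real.log (p:ℕ) * pzdE η p * v p ≤
      D * δ ^ (γ - 1) * S
      + Real.exp 1 * ∑' p : Nat.Primes, Real.log (p:ℕ) * pzdE δ p * v p
      + Real.exp (-(K * (η / δ) / 2)) * ∑' p : Nat.Primes, Real.log (p:ℕ) * pzdE (η / 2) p * v p := by
    rw [hS, ← tsum_mul_left, ← tsum_mul_left, ← tsum_mul_left,
      ← (s3.mul_left _).tsum_add (s1.mul_left _),
      ← ((s3.mul_left _).add (s1.mul_left _)).tsum_add (s2.mul_left _)]
    refine s4.tsum_le_tsum (fun p => ?_)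
      (((s3.mul_left _).add (s1.mul_left _)).add (s2.mul_left _))
    have := mul_le_mul_of_nonneg_right
      (pzd_pointwise (γ := γ) h0 hη0 (show 1 ≤ K by rw [hK]; norm_num) p) (hv0 p)
    refine this.trans_eq ?_
    rw [hD]; ring
  have hexp : Real.exp (-(K * (η / δ) / 2)) ≤ 1 / 256 := by
    have e : K * (η / δ) / 2 = 255 := by rw [hη, hK]; field_simp; norm_num
    rw [e, Real.exp_neg, one_div]
    gcongr
    linarith [Real.add_one_le_exp (255:ℝ)]
  have he1 : Real.exp 1 ≤ 3 := by linarith [Real.exp_one_lt_d9]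
  have c1 := hb δ h0 h1
  have c2 := hb (η/2) (by positivity) (by linarith)
  have e4 : 1 / (η / 2) = 128 * L := by rw [hη, hL]; field_simp; norm_num
  rw [e4] at c2
  have hLpos : 0 < L := by positivity
  have d1 : Real.exp 1 * ∑' p : Nat.Primes, Real.log (p:ℕ) * pzdE δ p * v p ≤ 3 * (2 * (L + C)) := by
    refine mul_le_mul he1 (b1.trans ?_) (tsum_nonneg fun p => mul_nonneg (hnn1 _ p) (hv0 p))
      (by norm_num)
    gcongr
  have d2 : Real.exp (-(K * (η / δ) / 2)) *
      ∑' p : Nat.Primes, Real.log (p:ℕ) * pzdE (η / 2) p * v p ≤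
      1 / 256 * (2 * (128 * L + C)) := by
    refine mul_le_mul hexp (b2.trans ?_) (tsum_nonneg fun p => mul_nonneg (hnn1 _ p) (hv0 p))
      (by norm_num)
    gcongr
  have hfin : L ≤ D * δ ^ (γ - 1) * S := by
    have : 16 * 64 + 10 * C ≤ L := hWL
    linarith
  have hS2 : δ ^ (-γ) ≤ D * S := by
    have e5 : δ ^ (γ - 1) * δ ^ (-γ) = L := by
      rw [← Real.rpow_add h0, hL, one_div, ← Real.rpow_neg_one]; congr 1; ring
    have hp : 0 < δ ^ (γ - 1) := by positivity
    rw [← e5] at hfin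
    have : δ ^ (γ - 1) * δ ^ (-γ) ≤ δ ^ (γ - 1) * (D * S) := by linarith
    exact le_of_mul_le_mul_left this hp
  set T := ∑' p : Nat.Primes, Real.log (p:ℕ) ^ γ * pzdE δ p with hT
  have hTS : 1 / (D * K') * T ≤ S := by
    rw [one_div, ← div_eq_inv_mul, div_le_iff₀ (by positivity)]
    calc T ≤ K' * δ ^ (-γ) := hHb
      _ ≤ K' * (D * S) := by gcongr
      _ = _ := by ring
  have e6 : ∑' p : Nat.Primes, Real.log (p:ℕ) ^ γ * pzdE δ p * Real.cos (t * Real.log (p:ℕ)) =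
      T - S := by
    rw [hT, hS, ← hHs.tsum_sub s3]
    refine tsum_congr (fun p => ?_)
    simp only [hv]; ring
  rw [e6]; linarith

/-- **Decay of the real part of `G` on the moderate-`t` range:** for
`G(s) = Σ_p (log p)^γ / p^s` there is `c > 0` such that for all `σ > 1` sufficiently close
to `1` and all real `t` with `1 ≤ |t| ≤ e^{1/(σ−1)}`,
`Re G(σ + it) ≤ (1 − c) G(σ)`. -/
theorem prime_zeta_decay (γ : ℝ) (hγ : 0 < γ) :
    ∃ c : ℝ, 0 < c ∧ ∃ σ₀ : ℝ, 1 < σ₀ ∧ ∀ σ : ℝ, 1 < σ → σ ≤ σ₀ → ∀ t : ℝ,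
      1 ≤ |t| → |t| ≤ Real.exp (1 / (σ - 1)) →
      (∑' p : Nat.Primes,
          ((Real.log (p : ℕ) ^ γ : ℝ) : ℂ) / ((p : ℕ) : ℂ) ^ ((σ : ℂ) + t * Complex.I)).re
        ≤ (1 - c) * ∑' p : Nat.Primes, Real.log (p : ℕ) ^ γ / ((p : ℕ) : ℝ) ^ σ := by
  obtain ⟨c, hc, δ₀, hδ₀, -, h⟩ := pzd_real γ hγ
  refine ⟨c, hc, 1 + δ₀, by linarith, fun σ hσ hσ' t ht hte => ?_⟩
  obtain ⟨hsum, hcos⟩ := h (σ - 1) (by linarith) (by linarith)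
  have hE : ∀ p : Nat.Primes, (((p : ℕ) : ℝ) ^ σ)⁻¹ = pzdE (σ - 1) p := by
    intro p
    have hp : (0:ℝ) < ((p:ℕ):ℝ) := by exact_mod_cast p.2.pos
    rw [← Real.rpow_neg hp.le, Real.rpow_def_of_pos hp, pzdE]
    congr 1; ring
  have hR : ∑' p : Nat.Primes, Real.log (p : ℕ) ^ γ / ((p : ℕ) : ℝ) ^ σ =
      ∑' p : Nat.Primes, Real.log (p:ℕ) ^ γ * pzdE (σ - 1) p :=
    tsum_congr (fun p => by rw [div_eq_mul_inv, hE])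
  set s : ℂ := (σ : ℂ) + t * Complex.I with hs
  have hsre : s.re = σ := by simp [hs]
  have hsim : s.im = t := by simp [hs]
  have hsc : Summable (fun p : Nat.Primes =>
      ((Real.log (p : ℕ) ^ γ : ℝ) : ℂ) / ((p : ℕ) : ℂ) ^ s) := by
    refine Summable.of_norm (hsum.congr (fun p => ?_))
    have hp : (0:ℝ) < ((p:ℕ):ℝ) := by exact_mod_cast p.2.pos
    have hx := pzd_log_pos p
    rw [norm_div, norm_real, Real.norm_eq_abs, abs_of_pos (by positivity), ← ofReal_natCast,
      norm_cpow_eq_rpow_re_of_pos hp, hsre, div_eq_mul_inv, hE]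
  rw [Complex.re_tsum hsc, hR]
  refine le_trans (le_of_eq ?_) (hcos |t| ht hte)
  refine tsum_congr (fun p => ?_)
  have hp : (0:ℝ) < ((p:ℕ):ℝ) := by exact_mod_cast p.2.pos
  have hn0 : ((p:ℕ):ℂ) ≠ 0 := by exact_mod_cast p.2.ne_zero
  have hx := pzd_log_pos p
  rw [div_eq_mul_inv, re_ofReal_mul, ← cpow_neg, cpow_def_of_ne_zero hn0, ← natCast_log, exp_re,
    re_ofReal_mul, im_ofReal_mul, neg_re, neg_im, hsre, hsim, mul_assoc]
  congr 2
  · rw [pzdE]; congr 1; ring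
  · rw [← Real.cos_abs, mul_neg, abs_neg, abs_mul, abs_of_pos hx, mul_comm]
end

section
/- Quasi-subgroup property of near-maximizers of nonnegative cosine series: Let (a_n)_{n ≥ 1} be non-negative reals with Σ_n a_n < ∞, and define f(t) = Σ_{n ≥ 1} a_n·cos(t·log n) for t ∈ ℝ. Then for any 0 < ε < 1 and any t_1, t_2 ∈ ℝ with f(t_1) ≥ (1−ε)·f(0) and f(t_2) ≥ (1−ε)·f(0), we have f(t_1 − t_2) ≥ (1 − 8√ε)·f(0). -/
/-- **Quasi-subgroup property of near-maximizers of nonnegative cosine series:** let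
`a_n ≥ 0` with `Σ_{n ≥ 1} a_n < ∞` and `f(t) = Σ_{n ≥ 1} a_n cos(t log n)`. If
`f(t₁) ≥ (1−ε) f(0)` and `f(t₂) ≥ (1−ε) f(0)` for some `0 < ε < 1`, then
`f(t₁ − t₂) ≥ (1 − 8√ε) f(0)`. Here `f(0) = Σ_{n ≥ 1} a_n`. -/
theorem cosine_series_quasi_subgroup (a : ℕ → ℝ) (ha : ∀ n, 0 ≤ a n)
    (hsum : Summable fun n : ℕ => a (n + 1))
    (ε : ℝ) (hε0 : 0 < ε) (hε1 : ε < 1) (t₁ t₂ : ℝ)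
    (h1 : (1 - ε) * (∑' n : ℕ, a (n + 1)) ≤
      ∑' n : ℕ, a (n + 1) * Real.cos (t₁ * Real.log ((n : ℝ) + 1)))
    (h2 : (1 - ε) * (∑' n : ℕ, a (n + 1)) ≤
      ∑' n : ℕ, a (n + 1) * Real.cos (t₂ * Real.log ((n : ℝ) + 1))) :
    (1 - 8 * Real.sqrt ε) * (∑' n : ℕ, a (n + 1)) ≤
      ∑' n : ℕ, a (n + 1) * Real.cos ((t₁ - t₂) * Real.log ((n : ℝ) + 1)) := by
  have hs : ∀ t : ℝ, Summable fun n : ℕ => a (n + 1) * Real.cos (t * Real.log ((n : ℝ) + 1)) := by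
    intro t
    refine Summable.of_norm_bounded hsum ?_
    intro n
    rw [Real.norm_eq_abs, abs_mul, abs_of_nonneg (ha _)]
    exact mul_le_of_le_one_right (ha _) (Real.abs_cos_le_one _)
  have key : ∀ x y : ℝ, 2 * Real.cos x + 2 * Real.cos y - 3 ≤ Real.cos (x - y) := by
    intro x y
    rw [Real.cos_sub]
    nlinarith [sq_nonneg (Real.cos x + Real.cos y - 2), sq_nonneg (Real.sin x + Real.sin y),
      Real.sin_sq_add_cos_sq x, Real.sin_sq_add_cos_sq y]
  have hA : 0 ≤ ∑' n : ℕ, a (n + 1) := tsum_nonneg fun n => ha _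
  have hL := (((hs t₁).hasSum.mul_left 2).add ((hs t₂).hasSum.mul_left 2)).sub
    (hsum.hasSum.mul_left 3)
  have hle := hasSum_le (fun n => by
    have h := mul_le_mul_of_nonneg_left
      (key (t₁ * Real.log ((n : ℝ) + 1)) (t₂ * Real.log ((n : ℝ) + 1))) (ha (n + 1))
    rw [← sub_mul] at h
    linarith) hL (hs (t₁ - t₂)).hasSum
  have hsq : ε ≤ Real.sqrt ε := Real.le_sqrt_of_sq_le (by nlinarith)
  have h3 := mul_le_mul_of_nonneg_right hsq hA
  have h4 := mul_nonneg hε0.le hA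
  linarith
end
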